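/- Let (ρ, u, B) be a smooth solution of the isentropic compressible MHD system with Navier-slip boundary conditions on Ω. Then for every 2 ≤ p < ∞ there is a constant C depending only on p, μ, and Ω such that ‖∇u‖_{L^p} ≤ C(‖ρu̇‖_{L²} + ‖|B||∇B|‖_{L²})^{1−2/p}‖∇u‖_{L²}^{2/p} + C‖∇u‖_{L²} + (C/(2μ+λ))(‖P−P̄‖_{L^p} + ‖B‖²_{L^{2p}}) + (C/(2μ+λ))‖P−P̄‖_{L²}^{2/p}(‖ρu̇‖_{L²} + ‖∇u‖_{L²} + ‖|B||∇B|‖_{L²})^{1−2/p}. -/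

import Mathlib

noncomputable section

open MeasureTheory Real Set Filter Topology Bornology

/-- Points of the plane (with an equivalent norm to the Euclidean one). -/
abbrev V2 := Fin 2 → ℝ

namespace MHD

/-- `i`-th partial derivative of a scalar field. -/
def pd (i : Fin 2) (f : V2 → ℝ) (x : V2) : ℝ :=
  fderiv ℝ f x (Pi.single i 1)

/-- Gradient of a scalar field. -/
def grad (f : V2 → ℝ) (x : V2) : V2 := fun i => pd i f x

/-- Divergence of a planar vector field. -/
def div2 (u : V2 → V2) (x : V2) : ℝ := ∑ i, pd i (fun y => u y i) x

/-- (Scalar) curl of a planar vector field. -/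
def curl2 (u : V2 → V2) (x : V2) : ℝ :=
  pd 0 (fun y => u y 1) x - pd 1 (fun y => u y 0) x

/-- Laplacian of a scalar field. -/
def lap (f : V2 → ℝ) (x : V2) : ℝ := ∑ j, pd j (pd j f) x

/-- Euclidean inner product on the plane. -/
def dot (a b : V2) : ℝ := ∑ i, a i * b i

/-- Squared Euclidean norm on the plane. -/
def nsq (a : V2) : ℝ := ∑ i, (a i) ^ 2

/-- Rotation by -90 degrees : `perp (n¹,n²) = (n²,−n¹)`. -/
def perp (v : V2) : V2 := ![v 1, -(v 0)]

/-- Squared Frobenius norm of the spatial gradient of a vector field. -/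
def gnsq (u : V2 → V2) (x : V2) : ℝ := ∑ i, ∑ j, (pd j (fun y => u y i) x) ^ 2

/-- Squared Frobenius norm of the second spatial gradient of a vector field. -/
def g2nsq (u : V2 → V2) (x : V2) : ℝ :=
  ∑ i, ∑ j, ∑ k, (pd k (fun y => pd j (fun z => u z i) y) x) ^ 2

/-- `Lᵖ(Ω)` norm of a scalar field. -/
def LpS (p : ℝ) (Ω : Set V2) (f : V2 → ℝ) : ℝ :=
  (∫ x in Ω, |f x| ^ p) ^ (1 / p)

/-- `Lᵖ(Ω)` norm of a vector field (Euclidean norm pointwise). -/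
def LpV (p : ℝ) (Ω : Set V2) (u : V2 → V2) : ℝ :=
  (∫ x in Ω, (nsq (u x)) ^ (p / 2)) ^ (1 / p)

/-- `Lᵖ(Ω)` norm of the gradient of a vector field. -/
def LpG (p : ℝ) (Ω : Set V2) (u : V2 → V2) : ℝ :=
  (∫ x in Ω, (gnsq u x) ^ (p / 2)) ^ (1 / p)

/-- `Lᵖ(Ω)` norm of the second gradient of a vector field. -/
def LpG2 (p : ℝ) (Ω : Set V2) (u : V2 → V2) : ℝ :=
  (∫ x in Ω, (g2nsq u x) ^ (p / 2)) ^ (1 / p)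

/-- Average of a scalar field over `Ω`. -/
def avg (Ω : Set V2) (f : V2 → ℝ) : ℝ := (∫ x in Ω, f x) / (volume Ω).toReal

/-- Time derivative of a time dependent scalar field. -/
def dt (f : ℝ → V2 → ℝ) (t : ℝ) (x : V2) : ℝ := deriv (fun s => f s x) t

/-- Time derivative of a time dependent vector field. -/
def dtV (u : ℝ → V2 → V2) (t : ℝ) (x : V2) : V2 := fun i => dt (fun s y => u s y i) t x

/-- Material derivative `u̇ = u_t + (u·∇)u` of the velocity field itself. -/
def matD (u : ℝ → V2 → V2) (t : ℝ) (x : V2) : V2 := fun i =>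
  dt (fun s y => u s y i) t x + dot (u t x) (grad (fun y => u t y i) x)

/-- The material derivative `(div u)· = (div u)_t + u·∇ div u`. -/
def divdot (u : ℝ → V2 → V2) (t : ℝ) (x : V2) : ℝ :=
  deriv (fun s => div2 (u s) x) t + dot (u t x) (grad (fun y => div2 (u t) y) x)

/-- Average pressure `P̄` at time `t`. -/
def Pbar (Ω : Set V2) (a γ : ℝ) (ρ : ℝ → V2 → ℝ) (t : ℝ) : ℝ :=
  avg Ω (fun x => a * ρ t x ^ γ)

/-- Effective viscous flux `F = (2μ+λ) div u − (P − P̄) − |B|²/2`. -/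
def Fflux (Ω : Set V2) (a γ μ lam : ℝ) (ρ : ℝ → V2 → ℝ) (u B : ℝ → V2 → V2)
    (t : ℝ) (x : V2) : ℝ :=
  (2 * μ + lam) * div2 (u t) x - (a * ρ t x ^ γ - Pbar Ω a γ ρ t) - nsq (B t x) / 2

/-- Potential energy density `G(ρ)`. -/
def Gpot (a γ ρb : ℝ) (r : ℝ) : ℝ :=
  r * ∫ ξ in ρb..r, (a * ξ ^ γ - a * ρb ^ γ) / ξ ^ 2

/-- Initial total energy `C₀`. -/
def C0 (Ω : Set V2) (a γ : ℝ) (ρ₀ : V2 → ℝ) (u₀ B₀ : V2 → V2) : ℝ :=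
  ∫ x in Ω, (ρ₀ x * nsq (u₀ x) / 2 + nsq (B₀ x) / 2 + Gpot a γ (avg Ω ρ₀) (ρ₀ x))

/-- The time weight `σ(t) = min{1,t}`. -/
def tw (t : ℝ) : ℝ := min 1 t

/-- Smoothness (in time and space) of a time dependent scalar field. -/
def Smooth2 (f : ℝ → V2 → ℝ) : Prop := ContDiff ℝ (⊤ : ℕ∞) (fun p : ℝ × V2 => f p.1 p.2)

/-- Smoothness (in time and space) of a time dependent vector field. -/
def Smooth2V (u : ℝ → V2 → V2) : Prop := ∀ i, Smooth2 (fun t x => u t x i)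

/-- A bounded domain with smooth boundary, given by a smooth defining function `φ`,
with outward unit normal `n` on the boundary. -/
structure SmoothDomain (Ω : Set V2) (n : V2 → V2) : Prop where
  nonempty : Ω.Nonempty
  bounded : IsBounded Ω
  defining : ∃ φ : V2 → ℝ, ContDiff ℝ (⊤ : ℕ∞) φ ∧ Ω = {x | φ x < 0} ∧
      frontier Ω = {x | φ x = 0} ∧
      (∀ x ∈ frontier Ω, grad φ x ≠ 0) ∧
      (∀ x ∈ frontier Ω, n x = (Real.sqrt (nsq (grad φ x)))⁻¹ • grad φ x)

/-- Outward unit normal on the boundary of a convex domain, characterized by the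
supporting hyperplane property. -/
def ConvexOuterNormal (Ω : Set V2) (n : V2 → V2) : Prop :=
  ∀ x ∈ frontier Ω, nsq (n x) = 1 ∧ ∀ y ∈ closure Ω, dot (n x) (y - x) ≤ 0

/-- Membership in `H¹(Ω)` for (a smooth representative of) a vector field. -/
def InH1V (Ω : Set V2) (f : V2 → V2) : Prop :=
  (∀ i, Differentiable ℝ fun x => f x i) ∧
  IntegrableOn (fun x => nsq (f x)) Ω volume ∧ IntegrableOn (fun x => gnsq f x) Ω volume

/-- Classical (pointwise) solution of the isentropic compressible MHD system with
Navier-slip boundary conditions, for times in the set `I`. -/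
structure IsMHDSol (Ω : Set V2) (n : V2 → V2) (a γ μ lam ν : ℝ) (I : Set ℝ)
    (ρ : ℝ → V2 → ℝ) (u B : ℝ → V2 → V2) : Prop where
  mass : ∀ t ∈ I, ∀ x ∈ Ω,
    dt ρ t x + div2 (fun y j => ρ t y * u t y j) x = 0
  momentum : ∀ t ∈ I, ∀ x ∈ Ω, ∀ i,
    dt (fun s y => ρ s y * u s y i) t x
      + (∑ j, pd j (fun y => ρ t y * u t y i * u t y j) x)
      + pd i (fun y => a * ρ t y ^ γ) x
    = μ * lap (fun y => u t y i) x
      + (μ + lam) * pd i (fun y => div2 (u t) y) x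
      + dot (B t x) (grad (fun y => B t y i) x)
      - pd i (fun y => nsq (B t y)) x / 2
  magnetic : ∀ t ∈ I, ∀ x ∈ Ω, ∀ i,
    dt (fun s y => B s y i) t x + dot (u t x) (grad (fun y => B t y i) x)
      - dot (B t x) (grad (fun y => u t y i) x) + B t x i * div2 (u t) x
    = ν * lap (fun y => B t y i) x
  divB : ∀ t ∈ I, ∀ x ∈ Ω, div2 (B t) x = 0
  slipU : ∀ t ∈ I, ∀ x ∈ frontier Ω, dot (u t x) (n x) = 0 ∧ curl2 (u t) x = 0
  slipB : ∀ t ∈ I, ∀ x ∈ frontier Ω, dot (B t x) (n x) = 0 ∧ curl2 (B t) x = 0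



set_option maxHeartbeats 2000000 in
/-- second derivative algebra for the Bellman function -/
lemma bell_alg (x y a b ε α β s δ m X Y P T W Z : ℝ) (hε : 0 < ε) (hα : 1 < α) (hβ : β < 1)
    (hβ2 : 1 / 2 < β) (hs0 : 0 < s) (hs1 : s < 1) (hsα : (1 - s) * α = 1)
    (hm : m = 2 * β - 1) (hδ : δ = m / 64)
    (hX : X = ε + x ^ 2) (hY : Y = ε + y ^ 2) (hP : 0 < P) (hT : 0 < T) (hW : 0 < W)
    (hZ : Z = X * P + Y * T) (f1 : x ^ 2 * W ≤ 1) (f2 : |x| * |y| * T * W ≤ 1)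
    (f3 : 1 ≤ Z * W * T) :
    m / 8 * (|a| * |b|) ≤
      (2 * b ^ 2 * β * T + 4 * y ^ 2 * b ^ 2 * β * (β - 1) * (T / Y)) +
      δ * (2 * a ^ 2 * (Z * W) + 4 * x * a * s * W * (2 * x * a * α * P + 2 * y * b * β * T)
        + x ^ 2 * s * (s - 1) * (W / Z) * (2 * x * a * α * P + 2 * y * b * β * T) ^ 2
        + x ^ 2 * s * W * ((2 * a ^ 2 * α * P + 4 * x ^ 2 * a ^ 2 * α * (α - 1) * (P / X)) +
           (2 * b ^ 2 * β * T + 4 * y ^ 2 * b ^ 2 * β * (β - 1) * (T / Y)))) := by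
  have hm0 : 0 < m := by linarith
  have hm1 : m < 1 := by linarith
  have hδ0 : 0 < δ := by rw [hδ]; positivity
  have hX0 : 0 < X := by rw [hX]; positivity
  have hY0 : 0 < Y := by rw [hY]; positivity
  have hZ0 : 0 < Z := by rw [hZ]; positivity
  have hxX : x ^ 2 ≤ X := by rw [hX]; linarith
  have hyY : y ^ 2 ≤ Y := by rw [hY]; linarith
  -- Y2 bound
  have hyY' : y ^ 2 / Y ≤ 1 := by rw [div_le_one hY0]; exact hyY
  have hY2 : m * (b ^ 2 * T) ≤ 2 * b ^ 2 * β * T + 4 * y ^ 2 * b ^ 2 * β * (β - 1) * (T / Y) := by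
    have h1 : 4 * y ^ 2 * b ^ 2 * β * (β - 1) * (T / Y)
        = -(4 * b ^ 2 * T * β * (1 - β)) * (y ^ 2 / Y) := by ring
    rw [h1]
    have h2 : 0 ≤ 4 * b ^ 2 * T * β * (1 - β) := by
      have : 0 < 1 - β := by linarith
      positivity
    have h3 : (4 * b ^ 2 * T * β * (1 - β)) * (y ^ 2 / Y) ≤ 4 * b ^ 2 * T * β * (1 - β) :=
      mul_le_of_le_one_right h2 hyY'
    have h4 : 0 ≤ b ^ 2 * T := by positivity
    have h5 : 0 ≤ (b ^ 2 * T) * (m * (m)) := by positivity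
    have h6 : 2 * b ^ 2 * β * T - 4 * b ^ 2 * T * β * (1 - β) = (b ^ 2 * T) * (m + m*m) := by
      rw [hm]; ring
    linarith
  have hX2 : 0 ≤ 2 * a ^ 2 * α * P + 4 * x ^ 2 * a ^ 2 * α * (α - 1) * (P / X) := by
    have : 0 < α - 1 := by linarith
    positivity
  have hbT : 0 ≤ b ^ 2 * T := by positivity
  have hY2' : 0 ≤ 2 * b ^ 2 * β * T + 4 * y ^ 2 * b ^ 2 * β * (β - 1) * (T / Y) :=
    le_trans (by positivity) hY2
  -- square term
  have hsq : (2 * x * a * α * P + 2 * y * b * β * T) ^ 2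
      ≤ 2 * (2 * x * a * α * P) ^ 2 + 2 * (2 * y * b * β * T) ^ 2 := by
    linarith [sq_nonneg (2 * x * a * α * P - 2 * y * b * β * T)]
  have hxP : x ^ 2 * P ≤ Z := by
    rw [hZ]; linarith [mul_le_mul_of_nonneg_right hxX hP.le, mul_pos hY0 hT]
  have hyT : y ^ 2 * T ≤ Z := by
    rw [hZ]; linarith [mul_le_mul_of_nonneg_right hyY hT.le, mul_pos hX0 hP]
  have hxP' : x ^ 2 * P / Z ≤ 1 := by rw [div_le_one hZ0]; exact hxP
  have hyT' : y ^ 2 * T / Z ≤ 1 := by rw [div_le_one hZ0]; exact hyT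
  have hA : x ^ 2 * s * (1 - s) * (W / Z) * (2 * (2 * x * a * α * P) ^ 2)
      ≤ 4 * x * a * s * W * (2 * x * a * α * P) := by
    have e : x ^ 2 * s * (1 - s) * (W / Z) * (2 * (2 * x * a * α * P) ^ 2)
        = (8 * x ^ 2 * a ^ 2 * s * W * α * P) * ((1 - s) * α) * (x ^ 2 * P / Z) := by
      ring
    rw [e, hsα, mul_one]
    calc _ ≤ (8 * x ^ 2 * a ^ 2 * s * W * α * P) := mul_le_of_le_one_right (by positivity) hxP'
      _ = _ := by ring
  have hBq : x ^ 2 * s * (1 - s) * (W / Z) * (2 * (2 * y * b * β * T) ^ 2) ≤ 8 * (b ^ 2 * T) := by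
    have e : x ^ 2 * s * (1 - s) * (W / Z) * (2 * (2 * y * b * β * T) ^ 2)
        = (8 * (b ^ 2 * T)) * ((x ^ 2 * W) * ((y ^ 2 * T / Z) * (s * ((1 - s) * (β * β))))) := by
      ring
    rw [e]
    have hs' : 0 < 1 - s := by linarith
    have hβ0 : 0 < β := by linarith
    refine mul_le_of_le_one_right (by positivity) ?_
    refine mul_le_one₀ f1 (by positivity) ?_
    refine mul_le_one₀ hyT' (by positivity) ?_
    refine mul_le_one₀ hs1.le (by positivity) ?_
    refine mul_le_one₀ (by linarith) (by positivity) ?_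
    exact mul_le_one₀ hβ.le hβ0.le hβ.le
  have hC : -(8 * (|a| * |b|)) ≤ 4 * x * a * s * W * (2 * y * b * β * T) := by
    have e : 4 * x * a * s * W * (2 * y * b * β * T) = 8 * (s * β) * ((x * y * T * W) * (a * b)) := by ring
    have h1 : |4 * x * a * s * W * (2 * y * b * β * T)| ≤ 8 * (|a| * |b|) := by
      rw [e, abs_mul, abs_mul, abs_mul (a := x*y*T*W), abs_mul (a:=a), abs_of_pos (show (0:ℝ)<8 by norm_num)]
      have h2 : |x * y * T * W| ≤ 1 := by
        rw [abs_mul, abs_mul, abs_mul, abs_of_pos hT, abs_of_pos hW]; exact f2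
      have h3 : |s * β| ≤ 1 := by
        have hb0 : 0 < β := by linarith
        rw [abs_of_pos (by positivity)]; exact mul_le_one₀ hs1.le hb0.le hβ.le
      have h4 : |s*β| * (|x*y*T*W| * (|a| * |b|)) ≤ 1 * (1 * (|a| * |b|)) := by gcongr
      linarith
    exact (abs_le.mp h1).1
  have hD : x ^ 2 * s * (s - 1) * (W / Z) * (2 * x * a * α * P + 2 * y * b * β * T) ^ 2
      ≥ - (x ^ 2 * s * (1 - s) * (W / Z) * (2 * (2 * x * a * α * P) ^ 2)
        + x ^ 2 * s * (1 - s) * (W / Z) * (2 * (2 * y * b * β * T) ^ 2)) := by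
    have hs' : 0 < 1 - s := by linarith
    have : 0 ≤ x ^ 2 * s * (1 - s) * (W / Z) := by positivity
    linarith [mul_le_mul_of_nonneg_left hsq this]
  have hE : 0 ≤ x ^ 2 * s * W * ((2 * a ^ 2 * α * P + 4 * x ^ 2 * a ^ 2 * α * (α - 1) * (P / X)) +
           (2 * b ^ 2 * β * T + 4 * y ^ 2 * b ^ 2 * β * (β - 1) * (T / Y))) := by positivity
  -- key quadratic
  have hF : 2 * δ * a ^ 2 * (Z * W) + (m / 2) * (b ^ 2 * T) ≥ (m / 4) * (|a| * |b|) := by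
    have h1 : a ^ 2 * (1 / T) ≤ a ^ 2 * (Z * W) := by
      apply mul_le_mul_of_nonneg_left _ (sq_nonneg a)
      rw [div_le_iff₀ hT]; linarith
    have h3 : 0 ≤ (|a| - 4 * |b| * T) ^ 2 / T := by positivity
    have h4 : (|a| - 4 * |b| * T) ^ 2 / T = a^2 * (1/T) - 8 * (|a| * |b|) + 16 * (b^2 * T) := by
      field_simp
      rw [← sq_abs a, ← sq_abs b]; ring
    rw [h4] at h3
    rw [hδ]
    have h5 := mul_nonneg hm0.le (show 0 ≤ a^2 * (Z*W) - 8 * (|a| * |b|) + 16 * (b^2 * T) by linarith)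
    linarith
  have hG : 4 * x * a * s * W * (2 * x * a * α * P + 2 * y * b * β * T) =
     4 * x * a * s * W * (2 * x * a * α * P) + 4 * x * a * s * W * (2 * y * b * β * T) := by ring
  have hab : 0 ≤ |a| * |b| := by positivity
  have hH : 2 * a ^ 2 * (Z * W) - 8 * (|a| * |b|) - 8 * (b^2 * T) ≤ 2 * a ^ 2 * (Z * W) + 4 * x * a * s * W * (2 * x * a * α * P + 2 * y * b * β * T)
        + x ^ 2 * s * (s - 1) * (W / Z) * (2 * x * a * α * P + 2 * y * b * β * T) ^ 2
        + x ^ 2 * s * W * ((2 * a ^ 2 * α * P + 4 * x ^ 2 * a ^ 2 * α * (α - 1) * (P / X)) +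
           (2 * b ^ 2 * β * T + 4 * y ^ 2 * b ^ 2 * β * (β - 1) * (T / Y))) := by
    rw [hG]; linarith
  have hI := mul_le_mul_of_nonneg_left hH hδ0.le
  refine le_trans ?_ (add_le_add hY2 hI)
  have : δ * (2 * a ^ 2 * (Z * W) - 8 * (|a| * |b|) - 8 * (b^2 * T)) = 2 * δ * a ^ 2 * (Z * W) - m / 8 * (|a| * |b|) - m / 8 * (b^2*T) := by
    rw [hδ]; ring
  rw [this]
  linarith [mul_nonneg hm0.le hbT]

/-- midpoint gain from a lower bound of the second derivative -/
lemma midpoint_gain (f f1 f2 : ℝ → ℝ) (κ : ℝ) (h1 : ∀ s, HasDerivAt f (f1 s) s)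
    (h2 : ∀ s, HasDerivAt f1 (f2 s) s) (h3 : ∀ s, κ ≤ f2 s) :
    f (1 / 2) ≤ (f 0 + f 1) / 2 - κ / 8 := by
  have hc : ConvexOn ℝ univ (fun s => f s - κ * s ^ 2 / 2) := by
    have d1 : ∀ s, HasDerivAt (fun s => f s - κ * s ^ 2 / 2) (f1 s - κ * s) s := by
      intro s
      have := (h1 s).sub (((hasDerivAt_pow 2 s).const_mul κ).div_const 2)
      exact this.congr_deriv (by simp; ring)
    have d2 : ∀ s, HasDerivAt (fun s => f1 s - κ * s) (f2 s - κ) s := by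
      intro s
      have := (h2 s).sub ((hasDerivAt_id s).const_mul κ)
      exact this.congr_deriv (by simp)
    have e1 : deriv (fun s => f s - κ * s ^ 2 / 2) = fun s => f1 s - κ * s := by
      ext s; exact (d1 s).deriv
    apply convexOn_univ_of_deriv2_nonneg
    · intro s; exact (d1 s).differentiableAt
    · rw [e1]; intro s; exact (d2 s).differentiableAt
    · intro s
      simp only [Function.iterate_succ, Function.iterate_zero, Function.comp, id]
      rw [e1, (d2 s).deriv]; linarith [h3 s]
  have := hc.2 (mem_univ 0) (mem_univ 1) (show (0:ℝ) ≤ 1/2 by norm_num) (show (0:ℝ) ≤ 1/2 by norm_num) (by norm_num)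
  simp at this
  norm_num at this ⊢
  linarith

/-- regularized Bellman function -/
def bellE (ε α β s δ x y : ℝ) : ℝ :=
  (ε + y ^ 2) ^ β + δ * (x ^ 2 * ((ε + x ^ 2) ^ α + (ε + y ^ 2) ^ β) ^ s)

lemma bellE_mid (ε α β s δ m : ℝ) (hε : 0 < ε) (hα : 1 < α) (hβ : β < 1)
    (hβ2 : 1 / 2 < β) (hs0 : 0 < s) (hs1 : s < 1) (hsα : (1 - s) * α = 1)
    (hm : m = 2 * β - 1) (hδ : δ = m / 64) (hsβ : β * s = 1 - β)
    (x y x' y' : ℝ) :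
    bellE ε α β s δ ((x + x') / 2) ((y + y') / 2) ≤
      (bellE ε α β s δ x y + bellE ε α β s δ x' y') / 2 - m / 64 * (|x - x'| * |y - y'|) := by
  set a := x' - x
  set b := y' - y
  let X : ℝ → ℝ := fun t => x + t * a
  let Y : ℝ → ℝ := fun t => y + t * b
  have hX : ∀ t, HasDerivAt X a t := fun t => by
    exact (((hasDerivAt_id t).mul_const a).const_add x).congr_deriv (by simp)
  have hY : ∀ t, HasDerivAt Y b t := fun t => by
    exact (((hasDerivAt_id t).mul_const b).const_add y).congr_deriv (by simp)
  let Xs : ℝ → ℝ := fun t => ε + X t ^ 2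
  let Ys : ℝ → ℝ := fun t => ε + Y t ^ 2
  have hXs0 : ∀ t, 0 < Xs t := fun t => by positivity
  have hYs0 : ∀ t, 0 < Ys t := fun t => by positivity
  have hXs : ∀ t, HasDerivAt Xs (2 * X t * a) t := fun t => by
    exact (((hX t).pow 2).const_add ε).congr_deriv (by simp)
  have hYs : ∀ t, HasDerivAt Ys (2 * Y t * b) t := fun t => by
    exact (((hY t).pow 2).const_add ε).congr_deriv (by simp)
  have rp : ∀ (F F' : ℝ → ℝ) (r t : ℝ), 0 < F t → HasDerivAt F (F' t) t →
      HasDerivAt (fun t => F t ^ r) (F' t * r * F t ^ (r - 1)) t := fun F F' r t h0 h =>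
    h.rpow_const (Or.inl h0.ne')
  let Z : ℝ → ℝ := fun t => Xs t ^ α + Ys t ^ β
  have hZ0 : ∀ t, 0 < Z t := fun t =>
    add_pos (rpow_pos_of_pos (hXs0 t) _) (rpow_pos_of_pos (hYs0 t) _)
  let X1 : ℝ → ℝ := fun t => 2 * X t * a * α * Xs t ^ (α - 1)
  let Y1 : ℝ → ℝ := fun t => 2 * Y t * b * β * Ys t ^ (β - 1)
  let X2 : ℝ → ℝ := fun t => 2 * a * a * α * Xs t ^ (α - 1)
    + 2 * X t * a * α * (2 * X t * a * (α - 1) * Xs t ^ (α - 1 - 1))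
  let Y2 : ℝ → ℝ := fun t => 2 * b * b * β * Ys t ^ (β - 1)
    + 2 * Y t * b * β * (2 * Y t * b * (β - 1) * Ys t ^ (β - 1 - 1))
  have hXa : ∀ t, HasDerivAt (fun t => Xs t ^ α) (X1 t) t := fun t =>
    rp Xs (fun t => 2 * X t * a) α t (hXs0 t) (hXs t)
  have hYa : ∀ t, HasDerivAt (fun t => Ys t ^ β) (Y1 t) t := fun t =>
    rp Ys (fun t => 2 * Y t * b) β t (hYs0 t) (hYs t)
  have hX1 : ∀ t, HasDerivAt X1 (X2 t) t := fun t => by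
    have h := ((((hX t).const_mul 2).mul_const a).mul_const α).mul
      (rp Xs (fun t => 2 * X t * a) (α - 1) t (hXs0 t) (hXs t))
    exact h
  have hY1 : ∀ t, HasDerivAt Y1 (Y2 t) t := fun t => by
    have h := ((((hY t).const_mul 2).mul_const b).mul_const β).mul
      (rp Ys (fun t => 2 * Y t * b) (β - 1) t (hYs0 t) (hYs t))
    exact h
  have hZ : ∀ t, HasDerivAt Z (X1 t + Y1 t) t := fun t => (hXa t).add (hYa t)
  have hZs : ∀ r t, HasDerivAt (fun t => Z t ^ r) ((X1 t + Y1 t) * r * Z t ^ (r - 1)) t := fun r t =>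
    rp Z (fun t => X1 t + Y1 t) r t (hZ0 t) (hZ t)
  have hXsq : ∀ t, HasDerivAt (fun t => X t ^ 2) (2 * X t * a) t := fun t => by
    exact ((hX t).pow 2).congr_deriv (by simp)
  have key := midpoint_gain (fun t => Ys t ^ β + δ * (X t ^ 2 * Z t ^ s))
    (fun t => Y1 t + δ * (2 * X t * a * Z t ^ s + X t ^ 2 * ((X1 t + Y1 t) * s * Z t ^ (s - 1))))
    (fun t => Y2 t + δ * ((2 * a * a * Z t ^ s + 2 * X t * a * ((X1 t + Y1 t) * s * Z t ^ (s - 1)))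
      + (2 * X t * a * ((X1 t + Y1 t) * s * Z t ^ (s - 1)) +
        X t ^ 2 * ((X2 t + Y2 t) * s * Z t ^ (s - 1) + (X1 t + Y1 t) * s * ((X1 t + Y1 t) * (s - 1) * Z t ^ (s - 1 - 1))))))
    (m / 8 * (|a| * |b|))
    (fun t => (hYa t).add (((hXsq t).mul (hZs s t)).const_mul δ))
    (fun t => (hY1 t).add ((((((hX t).const_mul 2).mul_const a).mul (hZs s t)).add
      ((hXsq t).mul ((((hX1 t).add (hY1 t)).mul_const s).mul (hZs (s - 1) t)))).const_mul δ))
    (fun t => by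
      have e1 : Xs t ^ (α - 1 - 1) = Xs t ^ (α - 1) / Xs t := by
        rw [rpow_sub_one (hXs0 t).ne' (α - 1)]
      have e2 : Ys t ^ (β - 1 - 1) = Ys t ^ (β - 1) / Ys t := by
        rw [rpow_sub_one (hYs0 t).ne' (β - 1)]
      have e3 : Z t ^ (s - 1 - 1) = Z t ^ (s - 1) / Z t := by
        rw [rpow_sub_one (hZ0 t).ne' (s - 1)]
      have e4 : Z t ^ s = Z t * Z t ^ (s - 1) := by
        rw [rpow_sub_one (hZ0 t).ne' s]; field_simp [(hZ0 t).ne']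
      have e5 : Xs t ^ α = Xs t * Xs t ^ (α - 1) := by
        rw [rpow_sub_one (hXs0 t).ne' α]; field_simp [(hXs0 t).ne']
      have e6 : Ys t ^ β = Ys t * Ys t ^ (β - 1) := by
        rw [rpow_sub_one (hYs0 t).ne' β]; field_simp [(hYs0 t).ne']
      have hαX : Xs t ^ α ≤ Z t := le_add_of_nonneg_right (rpow_nonneg (hYs0 t).le _)
      have hβY : Ys t ^ β ≤ Z t := le_add_of_nonneg_left (rpow_nonneg (hXs0 t).le _)
      have hα0 : 0 < α := by linarith
      have hβ0 : 0 < β := by linarith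
      have hXZ : Xs t ≤ Z t ^ (1 - s) := by
        have h := rpow_le_rpow (rpow_nonneg (hXs0 t).le _) hαX (show 0 ≤ 1 - s by linarith)
        rwa [← rpow_mul (hXs0 t).le, mul_comm α, hsα, rpow_one] at h
      have hYZ : Ys t ^ (2 * β - 1) ≤ Z t ^ (1 - s) := by
        have h := rpow_le_rpow (rpow_nonneg (hYs0 t).le _) hβY (show 0 ≤ 1 - s by linarith)
        rw [← rpow_mul (hYs0 t).le] at h
        have : β * (1 - s) = 2 * β - 1 := by linarith
        rwa [this] at h
      have hZZ : Z t ^ (1 - s) * Z t ^ (s - 1) = 1 := by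
        rw [← rpow_add (hZ0 t)]; simp
      have hWp : 0 < Z t ^ (s - 1) := rpow_pos_of_pos (hZ0 t) _
      have g1 : Xs t * Z t ^ (s - 1) ≤ 1 := by
        calc Xs t * Z t ^ (s - 1) ≤ Z t ^ (1 - s) * Z t ^ (s - 1) := by gcongr
          _ = 1 := hZZ
      have f1 : X t ^ 2 * Z t ^ (s - 1) ≤ 1 := by
        refine le_trans ?_ g1
        gcongr
        show X t ^ 2 ≤ ε + X t ^ 2
        linarith
      have hTp : 0 < Ys t ^ (β - 1) := rpow_pos_of_pos (hYs0 t) _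
      have g2 : Y t ^ 2 * (Ys t ^ (β - 1)) ^ 2 * Z t ^ (s - 1) ≤ 1 := by
        refine le_trans ?_ hZZ.le
        gcongr
        refine le_trans ?_ hYZ
        have : Ys t ^ (2 * β - 1) = Ys t * (Ys t ^ (β - 1)) ^ 2 := by
          have h1 : Ys t * (Ys t ^ (β - 1)) ^ 2 = Ys t ^ (1:ℝ) * (Ys t ^ (β - 1) * Ys t ^ (β - 1)) := by
            rw [rpow_one]; ring
          rw [h1, ← rpow_add (hYs0 t), ← rpow_add (hYs0 t)]
          congr 1; ring
        rw [this]; gcongr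
        show Y t ^ 2 ≤ ε + Y t ^ 2
        linarith
      have f2 : |X t| * |Y t| * Ys t ^ (β - 1) * Z t ^ (s - 1) ≤ 1 := by
        have h : (|X t| * |Y t| * Ys t ^ (β - 1) * Z t ^ (s - 1)) ^ 2 ≤ 1 := by
          have : (|X t| * |Y t| * Ys t ^ (β - 1) * Z t ^ (s - 1)) ^ 2 =
            (X t ^ 2 * Z t ^ (s - 1)) * (Y t ^ 2 * (Ys t ^ (β - 1)) ^ 2 * Z t ^ (s - 1)) := by
            rw [← sq_abs (X t), ← sq_abs (Y t)]; ring
          rw [this]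
          exact mul_le_one₀ f1 (by positivity) g2
        have h0 : 0 ≤ |X t| * |Y t| * Ys t ^ (β - 1) * Z t ^ (s - 1) := by positivity
        nlinarith
      have f3 : 1 ≤ Z t * Z t ^ (s - 1) * Ys t ^ (β - 1) := by
        rw [← e4]
        have h := rpow_le_rpow (rpow_nonneg (hYs0 t).le _) hβY hs0.le
        rw [← rpow_mul (hYs0 t).le, hsβ] at h
        calc (1:ℝ) = Ys t ^ (1 - β) * Ys t ^ (β - 1) := by
              rw [← rpow_add (hYs0 t)]; simp
          _ ≤ _ := by gcongr
      have := bell_alg (X t) (Y t) a b ε α β s δ m (Xs t) (Ys t) (Xs t ^ (α - 1)) (Ys t ^ (β - 1))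
        (Z t ^ (s - 1)) (Z t) hε hα hβ hβ2 hs0 hs1 hsα hm hδ rfl rfl
        (rpow_pos_of_pos (hXs0 t) _) hTp hWp (by rw [← e5, ← e6]) f1 f2 f3
      refine this.trans (le_of_eq ?_)
      simp only [X1, Y1, X2, Y2, e1, e2, e3, e4]
      ring)
  have ha : |x - x'| = |a| := abs_sub_comm _ _
  have hb : |y - y'| = |b| := abs_sub_comm _ _
  rw [ha, hb]
  have t0 : X 0 = x ∧ Y 0 = y := by simp [X, Y]
  have t1 : X 1 = x' ∧ Y 1 = y' := by simp [X, Y, a, b]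
  have th : X (1/2) = (x + x')/2 ∧ Y (1/2) = (y+y')/2 := by
    constructor <;> simp only [X, Y, a, b] <;> ring
  simp only [Z, Xs, Ys, t0.1, t0.2, t1.1, t1.2, th.1, th.2] at key
  unfold bellE
  linarith

lemma bellE_mid0 (α β s δ m : ℝ) (hα : 1 < α) (hβ : β < 1)
    (hβ2 : 1 / 2 < β) (hs0 : 0 < s) (hs1 : s < 1) (hsα : (1 - s) * α = 1)
    (hm : m = 2 * β - 1) (hδ : δ = m / 64) (hsβ : β * s = 1 - β)
    (x y x' y' : ℝ) :
    bellE 0 α β s δ ((x + x') / 2) ((y + y') / 2) ≤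
      (bellE 0 α β s δ x y + bellE 0 α β s δ x' y') / 2 - m / 64 * (|x - x'| * |y - y'|) := by
  have hc : ∀ x y, Continuous (fun ε => bellE ε α β s δ x y) := by
    intro x y
    unfold bellE
    have c1 : Continuous (fun ε : ℝ => (ε + y ^ 2) ^ β) :=
      Continuous.rpow_const (by fun_prop) (fun _ => Or.inr (by linarith))
    have c2 : Continuous (fun ε : ℝ => (ε + x ^ 2) ^ α) :=
      Continuous.rpow_const (by fun_prop) (fun _ => Or.inr (by linarith))
    exact c1.add (continuous_const.mul (continuous_const.mul
      ((c2.add c1).rpow_const (fun _ => Or.inr hs0.le))))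
  have hlim : ∀ x y, Tendsto (fun ε => bellE ε α β s δ x y) (𝓝[>] 0) (𝓝 (bellE 0 α β s δ x y)) :=
    fun x y => ((hc x y).tendsto 0).mono_left nhdsWithin_le_nhds
  refine le_of_tendsto_of_tendsto (hlim _ _)
    ((((hlim x y).add (hlim x' y')).div_const 2).sub_const _) ?_
  filter_upwards [self_mem_nhdsWithin] with ε hε
  exact bellE_mid ε α β s δ m hε hα hβ hβ2 hs0 hs1 hsα hm hδ hsβ x y x' y'

lemma exists_bellman (p q : ℝ) (hp : 2 < p) (hq : q = p / (p - 1)) :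
    ∃ (Bf : ℝ → ℝ → ℝ) (c K : ℝ), 0 < c ∧ 0 < K ∧ Continuous (fun z : ℝ × ℝ => Bf z.1 z.2) ∧
      (∀ x y, 0 ≤ Bf x y) ∧ (∀ x y, Bf x y ≤ K * (|x| ^ p + |y| ^ q)) ∧
      (∀ x y x' y', Bf ((x + x') / 2) ((y + y') / 2) ≤
        (Bf x y + Bf x' y') / 2 - c * (|x - x'| * |y - y'|)) := by
  have hp1 : 0 < p - 1 := by linarith
  have hqp : q * (p - 1) = p := by rw [hq]; field_simp
  have hq1 : 1 < q := by nlinarith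
  have hq2 : q < 2 := by nlinarith
  have hpq : p * (q - 1) = q := by linarith
  have hs : (1 - (2 - q) / q) * (p / 2) = 1 := by field_simp; linarith
  have hs0 : 0 < (2 - q) / q := by apply div_pos <;> linarith
  have hs1 : (2 - q) / q < 1 := by rw [div_lt_one] <;> linarith
  have hm0 : 0 < 2 * (q / 2) - 1 := by linarith
  set s := (2 - q) / q with hsdef
  set δ := (2 * (q / 2) - 1) / 64 with hδ
  have hδ0 : 0 < δ := by positivity
  refine ⟨bellE 0 (p / 2) (q / 2) s δ, (2 * (q / 2) - 1) / 64, 1 + δ, by positivity, by positivity, ?_, ?_, ?_, ?_⟩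
  · unfold bellE
    have c1 : Continuous (fun z : ℝ × ℝ => (0 + z.2 ^ 2) ^ (q / 2)) :=
      Continuous.rpow_const (by fun_prop) (fun _ => Or.inr (by linarith))
    have c2 : Continuous (fun z : ℝ × ℝ => (0 + z.1 ^ 2) ^ (p / 2)) :=
      Continuous.rpow_const (by fun_prop) (fun _ => Or.inr (by linarith))
    exact c1.add (continuous_const.mul ((continuous_fst.pow 2).mul
      ((c2.add c1).rpow_const (fun _ => Or.inr hs0.le))))
  · intro x y; unfold bellE; positivity
  · intro x y
    unfold bellE
    have e : ∀ (w r : ℝ), (0 + w ^ 2) ^ (r / 2) = |w| ^ r := by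
      intro w r
      rw [zero_add, ← sq_abs, ← rpow_natCast, ← rpow_mul (abs_nonneg w)]
      congr 1; push_cast; ring
    rw [e, e]
    set Z := |x| ^ p + |y| ^ q
    have hZ0 : 0 ≤ Z := by positivity
    have hx2 : x ^ 2 ≤ Z ^ (1 - s) := by
      have h : |x| ^ p ≤ Z := le_add_of_nonneg_right (by positivity)
      have h2 := rpow_le_rpow (by positivity) h (show 0 ≤ 1 - s by linarith)
      rw [← rpow_mul (abs_nonneg x)] at h2
      have : p * (1 - s) = (2:ℕ) := by push_cast; linarith
      rwa [this, rpow_natCast, sq_abs] at h2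
    have hZs : x ^ 2 * Z ^ s ≤ Z := by
      calc x ^ 2 * Z ^ s ≤ Z ^ (1 - s) * Z ^ s := by gcongr
        _ = Z := by
          rw [← rpow_add_of_nonneg hZ0 (by linarith) hs0.le]; simp
    have : |y| ^ q ≤ Z := le_add_of_nonneg_left (by positivity)
    nlinarith [mul_le_mul_of_nonneg_left hZs hδ0.le]
  · exact bellE_mid0 (p / 2) (q / 2) s δ _ (by linarith) (by linarith) (by linarith) hs0 hs1 hs rfl hδ
      (by rw [hsdef]; field_simp)


/-- continuous compactly supported functions -/
def CC (f : V2 → ℝ) : Prop := Continuous f ∧ HasCompactSupport f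

/-- shift -/
def sh (e : V2) (f : V2 → ℝ) : V2 → ℝ := fun x => f (x + e)

/-- difference -/
def Fd (e : V2) (f : V2 → ℝ) : V2 → ℝ := fun x => f (x + e) - f x

/-- averaging operator -/
def Av (d e : V2) (f : V2 → ℝ) : V2 → ℝ := fun x =>
  f x / 2 + (f (x + d) + f (x + -d) + f (x + e) + f (x + -e)) / 8

lemma CC.cont {f : V2 → ℝ} (h : CC f) : Continuous f := h.1

lemma CC.integrable {f : V2 → ℝ} (h : CC f) : Integrable f := h.1.integrable_of_hasCompactSupport h.2

lemma CC.sh {f : V2 → ℝ} (h : CC f) (e : V2) : CC (sh e f) :=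
  ⟨h.1.comp (continuous_id.add continuous_const), h.2.comp_homeomorph (Homeomorph.addRight e)⟩

lemma CC.comp {f : V2 → ℝ} (h : CC f) {φ : ℝ → ℝ} (hφ : Continuous φ) (h0 : φ 0 = 0) :
    CC (fun x => φ (f x)) := ⟨hφ.comp h.1, h.2.comp_left h0⟩

lemma CC.add {f g : V2 → ℝ} (h : CC f) (h' : CC g) : CC (fun x => f x + g x) :=
  ⟨h.1.add h'.1, h.2.add h'.2⟩

lemma CC.neg {f : V2 → ℝ} (h : CC f) : CC (fun x => - f x) :=
  h.comp continuous_neg neg_zero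

lemma CC.sub {f g : V2 → ℝ} (h : CC f) (h' : CC g) : CC (fun x => f x - g x) := by
  simpa [sub_eq_add_neg] using h.add h'.neg

lemma CC.mul {f g : V2 → ℝ} (h : CC f) (h' : CC g) : CC (fun x => f x * g x) :=
  ⟨h.1.mul h'.1, h.2.mul_right⟩

lemma CC.smul {f : V2 → ℝ} (h : CC f) (c : ℝ) : CC (fun x => c * f x) :=
  h.comp (continuous_const.mul continuous_id) (mul_zero c)

lemma CC.abs {f : V2 → ℝ} (h : CC f) : CC (fun x => |f x|) := h.comp continuous_abs abs_zero

lemma CC.abspow {f : V2 → ℝ} (h : CC f) {p : ℝ} (hp : 0 < p) : CC (fun x => |f x| ^ p) :=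
  h.comp (φ := fun t => |t| ^ p) (continuous_abs.rpow_const (fun _ => Or.inr hp.le))
    (by simp [hp.ne'])

lemma CC.comp₂ {f g : V2 → ℝ} (h : CC f) (h' : CC g) {φ : ℝ → ℝ → ℝ}
    (hφ : Continuous (fun z : ℝ × ℝ => φ z.1 z.2)) (h0 : φ 0 0 = 0) :
    CC (fun x => φ (f x) (g x)) :=
  ⟨hφ.comp (h.1.prodMk h'.1), h.2.comp₂_left h'.2 h0⟩

lemma CC.Fd {f : V2 → ℝ} (h : CC f) (e : V2) : CC (Fd e f) := (h.sh e).sub h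

lemma CC.Av {f : V2 → ℝ} (h : CC f) (d e : V2) : CC (Av d e f) := by
  have := (h.smul (1/2)).add (((((h.sh d).add (h.sh (-d))).add (h.sh e)).add (h.sh (-e))).smul (1/8))
  convert this using 2
  unfold MHD.Av MHD.sh; ring

lemma CC.iter {f : V2 → ℝ} (h : CC f) (d e : V2) (n : ℕ) : CC ((MHD.Av d e)^[n] f) := by
  induction n with
  | zero => exact h
  | succ n ih => rw [Function.iterate_succ_apply']; exact ih.Av d e

lemma int_sh (e : V2) (f : V2 → ℝ) : ∫ x, f (x + e) = ∫ x, f x := integral_add_right_eq_self f e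

lemma int5 {f0 f1 f2 f3 f4 : V2 → ℝ} (h0 : Integrable f0) (h1 : Integrable f1) (h2 : Integrable f2)
    (h3 : Integrable f3) (h4 : Integrable f4) :
    ∫ x, (f0 x / 2 + (f1 x + f2 x + f3 x + f4 x) / 8) =
      (∫ x, f0 x) / 2 + ((∫ x, f1 x) + (∫ x, f2 x) + (∫ x, f3 x) + (∫ x, f4 x)) / 8 := by
  have a1 : Integrable (fun x => f1 x + f2 x) := h1.add h2
  have a2 : Integrable (fun x => f1 x + f2 x + f3 x) := a1.add h3
  have a3 : Integrable (fun x => f1 x + f2 x + f3 x + f4 x) := a2.add h4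
  rw [integral_add (h0.div_const 2) (a3.div_const 8), integral_div, integral_div,
    integral_add a2 h4, integral_add a1 h3, integral_add h1 h2]

lemma int_Av {f : V2 → ℝ} (h : CC f) (d e : V2) : ∫ x, Av d e f x = ∫ x, f x := by
  have := int5 h.integrable (h.sh d).integrable (h.sh (-d)).integrable (h.sh e).integrable (h.sh (-e)).integrable
  unfold sh at this
  unfold Av
  rw [this, int_sh, int_sh, int_sh, int_sh]
  ring

lemma int_sh_mul (e : V2) (f h : V2 → ℝ) : ∫ x, f (x + e) * h x = ∫ x, f x * h (x + -e) := by
  rw [← int_sh e (fun x => f x * h (x + -e))]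
  simp

lemma int_Fd_mul {f h : V2 → ℝ} (hf : CC f) (hh : CC h) (e : V2) :
    ∫ x, Fd e f x * h x = ∫ x, f x * Fd (-e) h x := by
  unfold Fd
  simp only [sub_mul, mul_sub]
  have i1 : Integrable (fun x => f (x + e) * h x) := ((hf.sh e).mul hh).integrable
  have i2 : Integrable (fun x => f x * h (x + -e)) := (hf.mul (hh.sh (-e))).integrable
  rw [integral_sub i1 (hf.mul hh).integrable,
    integral_sub i2 (hf.mul hh).integrable, int_sh_mul]

lemma int_Av_mul {f h : V2 → ℝ} (hf : CC f) (hh : CC h) (d e : V2) :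
    ∫ x, Av d e f x * h x = ∫ x, f x * Av d e h x := by
  have i0 := (hf.mul hh).integrable
  have j : ∀ e, Integrable (fun x => f (x + e) * h x) := fun e => ((hf.sh e).mul hh).integrable
  have k : ∀ e, Integrable (fun x => f x * h (x + e)) := fun e => (hf.mul (hh.sh e)).integrable
  have e1 : ∀ x, Av d e f x * h x = (f x * h x) / 2 + (f (x + d) * h x + f (x + -d) * h x
    + f (x + e) * h x + f (x + -e) * h x) / 8 := fun x => by unfold Av; ring
  have e2 : ∀ x, f x * Av d e h x = (f x * h x) / 2 + (f x * h (x + d) + f x * h (x + -d)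
    + f x * h (x + e) + f x * h (x + -e)) / 8 := fun x => by unfold Av; ring
  simp only [e1, e2]
  rw [int5 i0 (j d) (j (-d)) (j e) (j (-e)), int5 i0 (k d) (k (-d)) (k e) (k (-e)),
    int_sh_mul, int_sh_mul, int_sh_mul, int_sh_mul, neg_neg, neg_neg]
  ring

lemma Av_Fd (d e i : V2) (f : V2 → ℝ) : Av d e (Fd i f) = Fd i (Av d e f) := by
  ext x; unfold Av Fd
  simp only [add_right_comm x i]
  ring

lemma Av_iter_Fd (d e i : V2) (f : V2 → ℝ) (n : ℕ) :
    (Av d e)^[n] (Fd i f) = Fd i ((Av d e)^[n] f) := by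
  induction n with
  | zero => rfl
  | succ n ih => rw [Function.iterate_succ_apply', ih, Av_Fd, Function.iterate_succ_apply']

lemma Av_add (d e : V2) (f g : V2 → ℝ) :
    Av d e (fun x => f x + g x) = fun x => Av d e f x + Av d e g x := by
  ext x; unfold Av; ring

lemma Av_iter_add (d e : V2) (f g : V2 → ℝ) (n : ℕ) :
    (Av d e)^[n] (fun x => f x + g x) = fun x => (Av d e)^[n] f x + (Av d e)^[n] g x := by
  induction n with
  | zero => rfl
  | succ n ih => rw [Function.iterate_succ_apply', ih, Av_add]; simp only [Function.iterate_succ_apply']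

lemma Av_sub (d e : V2) (f g : V2 → ℝ) :
    Av d e (fun x => f x - g x) = fun x => Av d e f x - Av d e g x := by
  ext x; unfold Av; ring

lemma Av_iter_sub (d e : V2) (f g : V2 → ℝ) (n : ℕ) :
    (Av d e)^[n] (fun x => f x - g x) = fun x => (Av d e)^[n] f x - (Av d e)^[n] g x := by
  induction n with
  | zero => rfl
  | succ n ih => rw [Function.iterate_succ_apply', ih, Av_sub]; simp only [Function.iterate_succ_apply']

lemma Fd_add (i : V2) (f g : V2 → ℝ) :
    Fd i (fun x => f x + g x) = fun x => Fd i f x + Fd i g x := by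
  ext x; unfold Fd; ring

lemma mixed_alg (P Q s t S : ℝ) (h : s * t = P * Q) (hS : S = s + t) :
    |s| ≤ |S| + |P| + |Q| := by
  by_contra hc
  push Not at hc
  have h1 : |s| ≤ |S| + |t| := by
    have : s = S - t := by linarith
    rw [this]; exact abs_sub _ _
  have h2 : |P| + |Q| < |t| := by linarith
  have h3 : |s| * |t| = |P| * |Q| := by rw [← abs_mul, ← abs_mul, h]
  have := abs_nonneg P; have := abs_nonneg Q; have := abs_nonneg S
  nlinarith

/-- midpoint gain property -/
def MidGain (Φ : ℝ → ℝ → ℝ) (c : ℝ) : Prop :=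
  ∀ x y x' y', Φ ((x + x') / 2) ((y + y') / 2) ≤
        (Φ x y + Φ x' y') / 2 - c * (|x - x'| * |y - y'|)

lemma gain4 {Φ : ℝ → ℝ → ℝ} {c : ℝ} (hc : 0 ≤ c) (hΦ : MidGain Φ c)
    (x0 xa xb xc xd y0 ya yb yc yd : ℝ) :
    c / 16 * (|xa - x0| * |yb - y0|) ≤
      (Φ x0 y0 / 2 + (Φ xa ya + Φ xb yb + Φ xc yc + Φ xd yd) / 8
        - Φ (x0 / 2 + (xa + xb + xc + xd) / 8) (y0 / 2 + (ya + yb + yc + yd) / 8)) ∧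
    c / 16 * (|xa - x0| * |ya - y0|) ≤
      (Φ x0 y0 / 2 + (Φ xa ya + Φ xb yb + Φ xc yc + Φ xd yd) / 8
        - Φ (x0 / 2 + (xa + xb + xc + xd) / 8) (y0 / 2 + (ya + yb + yc + yd) / 8)) := by
  have pos : ∀ a b : ℝ, 0 ≤ c * (|a| * |b|) := fun a b => by positivity
  have t := hΦ ((x0 + (xa + xb) / 2) / 2) ((y0 + (ya + yb) / 2) / 2)
    ((x0 + (xc + xd) / 2) / 2) ((y0 + (yc + yd) / 2) / 2)
  have ex : ((x0 + (xa + xb) / 2) / 2 + (x0 + (xc + xd) / 2) / 2) / 2 = x0 / 2 + (xa + xb + xc + xd) / 8 := by ring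
  have ey : ((y0 + (ya + yb) / 2) / 2 + (y0 + (yc + yd) / 2) / 2) / 2 = y0 / 2 + (ya + yb + yc + yd) / 8 := by ring
  rw [ex, ey] at t
  set D := Φ x0 y0 / 2 + (Φ xa ya + Φ xb yb + Φ xc yc + Φ xd yd) / 8
        - Φ (x0 / 2 + (xa + xb + xc + xd) / 8) (y0 / 2 + (ya + yb + yc + yd) / 8) with hD
  have t' := pos ((x0 + (xa + xb) / 2) / 2 - (x0 + (xc + xd) / 2) / 2) ((y0 + (ya + yb) / 2) / 2 - (y0 + (yc + yd) / 2) / 2)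
  -- second half (crude)
  have r1 := hΦ x0 y0 ((xc + xd) / 2) ((yc + yd) / 2)
  have r1' := pos (x0 - (xc + xd) / 2) (y0 - (yc + yd) / 2)
  have r2 := hΦ xc yc xd yd
  have r2' := pos (xc - xd) (yc - yd)
  -- first half, way 1
  have l1 := hΦ x0 y0 ((xa + xb) / 2) ((ya + yb) / 2)
  have l2 := hΦ xa ya xb yb
  have l2' := pos (xa - xb) (ya - yb)
  -- first half, way 2
  have k1 := hΦ ((x0 + xa) / 2) ((y0 + ya) / 2) ((x0 + xb) / 2) ((y0 + yb) / 2)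
  have k1' := pos ((x0 + xa) / 2 - (x0 + xb) / 2) ((y0 + ya) / 2 - (y0 + yb) / 2)
  have fx : ((x0 + xa) / 2 + (x0 + xb) / 2) / 2 = (x0 + (xa + xb) / 2) / 2 := by ring
  have fy : ((y0 + ya) / 2 + (y0 + yb) / 2) / 2 = (y0 + (ya + yb) / 2) / 2 := by ring
  rw [fx, fy] at k1
  have k2 := hΦ x0 y0 xa ya
  have k3 := hΦ x0 y0 xb yb
  have k2' := pos (x0 - xa) (y0 - ya)
  have k3' := pos (x0 - xb) (y0 - yb)
  have S1 : c / 2 * (|x0 - (xa + xb) / 2| * |y0 - (ya + yb) / 2|) ≤ D := by linarith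
  have S2 : c / 4 * (|x0 - xa| * |y0 - ya| + |x0 - xb| * |y0 - yb|) ≤ D := by linarith
  rw [abs_sub_comm xa, abs_sub_comm yb, abs_sub_comm ya]
  constructor
  · have hm := mixed_alg ((x0 - xa) * (y0 - ya)) ((x0 - xb) * (y0 - yb)) ((x0 - xa) * (y0 - yb))
      ((x0 - xb) * (y0 - ya)) ((x0 - xa) * (y0 - yb) + (x0 - xb) * (y0 - ya)) (by ring) rfl
    have hS : |(x0 - xa) * (y0 - yb) + (x0 - xb) * (y0 - ya)| ≤
        4 * (|x0 - (xa + xb) / 2| * |y0 - (ya + yb) / 2|) + |x0 - xa| * |y0 - ya| + |x0 - xb| * |y0 - yb| := by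
      have : (x0 - xa) * (y0 - yb) + (x0 - xb) * (y0 - ya) =
        4 * ((x0 - (xa + xb) / 2) * (y0 - (ya + yb) / 2)) - (x0 - xa) * (y0 - ya) - (x0 - xb) * (y0 - yb) := by ring
      rw [this]
      refine (abs_sub _ _).trans ?_
      rw [abs_mul (x0 - xb)]
      gcongr
      refine (abs_sub _ _).trans ?_
      rw [abs_mul, abs_mul, abs_mul]; norm_num
    rw [abs_mul, abs_mul, abs_mul] at hm
    have := mul_le_mul_of_nonneg_left (hm.trans (add_le_add_left (add_le_add_left hS _) _)) (show 0 ≤ c / 16 by positivity)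
    linarith
  · linarith

/-- allowed directions -/
def Dir (d e i : V2) : Prop := i = d ∨ i = -d ∨ i = e ∨ i = -e

lemma Dir.neg {d e i : V2} (h : Dir d e i) : Dir d e (-i) := by
  rcases h with h | h | h | h <;> subst h <;> simp [Dir]

lemma gain_point {Φ : ℝ → ℝ → ℝ} {c : ℝ} (hc : 0 ≤ c) (hΦ : MidGain Φ c) {d e i j : V2}
    (hi : Dir d e i) (hj : Dir d e j) (g h : V2 → ℝ) (x : V2) :
    c / 16 * (|Fd i g x| * |Fd j h x|) ≤
      Av d e (fun x => Φ (g x) (h x)) x - Φ (Av d e g x) (Av d e h x) := by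
  unfold Fd Av
  have key := fun (σ : Fin 4 → V2) => gain4 hc hΦ (g x) (g (x + σ 0)) (g (x + σ 1)) (g (x + σ 2)) (g (x + σ 3))
    (h x) (h (x + σ 0)) (h (x + σ 1)) (h (x + σ 2)) (h (x + σ 3))
  have arr : ∃ σ : Fin 4 → V2, i = σ 0 ∧ (j = σ 0 ∨ j = σ 1) ∧ 
     ∀ f : V2 → ℝ, f (σ 0) + f (σ 1) + f (σ 2) + f (σ 3) = f d + f (-d) + f e + f (-e) := by
    rcases hi with hi | hi | hi | hi <;> rcases hj with hj | hj | hj | hj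
    · exact ⟨![d, -d, e, -e], hi, Or.inl hj, fun f => by simp⟩
    · exact ⟨![d, -d, e, -e], hi, Or.inr hj, fun f => by simp⟩
    · exact ⟨![d, e, -d, -e], hi, Or.inr hj, fun f => by simp; ring⟩
    · exact ⟨![d, -e, e, -d], hi, Or.inr hj, fun f => by simp; ring⟩
    · exact ⟨![-d, d, e, -e], hi, Or.inr hj, fun f => by simp; ring⟩
    · exact ⟨![-d, d, e, -e], hi, Or.inl hj, fun f => by simp; ring⟩
    · exact ⟨![-d, e, d, -e], hi, Or.inr hj, fun f => by simp; ring⟩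
    · exact ⟨![-d, -e, e, d], hi, Or.inr hj, fun f => by simp; ring⟩
    · exact ⟨![e, d, -d, -e], hi, Or.inr hj, fun f => by simp; ring⟩
    · exact ⟨![e, -d, d, -e], hi, Or.inr hj, fun f => by simp; ring⟩
    · exact ⟨![e, -d, d, -e], hi, Or.inl hj, fun f => by simp; ring⟩
    · exact ⟨![e, -e, d, -d], hi, Or.inr hj, fun f => by simp; ring⟩
    · exact ⟨![-e, d, -d, e], hi, Or.inr hj, fun f => by simp; ring⟩
    · exact ⟨![-e, -d, d, e], hi, Or.inr hj, fun f => by simp; ring⟩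
    · exact ⟨![-e, e, d, -d], hi, Or.inr hj, fun f => by simp; ring⟩
    · exact ⟨![-e, e, d, -d], hi, Or.inl hj, fun f => by simp; ring⟩
  obtain ⟨σ, h0, h1, h2⟩ := arr
  have k := key σ
  rw [h2 (fun v => g (x + v)), h2 (fun v => h (x + v)), h2 (fun v => Φ (g (x + v)) (h (x + v)))] at k
  rcases h1 with h1 | h1
  · rw [h0, h1]; exact k.2
  · rw [h0, h1]; exact k.1

lemma gain_int {Φ : ℝ → ℝ → ℝ} {c : ℝ} (hc : 0 ≤ c) (hΦ : MidGain Φ c)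
    (hcont : Continuous (fun z : ℝ × ℝ => Φ z.1 z.2)) (h0 : Φ 0 0 = 0) {d e i j : V2}
    (hi : Dir d e i) (hj : Dir d e j) {g h : V2 → ℝ} (hg : CC g) (hh : CC h) :
    c / 16 * (∫ x, |Fd i g x| * |Fd j h x|) ≤
      (∫ x, Φ (g x) (h x)) - ∫ x, Φ (Av d e g x) (Av d e h x) := by
  rw [← int_Av (hg.comp₂ hh hcont h0) d e, ← integral_const_mul,
    ← integral_sub ((hg.comp₂ hh hcont h0).Av d e).integrable
      ((hg.Av d e).comp₂ (hh.Av d e) hcont h0).integrable]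
  refine integral_mono (((hg.Fd i).abs.mul (hh.Fd j).abs).smul _).integrable
    (((hg.comp₂ hh hcont h0).Av d e).sub ((hg.Av d e).comp₂ (hh.Av d e) hcont h0)).integrable ?_
  intro x
  exact gain_point hc hΦ hi hj g h x

lemma gain_sum {Φ : ℝ → ℝ → ℝ} {c : ℝ} (hc : 0 ≤ c) (hΦ : MidGain Φ c)
    (hcont : Continuous (fun z : ℝ × ℝ => Φ z.1 z.2)) (h0 : Φ 0 0 = 0) {d e i j : V2}
    (hi : Dir d e i) (hj : Dir d e j) {g h : V2 → ℝ} (hg : CC g) (hh : CC h) (N : ℕ) :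
    c / 16 * (∑ n ∈ Finset.range N, ∫ x, |Fd i ((Av d e)^[n] g) x| * |Fd j ((Av d e)^[n] h) x|)
      + ∫ x, Φ ((Av d e)^[N] g x) ((Av d e)^[N] h x) ≤ ∫ x, Φ (g x) (h x) := by
  induction N with
  | zero => simp
  | succ N ih =>
    rw [Finset.sum_range_succ]
    have := gain_int hc hΦ hcont h0 hi hj (hg.iter d e N) (hh.iter d e N)
    simp only [Function.iterate_succ_apply']
    linarith

lemma midGain_sq : MidGain (fun x y => x ^ 2 + y ^ 2) (1 / 2) := by
  intro x y x' y'
  nlinarith [sq_nonneg (|x - x'| - |y - y'|), sq_abs (x - x'), sq_abs (y - y')]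

lemma sq_summable {d e j : V2} (hj : Dir d e j) {h : V2 → ℝ} (hh : CC h) :
    Tendsto (fun n => ∫ x, (Fd j ((Av d e)^[n] h) x) ^ 2) atTop (𝓝 0) := by
  refine Summable.tendsto_atTop_zero ?_
  refine summable_of_sum_range_le (c := 32 * ∫ x, (h x ^ 2 + h x ^ 2)) (fun n => integral_nonneg (fun x => sq_nonneg _)) ?_
  intro N
  have := gain_sum (by norm_num) midGain_sq (by fun_prop) (by norm_num) hj hj hh hh N
  have e1 : ∀ n, ∫ x, |Fd j ((Av d e)^[n] h) x| * |Fd j ((Av d e)^[n] h) x| = ∫ x, (Fd j ((Av d e)^[n] h) x) ^ 2 := by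
    intro n; congr 1; ext x; rw [abs_mul_abs_self, sq]
  simp only [e1] at this
  have h3 : 0 ≤ ∫ x, ((Av d e)^[N] h x ^ 2 + (Av d e)^[N] h x ^ 2) :=
    integral_nonneg (fun x => by positivity)
  linarith

lemma sq_contr {d e : V2} {h : V2 → ℝ} (hh : CC h) (N : ℕ) :
    ∫ x, ((Av d e)^[N] h x) ^ 2 ≤ ∫ x, h x ^ 2 := by
  have := gain_sum (by norm_num) midGain_sq (by fun_prop) (by norm_num) (d := d) (e := e) (Or.inl rfl) (Or.inl rfl) hh hh N
  have h3 : 0 ≤ ∑ n ∈ Finset.range N, ∫ x, |Fd d ((Av d e)^[n] h) x| * |Fd d ((Av d e)^[n] h) x| :=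
    Finset.sum_nonneg fun n _ => integral_nonneg (fun x => by positivity)
  have e1 : ∀ f : V2 → ℝ, ∫ x, (f x ^ 2 + f x ^ 2) = 2 * ∫ x, f x ^ 2 := by
    intro f; rw [← integral_const_mul]; congr 1; ext x; ring
  rw [e1, e1] at this
  linarith



lemma pow5 (q a b0 b1 b2 b3 b4 : ℝ) (hq : 0 < q)
    (ha : |a| ≤ 3 / 2 * |b0| + (|b1| + |b2| + |b3| + |b4|) / 8) :
    |a| ^ q ≤ 2 ^ q * (|b0| ^ q + |b1| ^ q + |b2| ^ q + |b3| ^ q + |b4| ^ q) := by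
  set M := max |b0| (max (max |b1| |b2|) (max |b3| |b4|)) with hM
  have m0 : |b0| ≤ M := le_max_left _ _
  have m1 : |b1| ≤ M := (le_max_left _ _).trans ((le_max_left _ _).trans (le_max_right _ _))
  have m2 : |b2| ≤ M := (le_max_right _ _).trans ((le_max_left _ _).trans (le_max_right _ _))
  have m3 : |b3| ≤ M := (le_max_left _ _).trans ((le_max_right _ _).trans (le_max_right _ _))
  have m4 : |b4| ≤ M := (le_max_right _ _).trans ((le_max_right _ _).trans (le_max_right _ _))
  have hM0 : 0 ≤ M := (abs_nonneg _).trans m0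
  have p0 := rpow_nonneg (abs_nonneg b0) q
  have p1 := rpow_nonneg (abs_nonneg b1) q
  have p2 := rpow_nonneg (abs_nonneg b2) q
  have p3 := rpow_nonneg (abs_nonneg b3) q
  have p4 := rpow_nonneg (abs_nonneg b4) q
  have h1 : |a| ^ q ≤ (2 * M) ^ q := rpow_le_rpow (abs_nonneg _) (by linarith) hq.le
  rw [mul_rpow (by norm_num) hM0] at h1
  refine h1.trans (mul_le_mul_of_nonneg_left ?_ (by positivity))
  rcases max_cases |b0| (max (max |b1| |b2|) (max |b3| |b4|)) with h | h
  · rw [hM, h.1]; linarith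
  rw [hM, h.1]
  rcases max_cases (max |b1| |b2|) (max |b3| |b4|) with h | h
  · rw [h.1]; rcases max_cases |b1| |b2| with h | h <;> rw [h.1] <;> linarith
  · rw [h.1]; rcases max_cases |b3| |b4| with h | h <;> rw [h.1] <;> linarith

lemma int_tilde (q : ℝ) (hq : 0 < q) {h : V2 → ℝ} (hh : CC h) (d e : V2) :
    ∫ x, |h x + Av d e h x| ^ q ≤ 2 ^ q * 5 * ∫ x, |h x| ^ q := by
  have i0 := (hh.abspow hq).integrable
  have i1 : ∀ e, Integrable (fun x => |h (x + e)| ^ q) := fun e => ((hh.sh e).abspow hq).integrable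
  have a1 : Integrable (fun x => |h x| ^ q + |h (x + d)| ^ q) := i0.add (i1 d)
  have a2 : Integrable (fun x => |h x| ^ q + |h (x + d)| ^ q + |h (x + -d)| ^ q) := a1.add (i1 (-d))
  have a3 : Integrable (fun x => |h x| ^ q + |h (x + d)| ^ q + |h (x + -d)| ^ q + |h (x + e)| ^ q) :=
    a2.add (i1 e)
  have a4 : Integrable (fun x => |h x| ^ q + |h (x + d)| ^ q + |h (x + -d)| ^ q + |h (x + e)| ^ q
      + |h (x + -e)| ^ q) := a3.add (i1 (-e))
  calc ∫ x, |h x + Av d e h x| ^ q ≤ ∫ x, 2 ^ q * (|h x| ^ q + |h (x + d)| ^ q + |h (x + -d)| ^ q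
        + |h (x + e)| ^ q + |h (x + -e)| ^ q) := by
        refine integral_mono ((hh.add (hh.Av d e)).abspow hq).integrable (a4.const_mul _) ?_
        intro x
        refine pow5 q _ _ _ _ _ _ hq ?_
        unfold Av
        have e1 : h x + (h x / 2 + (h (x + d) + h (x + -d) + h (x + e) + h (x + -e)) / 8) =
          3 / 2 * h x + (h (x + d) + h (x + -d) + h (x + e) + h (x + -e)) / 8 := by ring
        rw [e1]
        refine (abs_add_le _ _).trans ?_
        rw [abs_mul, abs_of_pos (show (0:ℝ) < 3/2 by norm_num), abs_div, abs_of_pos (show (0:ℝ) < 8 by norm_num)]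
        gcongr
        refine (abs_add_le _ _).trans ?_
        gcongr
        refine (abs_add_le _ _).trans ?_
        gcongr
        exact (abs_add_le _ _)
    _ = _ := by
        rw [integral_const_mul, integral_add a3 (i1 _), integral_add a2 (i1 _), integral_add a1 (i1 _),
          integral_add i0 (i1 _)]
        have : ∀ e, ∫ x, |h (x + e)| ^ q = ∫ x, |h x| ^ q := fun e => int_sh e (fun x => |h x| ^ q)
        rw [this, this, this, this]; ring

/-- core discrete estimate -/
lemma core (p q : ℝ) (hp : 2 < p) (hq : q = p / (p - 1)) : ∃ C > (0:ℝ), ∀ (d e i k j : V2)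
    (_ : Dir d e i) (_ : Dir d e k) (_ : Dir d e j) (u g w h : V2 → ℝ) (_ : CC u) (_ : CC g) (_ : CC w) (_ : CC h)
    (_ : ∀ x, u x - Av d e u x = Fd i g x + Fd k w x),
    ∫ x, Fd j u x * h x ≤ C * ((∫ x, |g x| ^ p) + (∫ x, |w x| ^ p) + ∫ x, |h x| ^ q) := by
  obtain ⟨Φ, c, K, hc, hK, hcont, h0, hle, hmid⟩ := exists_bellman p q hp hq
  have hp1 : 0 < p - 1 := by linarith
  have hq0 : 0 < q := by rw [hq]; positivity
  have hp0 : 0 < p := by linarith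
  have hmid' : MidGain Φ c := hmid
  have hΦ0 : Φ 0 0 = 0 := le_antisymm (by simpa [hp0.ne', hq0.ne'] using hle 0 0) (h0 0 0)
  refine ⟨(16 / c * K) * (2 * (2 ^ q * 5)) + (16 / c * K), by positivity, ?_⟩
  intro d e i k j hi hk hj u g w h hu hg hw hh heq
  set A := Av d e with hA
  set H : V2 → ℝ := fun x => h x + A h x with hHdef
  have hH : CC H := hh.add (hh.Av d e)
  -- dissipation bound
  have diss : ∀ (i : V2) (_ : Dir d e i) (g : V2 → ℝ) (_ : CC g) (N : ℕ),
      ∑ n ∈ Finset.range N, ∫ x, |Fd i (A^[n] g) x| * |Fd (-j) (A^[n] H) x| ≤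
        16 / c * K * ((∫ x, |g x| ^ p) + ∫ x, |H x| ^ q) := by
    intro i hi g hg N
    have h1 := gain_sum hc.le hmid' hcont hΦ0 hi hj.neg hg hH N
    have h2 : 0 ≤ ∫ x, Φ ((Av d e)^[N] g x) ((Av d e)^[N] H x) := integral_nonneg (fun x => h0 _ _)
    have h3 : ∫ x, Φ (g x) (H x) ≤ K * ((∫ x, |g x| ^ p) + ∫ x, |H x| ^ q) := by
      rw [← integral_add (hg.abspow hp0).integrable (hH.abspow hq0).integrable, ← integral_const_mul]
      exact integral_mono (hg.comp₂ hH hcont hΦ0).integrable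
        (((hg.abspow hp0).add (hH.abspow hq0)).smul K).integrable (fun x => hle _ _)
    have h4 : c / 16 * (∑ n ∈ Finset.range N, ∫ x, |Fd i (A^[n] g) x| * |Fd (-j) (A^[n] H) x|) ≤
       K * ((∫ x, |g x| ^ p) + ∫ x, |H x| ^ q) := by linarith
    calc _ = 16 / c * (c / 16 * (∑ n ∈ Finset.range N, ∫ x, |Fd i (A^[n] g) x| * |Fd (-j) (A^[n] H) x|)) := by
          field_simp
      _ ≤ 16 / c * (K * ((∫ x, |g x| ^ p) + ∫ x, |H x| ^ q)) := by gcongr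
      _ = _ := by ring
  -- telescoping
  let Tm : ℕ → ℝ := fun m => ∫ x, A^[m] u x * Fd (-j) (A^[m] h) x
  have step : ∀ m, Tm m - Tm (m + 1) ≤
      (∫ x, |Fd i (A^[m] g) x| * |Fd (-j) (A^[m] H) x|) + ∫ x, |Fd k (A^[m] w) x| * |Fd (-j) (A^[m] H) x| := by
    intro m
    have hU : CC (A^[m] u) := hu.iter d e m
    have hV : CC (Fd (-j) (A^[m] h)) := (hh.iter d e m).Fd _
    have e1 : Tm (m + 1) = ∫ x, A (A^[m] u) x * A (Fd (-j) (A^[m] h)) x := by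
      simp only [Tm, Function.iterate_succ_apply']
      rw [hA, Av_Fd]
    have e2 : Fd (-j) (A^[m] H) = fun x => Fd (-j) (A^[m] h) x + A (Fd (-j) (A^[m] h)) x := by
      rw [hHdef, hA, Av_iter_add, Fd_add, Av_Fd]
      simp only [← Function.iterate_succ_apply' (Av d e), Function.iterate_succ_apply]
    have e3 : ∀ x, A^[m] u x - A (A^[m] u) x = Fd i (A^[m] g) x + Fd k (A^[m] w) x := by
      intro x
      have h1 : (A^[m] fun x => u x - A u x) = A^[m] (fun x => Fd i g x + Fd k w x) := by
        congr 1; ext x; exact heq x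
      rw [hA, Av_iter_sub, Av_iter_add, Av_iter_Fd, Av_iter_Fd] at h1
      have h2 := congrFun h1 x
      rw [← h2, hA, ← Function.iterate_succ_apply' (Av d e), Function.iterate_succ_apply]
    have e4 : ∫ x, A (A^[m] u) x * Fd (-j) (A^[m] h) x = ∫ x, A^[m] u x * A (Fd (-j) (A^[m] h)) x :=
      int_Av_mul hU hV d e
    have hAU := hU.Av d e
    have hAV := hV.Av d e
    have e5 : Tm m - Tm (m + 1) = ∫ x, (A^[m] u x - A (A^[m] u) x) * Fd (-j) (A^[m] H) x := by
      rw [e1, e2]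
      have i1 := (hU.mul hV).integrable
      have i2 := (hU.mul hAV).integrable
      have i3 := (hAU.mul hV).integrable
      have i4 := (hAU.mul hAV).integrable
      have : ∀ x, (A^[m] u x - A (A^[m] u) x) * (Fd (-j) (A^[m] h) x + A (Fd (-j) (A^[m] h)) x)
        = (A^[m] u x * Fd (-j) (A^[m] h) x - A (A^[m] u) x * A (Fd (-j) (A^[m] h)) x)
         + (A^[m] u x * A (Fd (-j) (A^[m] h)) x - A (A^[m] u) x * Fd (-j) (A^[m] h) x) := fun x => by ring
      simp only [this]
      have i5 : Integrable (fun x => A^[m] u x * Fd (-j) (A^[m] h) x - A (A^[m] u) x * A (Fd (-j) (A^[m] h)) x) :=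
        i1.sub i4
      have i6 : Integrable (fun x => A^[m] u x * A (Fd (-j) (A^[m] h)) x - A (A^[m] u) x * Fd (-j) (A^[m] h) x) :=
        i2.sub i3
      rw [integral_add i5 i6, integral_sub i1 i4, integral_sub i2 i3]
      simp only [Tm]
      linarith
    rw [e5]
    have hgm := (hg.iter d e m).Fd i
    have hwm := (hw.iter d e m).Fd k
    have hHm := (hH.iter d e m).Fd (-j)
    have i7 := (hgm.abs.mul hHm.abs)
    have i8 := (hwm.abs.mul hHm.abs)
    rw [← integral_add i7.integrable i8.integrable]
    refine integral_mono ((hU.sub hAU).mul hHm).integrable (i7.add i8).integrable ?_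
    intro x
    simp only [e3, add_mul, ← abs_mul]
    exact add_le_add (le_abs_self _) (le_abs_self _)
  have tele : ∀ N, Tm 0 ≤ Tm N + ∑ m ∈ Finset.range N,
      ((∫ x, |Fd i (A^[m] g) x| * |Fd (-j) (A^[m] H) x|) + ∫ x, |Fd k (A^[m] w) x| * |Fd (-j) (A^[m] H) x|) := by
    intro N
    induction N with
    | zero => simp
    | succ N ih => rw [Finset.sum_range_succ]; linarith [step N]
  have lim : Tendsto Tm atTop (𝓝 0) := by
    have hz := sq_summable hj.neg hh
    have hz2 : Tendsto (fun n => sqrt ((∫ x, u x ^ 2) * ∫ x, (Fd (-j) ((Av d e)^[n] h) x) ^ 2)) atTop (𝓝 0) := by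
      have := (hz.const_mul (∫ x, u x ^ 2)).sqrt
      simpa using this
    refine squeeze_zero_norm (fun n => ?_) hz2
    rw [Real.norm_eq_abs]
    refine abs_le_sqrt ?_
    have hU : CC (A^[n] u) := hu.iter d e n
    have hV : CC (Fd (-j) (A^[n] h)) := (hh.iter d e n).Fd _
    have cs : (∫ x, A^[n] u x * Fd (-j) (A^[n] h) x) ^ 2 ≤ (∫ x, A^[n] u x ^ 2) * ∫ x, (Fd (-j) (A^[n] h) x) ^ 2 := by
      have a1 : Integrable (fun x => A^[n] u x ^ 2) := by simpa only [sq] using (hU.mul hU).integrable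
      have a2 : Integrable (fun x => Fd (-j) (A^[n] h) x ^ 2) := by simpa only [sq] using (hV.mul hV).integrable
      have a3 := (hU.mul hV).integrable
      have hd : discrim (∫ x, (Fd (-j) (A^[n] h) x) ^ 2) (2 * ∫ x, A^[n] u x * Fd (-j) (A^[n] h) x)
         (∫ x, A^[n] u x ^ 2) ≤ 0 := by
        apply discrim_le_zero
        intro t
        have : (∫ x, (Fd (-j) (A^[n] h) x) ^ 2) * (t * t) + (2 * ∫ x, A^[n] u x * Fd (-j) (A^[n] h) x) * t
           + (∫ x, A^[n] u x ^ 2) = ∫ x, (t * Fd (-j) (A^[n] h) x + A^[n] u x) ^ 2 := by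
          have e : ∀ x, (t * Fd (-j) (A^[n] h) x + A^[n] u x) ^ 2 = (t * t) * (Fd (-j) (A^[n] h) x) ^ 2
             + (2 * t) * (A^[n] u x * Fd (-j) (A^[n] h) x) + A^[n] u x ^ 2 := fun x => by ring
          simp only [e]
          have b1 : Integrable (fun x => (t * t) * (Fd (-j) (A^[n] h) x) ^ 2
             + (2 * t) * (A^[n] u x * Fd (-j) (A^[n] h) x)) := (a2.const_mul _).add (a3.const_mul _)
          rw [integral_add b1 a1, integral_add (a2.const_mul _) (a3.const_mul _), integral_const_mul, integral_const_mul]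
          ring
        rw [this]; exact integral_nonneg (fun x => sq_nonneg _)
      unfold discrim at hd
      linarith
    refine cs.trans ?_
    exact mul_le_mul_of_nonneg_right (sq_contr hu n) (integral_nonneg fun x => sq_nonneg _)
  have fin : Tm 0 ≤ 0 + ((16 / c * K * ((∫ x, |g x| ^ p) + ∫ x, |H x| ^ q)) + (16 / c * K * ((∫ x, |w x| ^ p) + ∫ x, |H x| ^ q))) := by
    refine ge_of_tendsto' (lim.add_const _) (fun N => ?_)
    refine (tele N).trans ?_
    rw [Finset.sum_add_distrib]
    gcongr
    · exact diss i hi g hg N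
    · exact diss k hk w hw N
  have hHq : ∫ x, |H x| ^ q ≤ 2 ^ q * 5 * ∫ x, |h x| ^ q := int_tilde q hq0 hh d e
  have hT0 : ∫ x, Fd j u x * h x = Tm 0 := int_Fd_mul hu hh j
  rw [hT0]
  refine fin.trans ?_
  have I1 : 0 ≤ ∫ x, |g x| ^ p := integral_nonneg fun x => by positivity
  have I2 : 0 ≤ ∫ x, |w x| ^ p := integral_nonneg fun x => by positivity
  have I3 : 0 ≤ ∫ x, |h x| ^ q := integral_nonneg fun x => by positivity
  set κ := 16 / c * K
  have hκ : 0 < κ := by positivity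
  have h2q : (0:ℝ) < 2 ^ q * 5 := by positivity
  have J1 := mul_le_mul_of_nonneg_left hHq hκ.le
  have J2 : 0 ≤ κ * (2 * (2 ^ q * 5)) * ((∫ x, |g x| ^ p) + ∫ x, |w x| ^ p) := by positivity
  have J3 : 0 ≤ κ * ∫ x, |h x| ^ q := by positivity
  nlinarith

/-- discrete Calderon-Zygmund estimate for one component -/
lemma core2 (p : ℝ) (hp : 2 < p) : ∃ C > (0:ℝ), ∀ (d e i k j : V2)
    (_ : Dir d e i) (_ : Dir d e k) (_ : Dir d e j) (u g w : V2 → ℝ) (_ : CC u) (_ : CC g) (_ : CC w)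
    (_ : ∀ x, u x - Av d e u x = Fd i g x + Fd k w x),
    ∫ x, |Fd j u x| ^ p ≤ C * ((∫ x, |g x| ^ p) + (∫ x, |w x| ^ p)) := by
  obtain ⟨C, hC, H⟩ := core p (p / (p - 1)) hp rfl
  set q := p / (p - 1) with hq
  have hp1 : 0 < p - 1 := by linarith
  have hqp : q * (p - 1) = p := by rw [hq]; field_simp
  have hq1 : 0 < q - 1 := by nlinarith
  -- κ with C κ^q = κ/2
  set κ : ℝ := (1 / (2 * C)) ^ (1 / (q - 1)) with hκ
  have hκ0 : 0 < κ := by positivity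
  have hκq : C * κ ^ q = κ / 2 := by
    have h1 : κ ^ (q - 1) = 1 / (2 * C) := by
      rw [hκ, ← rpow_mul (by positivity)]
      rw [one_div_mul_cancel hq1.ne', rpow_one]
    have h2 : κ ^ q = κ ^ (q - 1) * κ := by
      rw [← rpow_add_one hκ0.ne']; simp
    rw [h2, h1]; field_simp
  refine ⟨2 * C / κ, by positivity, ?_⟩
  intro d e i k j hi hk hj u g w hu hg hw heq
  have hv : CC (Fd j u) := hu.Fd j
  set v := Fd j u with hvdef
  have hcont : Continuous (fun t : ℝ => κ * (|t| ^ (p - 2) * t)) :=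
    continuous_const.mul ((continuous_abs.rpow_const (fun _ => Or.inr (by linarith))).mul continuous_id)
  have hh : CC (fun x => κ * (|v x| ^ (p - 2) * v x)) := hv.comp hcont (by simp)
  have h1 := H d e i k j hi hk hj u g w _ hu hg hw hh heq
  have e1 : ∀ x, Fd j u x * (κ * (|v x| ^ (p - 2) * v x)) = κ * |v x| ^ p := by
    intro x
    rw [← hvdef]
    by_cases h : v x = 0
    · simp [h, (show p ≠ 0 by linarith)]
    have h' : 0 < |v x| := abs_pos.mpr h
    have : |v x| ^ p = |v x| ^ (p - 2) * (v x * v x) := by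
      rw [← abs_mul_abs_self, ← sq, ← rpow_two, ← rpow_add h']; simp
    rw [this]; ring
  have e2 : ∀ x, |κ * (|v x| ^ (p - 2) * v x)| ^ q = κ ^ q * |v x| ^ p := by
    intro x
    by_cases h : v x = 0
    · simp [h, (show p ≠ 0 by linarith), (show q ≠ 0 by intro h0; rw [h0] at hqp; linarith)]
    have h' : 0 < |v x| := abs_pos.mpr h
    rw [abs_mul, abs_mul, abs_of_pos hκ0, abs_of_nonneg (by positivity : 0 ≤ |v x| ^ (p - 2)),
      mul_rpow hκ0.le (by positivity), ← rpow_add_one h'.ne', ← rpow_mul h'.le]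
    congr 2
    linarith
  simp only [e1, e2] at h1
  rw [integral_const_mul, integral_const_mul] at h1
  set I := ∫ x, |v x| ^ p
  set J := (∫ x, |g x| ^ p) + (∫ x, |w x| ^ p)
  have : C * (J + κ ^ q * I) = C * J + κ / 2 * I := by rw [← hκq]; ring
  rw [this] at h1
  have h2 : κ / 2 * I ≤ C * J := by linarith
  calc I = 2 / κ * (κ / 2 * I) := by field_simp
    _ ≤ 2 / κ * (C * J) := by gcongr
    _ = _ := by ring

/-- discrete div-curl estimate -/
lemma disc_divcurl (p : ℝ) (hp : 2 < p) : ∃ C > (0:ℝ), ∀ (d e j : V2) (_ : Dir d e j) (u1 u2 : V2 → ℝ)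
    (_ : CC u1) (_ : CC u2),
    (∫ x, |Fd j u1 x| ^ p ≤ C * ((∫ x, |Fd (-d) u1 x + Fd (-e) u2 x| ^ p) + ∫ x, |Fd d u2 x - Fd e u1 x| ^ p)) ∧
    (∫ x, |Fd j u2 x| ^ p ≤ C * ((∫ x, |Fd (-d) u1 x + Fd (-e) u2 x| ^ p) + ∫ x, |Fd d u2 x - Fd e u1 x| ^ p)) := by
  obtain ⟨C, hC, H⟩ := core2 p hp
  refine ⟨C, hC, ?_⟩
  intro d e j hj u1 u2 h1 h2
  have hδ : CC (fun x => Fd (-d) u1 x + Fd (-e) u2 x) := (h1.Fd (-d)).add (h2.Fd (-e))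
  have hω : CC (fun x => Fd d u2 x - Fd e u1 x) := (h2.Fd d).sub (h1.Fd e)
  have sc : ∀ (f : V2 → ℝ) (c : ℝ), |c| ≤ 1 → (CC f) → ∫ x, |c * f x| ^ p ≤ ∫ x, |f x| ^ p := by
    intro f c hc hf
    refine integral_mono ((hf.smul c).abspow (by linarith)).integrable (hf.abspow (by linarith)).integrable ?_
    intro x
    refine rpow_le_rpow (abs_nonneg _) ?_ (by linarith)
    rw [abs_mul]
    exact mul_le_of_le_one_left (abs_nonneg _) hc
  have a1 := sc _ (1/8) (by norm_num) hδ
  have a2 := sc _ (1/8) (by norm_num) hω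
  have a3 := sc _ (-1/8) (by norm_num [abs_div]) hω
  have n1 : Dir d e d := Or.inl rfl
  have n2 : Dir d e (-d) := Or.inr (Or.inl rfl)
  have n3 : Dir d e e := Or.inr (Or.inr (Or.inl rfl))
  have n4 : Dir d e (-e) := Or.inr (Or.inr (Or.inr rfl))
  constructor
  · refine (H d e d (-e) j n1 n4 hj u1 _ _ h1 (hδ.smul (1/8)) (hω.smul (-1/8)) ?_).trans (by gcongr)
    intro x
    unfold Av Fd
    have q1 : x + d + -d = x := by abel
    have q2 : x + -e + e = x := by abel
    have q3 : x + d + -e = x + -e + d := by abel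
    beta_reduce
    rw [q1, q2, q3]
    ring
  · refine (H d e e (-d) j n3 n2 hj u2 _ _ h2 (hδ.smul (1/8)) (hω.smul (1/8)) ?_).trans (by gcongr)
    intro x
    unfold Av Fd
    have q1 : x + e + -e = x := by abel
    have q2 : x + -d + d = x := by abel
    have q3 : x + e + -d = x + -d + e := by abel
    beta_reduce
    rw [q1, q2, q3]
    ring



/-- difference quotient -/
def Qd (n : ℕ) (v : V2) (f : V2 → ℝ) (x : V2) : ℝ := ((n:ℝ) + 1) * Fd ((1 / ((n:ℝ) + 1)) • v) f x

lemma Qd_lim {f : V2 → ℝ} {x : V2} (hf : DifferentiableAt ℝ f x) (v : V2) :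
    Tendsto (fun n => Qd n v f x) atTop (𝓝 (fderiv ℝ f x v)) := by
  have h1 := (hf.hasFDerivAt.hasLineDerivAt v).tendsto_slope_zero
  have h2 : Tendsto (fun n : ℕ => 1 / ((n:ℝ) + 1)) atTop (𝓝[≠] 0) :=
    tendsto_nhdsWithin_iff.mpr ⟨tendsto_one_div_add_atTop_nhds_zero_nat,
      Eventually.of_forall fun n => by
        have : (0:ℝ) < 1 / ((n:ℝ) + 1) := by positivity
        exact this.ne'⟩
  have h3 := h1.comp h2
  refine h3.congr (fun n => ?_)
  simp [Qd, Fd, Function.comp]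

lemma Qd_bound {f : V2 → ℝ} {K : NNReal} (hf : LipschitzWith K f) (n : ℕ) {v : V2} (hv : ‖v‖ ≤ 1) (x : V2) :
    |Qd n v f x| ≤ K := by
  have hn : (0:ℝ) < (n:ℝ) + 1 := by positivity
  have h := hf.dist_le_mul (x + (1 / ((n:ℝ) + 1)) • v) x
  rw [Real.dist_eq, dist_eq_norm, add_sub_cancel_left, norm_smul, Real.norm_of_nonneg (by positivity)] at h
  unfold Qd Fd
  rw [abs_mul, abs_of_pos hn]
  calc _ ≤ ((n:ℝ) + 1) * (K * (1 / ((n:ℝ) + 1) * ‖v‖)) := by gcongr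
    _ = K * ‖v‖ := by field_simp
    _ ≤ K := mul_le_of_le_one_right K.2 hv

lemma Qd_supp {f : V2 → ℝ} {R : ℝ} (hf : ∀ x, x ∉ Metric.closedBall (0:V2) R → f x = 0) (n : ℕ) {v : V2}
    (hv : ‖v‖ ≤ 1) (x : V2) (hx : x ∉ Metric.closedBall (0:V2) (R + 1)) : Qd n v f x = 0 := by
  have hn : (0:ℝ) < (n:ℝ) + 1 := by positivity
  rw [mem_closedBall_zero_iff, not_le] at hx
  have h1 : f x = 0 := hf x (by rw [mem_closedBall_zero_iff]; linarith)
  have h2 : f (x + (1 / ((n:ℝ) + 1)) • v) = 0 := by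
    apply hf
    rw [mem_closedBall_zero_iff, not_le]
    have a1 : ‖(1 / ((n:ℝ) + 1)) • v‖ ≤ 1 := by
      rw [norm_smul, Real.norm_of_nonneg (by positivity)]
      have : 1 / ((n:ℝ) + 1) ≤ 1 := by rw [div_le_one hn]; linarith [(Nat.cast_nonneg n : (0:ℝ) ≤ n)]
      exact mul_le_one₀ this (norm_nonneg _) hv
    have := norm_sub_norm_le x (-((1 / ((n:ℝ) + 1)) • v))
    rw [sub_neg_eq_add, norm_neg] at this
    linarith
  unfold Qd Fd; rw [h1, h2]; simp

lemma dct_pow (p : ℝ) (hp : 0 < p) (G : ℕ → V2 → ℝ) (g : V2 → ℝ) (M R : ℝ) (hc : ∀ n, Continuous (G n))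
    (hb : ∀ n x, |G n x| ≤ M) (hs : ∀ n x, x ∉ Metric.closedBall (0:V2) R → G n x = 0)
    (hl : ∀ᵐ x, Tendsto (fun n => G n x) atTop (𝓝 (g x))) :
    Tendsto (fun n => ∫ x, |G n x| ^ p) atTop (𝓝 (∫ x, |g x| ^ p)) := by
  refine tendsto_integral_of_dominated_convergence
    ((Metric.closedBall (0:V2) R).indicator (fun _ => M ^ p)) ?_ ?_ ?_ ?_
  · intro n
    exact ((hc n).abs.rpow_const (fun _ => Or.inr hp.le)).aestronglyMeasurable
  · exact (integrable_indicator_iff measurableSet_closedBall).mpr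
      (integrableOn_const (isCompact_closedBall 0 R).measure_lt_top.ne)
  · intro n
    refine Eventually.of_forall fun x => ?_
    rw [Real.norm_of_nonneg (by positivity)]
    by_cases hx : x ∈ Metric.closedBall (0:V2) R
    · rw [indicator_of_mem hx]; exact rpow_le_rpow (abs_nonneg _) (hb n x) hp.le
    · rw [indicator_of_notMem hx, hs n x hx]; simp [hp.ne']
  · filter_upwards [hl] with x hx
    exact (hx.abs).rpow_const (Or.inr hp.le)

lemma Qd_cont {f : V2 → ℝ} (hf : Continuous f) (n : ℕ) (v : V2) : Continuous (Qd n v f) := by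
  unfold Qd Fd
  exact continuous_const.mul ((hf.comp (continuous_id.add continuous_const)).sub hf)

/-- whole-plane div-curl estimate -/
lemma divcurl_plane (p : ℝ) (hp : 2 < p) : ∃ C > (0:ℝ), ∀ (u1 u2 : V2 → ℝ) (K1 K2 : NNReal)
    (_ : LipschitzWith K1 u1) (_ : LipschitzWith K2 u2) (_ : HasCompactSupport u1) (_ : HasCompactSupport u2)
    (j : Fin 2),
    (∫ x, |pd j u1 x| ^ p ≤ C * ((∫ x, |pd 0 u1 x + pd 1 u2 x| ^ p) + ∫ x, |pd 0 u2 x - pd 1 u1 x| ^ p)) ∧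
    (∫ x, |pd j u2 x| ^ p ≤ C * ((∫ x, |pd 0 u1 x + pd 1 u2 x| ^ p) + ∫ x, |pd 0 u2 x - pd 1 u1 x| ^ p)) := by
  obtain ⟨C, hC, H⟩ := disc_divcurl p hp
  refine ⟨C, hC, ?_⟩
  intro u1 u2 K1 K2 L1 L2 s1 s2 j
  have c1 : CC u1 := ⟨L1.continuous, s1⟩
  have c2 : CC u2 := ⟨L2.continuous, s2⟩
  have hp0 : 0 < p := by linarith
  obtain ⟨R, hR⟩ : ∃ R, ∀ x, x ∉ Metric.closedBall (0:V2) R → u1 x = 0 ∧ u2 x = 0 := by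
    obtain ⟨R1, h1⟩ := s1.isCompact.isBounded.subset_closedBall (0:V2)
    obtain ⟨R2, h2⟩ := s2.isCompact.isBounded.subset_closedBall (0:V2)
    refine ⟨max R1 R2, fun x hx => ⟨?_, ?_⟩⟩
    · by_contra h
      exact hx (Metric.closedBall_subset_closedBall (le_max_left _ _) (h1 (subset_tsupport _ h)))
    · by_contra h
      exact hx (Metric.closedBall_subset_closedBall (le_max_right _ _) (h2 (subset_tsupport _ h)))
  have ne : ∀ i : Fin 2, ‖(Pi.single i 1 : V2)‖ ≤ 1 := fun i => by
    rw [pi_norm_le_iff_of_nonneg zero_le_one]; intro k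
    by_cases h : k = i
    · subst h; simp
    · simp [h]
  have ne' : ∀ i : Fin 2, ‖-(Pi.single i 1 : V2)‖ ≤ 1 := fun i => by rw [norm_neg]; exact ne i
  have ae1 := L1.ae_differentiableAt (μ := (volume : Measure V2))
  have ae2 := L2.ae_differentiableAt (μ := (volume : Measure V2))
  -- limits
  have l1 : Tendsto (fun n => ∫ x, |Qd n (Pi.single j 1) u1 x| ^ p) atTop (𝓝 (∫ x, |pd j u1 x| ^ p)) :=
    dct_pow p hp0 _ _ K1 (R + 1) (fun n => Qd_cont c1.1 n _) (fun n x => Qd_bound L1 n (ne j) x)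
      (fun n x hx => Qd_supp (fun x hx => (hR x hx).1) n (ne j) x hx)
      (by filter_upwards [ae1] with x hx using Qd_lim hx _)
  have l2 : Tendsto (fun n => ∫ x, |Qd n (Pi.single j 1) u2 x| ^ p) atTop (𝓝 (∫ x, |pd j u2 x| ^ p)) :=
    dct_pow p hp0 _ _ K2 (R + 1) (fun n => Qd_cont c2.1 n _) (fun n x => Qd_bound L2 n (ne j) x)
      (fun n x hx => Qd_supp (fun x hx => (hR x hx).2) n (ne j) x hx)
      (by filter_upwards [ae2] with x hx using Qd_lim hx _)
  have l3 : Tendsto (fun n => ∫ x, |Qd n (-Pi.single 0 1) u1 x + Qd n (-Pi.single 1 1) u2 x| ^ p) atTop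
      (𝓝 (∫ x, |-(pd 0 u1 x + pd 1 u2 x)| ^ p)) := by
    refine dct_pow p hp0 (fun n x => Qd n (-Pi.single 0 1) u1 x + Qd n (-Pi.single 1 1) u2 x)
      (fun x => -(pd 0 u1 x + pd 1 u2 x)) (K1 + K2) (R + 1)
      (fun n => (Qd_cont c1.1 n _).add (Qd_cont c2.1 n _)) 
      (fun n x => (abs_add_le _ _).trans (add_le_add (Qd_bound L1 n (ne' 0) x) (Qd_bound L2 n (ne' 1) x)))
      (fun n x hx => ?_) ?_
    · rw [Qd_supp (fun x hx => (hR x hx).1) n (ne' 0) x hx, Qd_supp (fun x hx => (hR x hx).2) n (ne' 1) x hx, add_zero]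
    · filter_upwards [ae1, ae2] with x hx hx'
      have := (Qd_lim hx (-Pi.single 0 1)).add (Qd_lim hx' (-Pi.single 1 1))
      rw [map_neg, map_neg, ← neg_add] at this
      exact this
  have l4 : Tendsto (fun n => ∫ x, |Qd n (Pi.single 0 1) u2 x - Qd n (Pi.single 1 1) u1 x| ^ p) atTop
      (𝓝 (∫ x, |pd 0 u2 x - pd 1 u1 x| ^ p)) := by
    refine dct_pow p hp0 (fun n x => Qd n (Pi.single 0 1) u2 x - Qd n (Pi.single 1 1) u1 x)
      (fun x => pd 0 u2 x - pd 1 u1 x) (K2 + K1) (R + 1)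
      (fun n => (Qd_cont c2.1 n _).sub (Qd_cont c1.1 n _)) 
      (fun n x => (abs_sub _ _).trans (add_le_add (Qd_bound L2 n (ne 0) x) (Qd_bound L1 n (ne 1) x)))
      (fun n x hx => ?_) ?_
    · rw [Qd_supp (fun x hx => (hR x hx).1) n (ne 1) x hx, Qd_supp (fun x hx => (hR x hx).2) n (ne 0) x hx, sub_zero]
    · filter_upwards [ae1, ae2] with x hx hx'
      exact (Qd_lim hx' (Pi.single 0 1)).sub (Qd_lim hx (Pi.single 1 1))
  simp only [abs_neg] at l3
  have lr := (l3.add l4).const_mul C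
  have sc : ∀ (n : ℕ) (F : V2 → ℝ), ∫ x, |((n:ℝ) + 1) * F x| ^ p = ((n:ℝ) + 1) ^ p * ∫ x, |F x| ^ p := by
    intro n F
    rw [← integral_const_mul]
    congr 1; ext x
    rw [abs_mul, mul_rpow (abs_nonneg _) (abs_nonneg _), abs_of_pos (by positivity)]
  have key : ∀ n : ℕ, (∫ x, |Qd n (Pi.single j 1) u1 x| ^ p ≤ C * ((∫ x, |Qd n (-Pi.single 0 1) u1 x + Qd n (-Pi.single 1 1) u2 x| ^ p)
      + ∫ x, |Qd n (Pi.single 0 1) u2 x - Qd n (Pi.single 1 1) u1 x| ^ p)) ∧ 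
      (∫ x, |Qd n (Pi.single j 1) u2 x| ^ p ≤ C * ((∫ x, |Qd n (-Pi.single 0 1) u1 x + Qd n (-Pi.single 1 1) u2 x| ^ p)
      + ∫ x, |Qd n (Pi.single 0 1) u2 x - Qd n (Pi.single 1 1) u1 x| ^ p)) := by
    intro n
    have hd : Dir ((1 / ((n:ℝ) + 1)) • (Pi.single 0 1 : V2)) ((1 / ((n:ℝ) + 1)) • (Pi.single 1 1 : V2))
        ((1 / ((n:ℝ) + 1)) • (Pi.single j 1 : V2)) := by
      fin_cases j
      · exact Or.inl rfl
      · exact Or.inr (Or.inr (Or.inl rfl))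
    have := H _ _ _ hd u1 u2 c1 c2
    unfold Qd
    simp only [smul_neg, ← mul_add, ← mul_sub, sc]
    have hpos : (0:ℝ) ≤ ((n:ℝ) + 1) ^ p := by positivity
    constructor
    · refine (mul_le_mul_of_nonneg_left this.1 hpos).trans (le_of_eq (by ring))
    · refine (mul_le_mul_of_nonneg_left this.2 hpos).trans (le_of_eq (by ring))
  exact ⟨le_of_tendsto_of_tendsto' l1 lr (fun n => (key n).1), le_of_tendsto_of_tendsto' l2 lr (fun n => (key n).2)⟩



lemma fderiv_eq_sum (f : V2 → ℝ) (x v : V2) : fderiv ℝ f x v = v 0 * pd 0 f x + v 1 * pd 1 f x := by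
  have hv : v = v 0 • (Pi.single 0 1 : V2) + v 1 • (Pi.single 1 1 : V2) := by
    ext i; fin_cases i <;> simp
  conv_lhs => rw [hv]
  rw [map_add, map_smul, map_smul]; rfl

lemma contDiff_pd {m n : WithTop ℕ∞} {f : V2 → ℝ} (hf : ContDiff ℝ n f) (h : m + 1 ≤ n) (i : Fin 2) :
    ContDiff ℝ m (pd i f) := by
  unfold pd
  exact (hf.fderiv_right h).clm_apply contDiff_const

lemma smooth_pd {f : V2 → ℝ} (hf : ContDiff ℝ (⊤ : ℕ∞) f) (i : Fin 2) :
    ContDiff ℝ (⊤ : ℕ∞) (pd i f) := contDiff_pd hf (by simp) i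

/-- Collected facts on the domain. -/
structure DomFn (Ω : Set V2) (φ : V2 → ℝ) : Prop where
  ne : Ω.Nonempty
  bdd : IsBounded Ω
  smooth : ContDiff ℝ (⊤ : ℕ∞) φ
  eq : Ω = {x | φ x < 0}
  fr : frontier Ω = {x | φ x = 0}
  gr : ∀ x ∈ frontier Ω, grad φ x ≠ 0
  conv : Convex ℝ Ω

lemma DomFn.isOpen {Ω : Set V2} {φ : V2 → ℝ} (h : DomFn Ω φ) : IsOpen Ω := by
  rw [h.eq]; exact isOpen_lt h.smooth.continuous continuous_const

lemma DomFn.closure {Ω : Set V2} {φ : V2 → ℝ} (h : DomFn Ω φ) : closure Ω = {x | φ x ≤ 0} := by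
  rw [closure_eq_self_union_frontier, h.fr]
  nth_rw 1 [h.eq]
  ext x; simp [le_iff_lt_or_eq]

lemma DomFn.compact_fr {Ω : Set V2} {φ : V2 → ℝ} (h : DomFn Ω φ) : IsCompact (frontier Ω) :=
  Metric.isCompact_of_isClosed_isBounded isClosed_frontier (h.bdd.closure.subset frontier_subset_closure)

lemma DomFn.compact_cl {Ω : Set V2} {φ : V2 → ℝ} (h : DomFn Ω φ) : IsCompact (_root_.closure Ω) :=
  h.bdd.isCompact_closure

lemma nsq_pos {a : V2} (h : a ≠ 0) : 0 < nsq a := by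
  unfold nsq
  simp only [Fin.sum_univ_two]
  by_contra hc
  have h0 : a 0 = 0 := by nlinarith [sq_nonneg (a 0), sq_nonneg (a 1)]
  have h1 : a 1 = 0 := by nlinarith [sq_nonneg (a 0), sq_nonneg (a 1)]
  exact h (by ext i; fin_cases i <;> simp [h0, h1])

lemma smooth_nsq {φ : V2 → ℝ} (h : ContDiff ℝ (⊤ : ℕ∞) φ) : ContDiff ℝ (⊤ : ℕ∞) (fun x => nsq (grad φ x)) := by
  unfold nsq grad
  simp only [Fin.sum_univ_two]
  exact ((smooth_pd h 0).pow 2).add ((smooth_pd h 1).pow 2)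

/-- normal-like field -/
def Nv (φ : V2 → ℝ) (x : V2) : V2 := fun a => pd a φ x / nsq (grad φ x)

/-- reflection -/
def Rf (φ : V2 → ℝ) (x : V2) : V2 := x - (2 * φ x) • Nv φ x

/-- reflection matrix -/
def Qm (φ : V2 → ℝ) (a b : Fin 2) (x : V2) : ℝ :=
  (if a = b then 1 else 0) - 2 * (pd a φ x * pd b φ x / nsq (grad φ x))

section
variable {Ω : Set V2} {φ : V2 → ℝ}

lemma Nv_smooth (h : DomFn Ω φ) {x : V2} (hx : grad φ x ≠ 0) : ContDiffAt ℝ (⊤ : ℕ∞) (Nv φ) x := by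
  rw [contDiffAt_pi]
  intro a
  exact (smooth_pd h.smooth a).contDiffAt.div (smooth_nsq h.smooth).contDiffAt (nsq_pos hx).ne'

lemma Rf_smooth (h : DomFn Ω φ) {x : V2} (hx : grad φ x ≠ 0) : ContDiffAt ℝ (⊤ : ℕ∞) (Rf φ) x :=
  contDiffAt_id.sub ((contDiffAt_const.mul h.smooth.contDiffAt).smul (Nv_smooth h hx))

lemma Qm_smooth (h : DomFn Ω φ) (a b : Fin 2) {x : V2} (hx : grad φ x ≠ 0) :
    ContDiffAt ℝ (⊤ : ℕ∞) (Qm φ a b) x :=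
  contDiffAt_const.sub (contDiffAt_const.mul (((smooth_pd h.smooth a).contDiffAt.mul
    (smooth_pd h.smooth b).contDiffAt).div (smooth_nsq h.smooth).contDiffAt (nsq_pos hx).ne'))

lemma Qm_rel {x : V2} (hx : grad φ x ≠ 0) : Qm φ 1 0 x = Qm φ 0 1 x ∧ Qm φ 1 1 x = - Qm φ 0 0 x ∧
    Qm φ 0 0 x ^ 2 + Qm φ 0 1 x ^ 2 = 1 := by
  have hs := (nsq_pos hx).ne'
  have e : nsq (grad φ x) = pd 0 φ x ^ 2 + pd 1 φ x ^ 2 := by simp [nsq, grad]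
  rw [e] at hs
  unfold Qm
  simp only [e]
  refine ⟨by simp; ring, by simp; field_simp; ring, by simp; field_simp; ring⟩

lemma Rf_fr {x : V2} (hx : φ x = 0) : Rf φ x = x := by simp [Rf, hx]

lemma Dphi_Nv {x : V2} (hx : grad φ x ≠ 0) : fderiv ℝ φ x (Nv φ x) = 1 := by
  have hs := (nsq_pos hx).ne'
  have e : nsq (grad φ x) = pd 0 φ x ^ 2 + pd 1 φ x ^ 2 := by simp [nsq, grad]
  rw [e] at hs
  rw [fderiv_eq_sum]; unfold Nv; rw [e]; field_simp

lemma Rf_deriv (h : DomFn Ω φ) {x : V2} (hx : grad φ x ≠ 0) (h0 : φ x = 0) :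
    fderiv ℝ (Rf φ) x = ContinuousLinearMap.id ℝ V2 - ((2:ℝ) • fderiv ℝ φ x).smulRight (Nv φ x) := by
  have h1 : HasFDerivAt φ (fderiv ℝ φ x) x := (h.smooth.differentiable (by simp) x).hasFDerivAt
  have h2 := ((Nv_smooth h hx).differentiableAt (by simp)).hasFDerivAt
  have h3 := (hasFDerivAt_id x).sub ((h1.const_mul 2).smul h2)
  have h4 : HasFDerivAt (Rf φ) _ x := h3
  rw [h4.fderiv]
  ext v
  simp [h0]

lemma Rf_invol (h : DomFn Ω φ) {x : V2} (hx : grad φ x ≠ 0) (h0 : φ x = 0) (v : V2) :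
    fderiv ℝ (Rf φ) x (fderiv ℝ (Rf φ) x v) = v := by
  rw [Rf_deriv h hx h0]
  simp only [ContinuousLinearMap.sub_apply, ContinuousLinearMap.id_apply, ContinuousLinearMap.smulRight_apply,
    ContinuousLinearMap.smul_apply, map_sub, map_smul, Dphi_Nv hx, smul_eq_mul, mul_one]
  module

lemma pd_Rf_fr (h : DomFn Ω φ) {x : V2} (hx : grad φ x ≠ 0) (h0 : φ x = 0) (c d : Fin 2) :
    fderiv ℝ (Rf φ) x (Pi.single c 1) d = Qm φ d c x := by
  rw [Rf_deriv h hx h0]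
  have : fderiv ℝ φ x (Pi.single c 1) = pd c φ x := rfl
  simp only [ContinuousLinearMap.sub_apply, ContinuousLinearMap.id_apply, ContinuousLinearMap.smulRight_apply,
    ContinuousLinearMap.smul_apply, this, Pi.sub_apply, Pi.smul_apply, smul_eq_mul, Nv, Qm, Pi.single_apply]
  ring

/-- the good collar -/
lemma exists_collar (h : DomFn Ω φ) (η : ℝ) (hη : 0 < η) : ∃ W : Set V2, IsOpen W ∧ frontier Ω ⊆ W ∧
    InjOn (Rf φ) W ∧ (∀ x ∈ W, grad φ x ≠ 0) ∧
    (∀ x ∈ W, ∀ c d, |fderiv ℝ (Rf φ) x (Pi.single c 1) d - Qm φ d c x| ≤ η) ∧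
    (∀ x ∈ W, 1 / 2 ≤ |(fderiv ℝ (Rf φ) x).det|) ∧ (∀ x ∈ W, 0 < φ x → Rf φ x ∈ Ω) := by
  have hfr : ∀ x ∈ frontier Ω, φ x = 0 := fun x hx => by rw [h.fr] at hx; exact hx
  have hgc : Continuous (grad φ) := continuous_pi fun i => (smooth_pd h.smooth i).continuous
  have hdc : ∀ x ∈ frontier Ω, ContinuousAt (fderiv ℝ (Rf φ)) x := fun x hx =>
    ((Rf_smooth h (h.gr x hx)).fderiv_right (m := 0) (by simp)).continuousAt
  obtain ⟨t, ht, hinj⟩ := Set.InjOn.exists_mem_nhdsSet (f := Rf φ) (s := frontier Ω)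
    (fun x hx y hy hxy => by rwa [Rf_fr (hfr x hx), Rf_fr (hfr y hy)] at hxy) h.compact_fr
    (fun x hx => (Rf_smooth h (h.gr x hx)).continuousAt)
    (fun x hx => by
      have hs := (Rf_smooth h (h.gr x hx)).hasStrictFDerivAt (by simp)
      let L := fderiv ℝ (Rf φ) x
      let e : V2 ≃L[ℝ] V2 := ContinuousLinearEquiv.equivOfInverse L L
        (fun v => Rf_invol h (h.gr x hx) (hfr x hx) v) (fun v => Rf_invol h (h.gr x hx) (hfr x hx) v)
      have hs' : HasStrictFDerivAt (Rf φ) (e : V2 →L[ℝ] V2) x := hs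
      exact ⟨(hs'.toOpenPartialHomeomorph (Rf φ)).source,
        (hs'.toOpenPartialHomeomorph (Rf φ)).open_source.mem_nhds hs'.mem_toOpenPartialHomeomorph_source,
        (hs'.toOpenPartialHomeomorph (Rf φ)).injOn⟩)
  have ev : ∀ᶠ x in 𝓝ˢ (frontier Ω), x ∈ t ∧ grad φ x ≠ 0 ∧
     (∀ c d, |fderiv ℝ (Rf φ) x (Pi.single c 1) d - Qm φ d c x| ≤ η) ∧
     1 / 2 ≤ |(fderiv ℝ (Rf φ) x).det| ∧ (0 < φ x → Rf φ x ∈ Ω) := by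
    refine Filter.Eventually.and ht ?_
    rw [eventually_nhdsSet_iff_forall]
    intro x hx
    have hx0 := hfr x hx
    have hgx := h.gr x hx
    have e1 : ∀ᶠ y in 𝓝 x, grad φ y ≠ 0 := hgc.continuousAt.eventually_ne hgx
    have e2 : ∀ᶠ y in 𝓝 x, ∀ c d, |fderiv ℝ (Rf φ) y (Pi.single c 1) d - Qm φ d c y| ≤ η := by
      rw [eventually_all]; intro c
      rw [eventually_all]; intro d
      have hc1 : ContinuousAt (fun y => fderiv ℝ (Rf φ) y (Pi.single c 1) d - Qm φ d c y) x := by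
        have a1 : ContinuousAt (fun y => fderiv ℝ (Rf φ) y (Pi.single c 1)) x :=
          (hdc x hx).clm_apply continuousAt_const
        exact ((continuous_apply d).continuousAt.comp a1).sub (Qm_smooth h d c hgx).continuousAt
      have hc2 := hc1.abs
      have hz : |fderiv ℝ (Rf φ) x (Pi.single c 1) d - Qm φ d c x| < η := by
        rw [pd_Rf_fr h hgx hx0, sub_self, abs_zero]; exact hη
      filter_upwards [hc2.eventually_lt continuousAt_const hz] with y hy using hy.le
    have e3 : ∀ᶠ y in 𝓝 x, 1 / 2 ≤ |(fderiv ℝ (Rf φ) y).det| := by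
      have hc : ContinuousAt (fun y => |(fderiv ℝ (Rf φ) y).det|) x :=
        (ContinuousLinearMap.continuous_det.continuousAt.comp (hdc x hx)).abs
      have hd : |(fderiv ℝ (Rf φ) x).det| = 1 := by
        have : (fderiv ℝ (Rf φ) x).det * (fderiv ℝ (Rf φ) x).det = 1 := by
          unfold ContinuousLinearMap.det
          rw [← LinearMap.det_comp]
          have : (↑(fderiv ℝ (Rf φ) x) : V2 →ₗ[ℝ] V2) ∘ₗ ↑(fderiv ℝ (Rf φ) x) = LinearMap.id := by
            apply LinearMap.ext
            intro v
            exact Rf_invol h hgx hx0 v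
          rw [this, LinearMap.det_id]
        rcases mul_self_eq_one_iff.mp this with h | h <;> rw [h] <;> simp
      have : (1/2 : ℝ) < |(fderiv ℝ (Rf φ) x).det| := by rw [hd]; norm_num
      filter_upwards [continuousAt_const.eventually_lt hc this] with y hy using hy.le
    have e4 : ∀ᶠ y in 𝓝 x, 0 < φ y → Rf φ y ∈ Ω := by
      -- ratio function
      have hc : ContinuousAt (fun z : V2 × V2 => fderiv ℝ φ z.1 (Nv φ z.2)) (x, x) := by
        have a1 : ContinuousAt (fun z : V2 × V2 => fderiv ℝ φ z.1) (x, x) :=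
          ((h.smooth.continuous_fderiv (by simp)).comp continuous_fst).continuousAt
        have a2 : ContinuousAt (fun z : V2 × V2 => Nv φ z.2) (x, x) :=
          ContinuousAt.comp (f := Prod.snd) (g := Nv φ) (x := (x, x)) (Nv_smooth h hgx).continuousAt continuousAt_snd
        exact a1.clm_apply a2
      have hlt : (3/4 : ℝ) < fderiv ℝ φ x (Nv φ x) := by rw [Dphi_Nv hgx]; norm_num
      have hev := continuousAt_const.eventually_lt hc hlt
      rw [nhds_prod_eq] at hev
      obtain ⟨pa, ha, pb, hb, hab⟩ := eventually_prod_iff.mp hev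
      obtain ⟨r, hr, hball⟩ := Metric.eventually_nhds_iff_ball.mp ha
      have hR : ∀ᶠ y in 𝓝 x, Rf φ y ∈ Metric.ball x r := by
        have := (Rf_smooth h hgx).continuousAt
        unfold ContinuousAt at this
        rw [Rf_fr hx0] at this
        exact this (Metric.ball_mem_nhds x hr)
      filter_upwards [hR, hb, Metric.ball_mem_nhds x hr] with y hy hyb hyr hpos
      -- mean value
      have hmv : ∃ z ∈ segment ℝ (Rf φ y) y, φ y - φ (Rf φ y) = fderiv ℝ φ z (y - Rf φ y) := by
        obtain ⟨z, hz, hz2⟩ := domain_mvt (f := φ) (f' := fun z => fderiv ℝ φ z) (s := univ)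
          (fun z _ => (h.smooth.differentiable (by simp) z).hasFDerivAt.hasFDerivWithinAt)
          convex_univ (mem_univ (Rf φ y)) (mem_univ y)
        exact ⟨z, hz, hz2⟩
      obtain ⟨z, hz, hzz⟩ := hmv
      have hzball : z ∈ Metric.ball x r := (convex_ball x r).segment_subset hy hyr hz
      have hrat := hab (hball z hzball) hyb
      simp only at hrat
      have hdiff : y - Rf φ y = (2 * φ y) • Nv φ y := by simp [Rf]
      rw [hdiff, map_smul, smul_eq_mul] at hzz
      rw [h.eq, mem_setOf_eq]
      nlinarith
    filter_upwards [e1, e2, e3, e4] with y h1 h2 h3 h4 using ⟨h1, h2, h3, h4⟩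
  obtain ⟨W, hWo, hW1, hW2⟩ := mem_nhdsSet_iff_exists.mp ev
  exact ⟨W, hWo, hW1, fun x hx y hy hxy => hinj (hW2 hx).1 (hW2 hy).1 hxy, fun x hx => (hW2 hx).2.1,
    fun x hx => (hW2 hx).2.2.1, fun x hx => (hW2 hx).2.2.2.1, fun x hx => (hW2 hx).2.2.2.2⟩

end


lemma glue_lip {Ω : Set V2} (ho : IsOpen Ω) {u w : V2 → ℝ} {K : NNReal} (hu : LipschitzOnWith K u (closure Ω))
    (hw : LipschitzWith K w) (hfr : ∀ x ∈ frontier Ω, u x = w x) {f : V2 → ℝ} (hf1 : ∀ x ∈ Ω, f x = u x)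
    (hf2 : ∀ x, x ∉ Ω → f x = w x) : LipschitzWith K f := by
  have key : ∀ x ∈ Ω, ∀ y, y ∉ Ω → dist (f x) (f y) ≤ K * dist x y := by
    intro x hx y hy
    obtain ⟨z, hz, hzf⟩ : ∃ z ∈ segment ℝ x y, z ∈ frontier Ω := by
      by_contra hc
      push Not at hc
      have hseg : segment ℝ x y ⊆ Ω ∪ (closure Ω)ᶜ := by
        intro z hz
        by_cases h : z ∈ Ω
        · exact Or.inl h
        · right
          intro hcl
          exact hc z hz (by rw [ho.frontier_eq]; exact ⟨hcl, h⟩)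
      have := (convex_segment x y).isPreconnected Ω (closure Ω)ᶜ ho isClosed_closure.isOpen_compl hseg
        ⟨x, left_mem_segment ℝ x y, hx⟩
        ⟨y, right_mem_segment ℝ x y, (hseg (right_mem_segment ℝ x y)).resolve_left hy⟩
      obtain ⟨z, _, h1, h2⟩ := this
      exact h2 (subset_closure h1)
    rw [hf1 x hx, hf2 y hy, ← dist_add_dist_of_mem_segment hz, mul_add]
    refine (dist_triangle _ (u z) _).trans (add_le_add ?_ ?_)
    · exact hu.dist_le_mul x (subset_closure hx) z (frontier_subset_closure hzf)
    · rw [hfr z hzf]; exact hw.dist_le_mul z y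
  refine LipschitzWith.of_dist_le_mul fun x y => ?_
  by_cases hx : x ∈ Ω <;> by_cases hy : y ∈ Ω
  · rw [hf1 x hx, hf1 y hy]; exact hu.dist_le_mul x (subset_closure hx) y (subset_closure hy)
  · exact key x hx y hy
  · rw [dist_comm, dist_comm x y]; exact key y hy x hx
  · rw [hf2 x hx, hf2 y hy]; exact hw.dist_le_mul x y

lemma exists_cutoff {F W : Set V2} (hF : IsCompact F) (hW : IsOpen W) (hFW : F ⊆ W) :
    ∃ χ : V2 → ℝ, ContDiff ℝ (⊤ : ℕ∞) χ ∧ (∀ x, 0 ≤ χ x ∧ χ x ≤ 1) ∧ (∀ x ∈ F, χ x = 1) ∧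
      HasCompactSupport χ ∧ tsupport χ ⊆ W := by
  obtain ⟨K, hK, hFK, hKW⟩ := exists_compact_between hF hW hFW
  obtain ⟨f, hf, hr, hs, h1⟩ := exists_contMDiff_support_eq_eq_one_iff (n := (⊤ : ℕ∞)) (modelWithCornersSelf ℝ V2)
    isOpen_interior hF.isClosed hFK
  have hsub : tsupport f ⊆ K := by
    rw [tsupport, hs]; exact closure_minimal interior_subset hK.isClosed
  exact ⟨f, hf.contDiff, fun x => hr ⟨x, rfl⟩, fun x hx => (h1 x).1 hx,
    HasCompactSupport.of_support_subset_isCompact hK (by rw [hs]; exact interior_subset), hsub.trans hKW⟩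

lemma add_rpow_le2 {p a b : ℝ} (hp : 0 ≤ p) (ha : 0 ≤ a) (hb : 0 ≤ b) : (a + b) ^ p ≤ 2 ^ p * (a ^ p + b ^ p) := by
  have h1 : a ^ p ≤ a ^ p + b ^ p := le_add_of_nonneg_right (rpow_nonneg hb p)
  have h2 : b ^ p ≤ a ^ p + b ^ p := le_add_of_nonneg_left (rpow_nonneg ha p)
  rcases le_total a b with h | h
  · calc (a + b) ^ p ≤ (2 * b) ^ p := rpow_le_rpow (by positivity) (by linarith) hp
      _ = 2 ^ p * b ^ p := mul_rpow (by norm_num) hb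
      _ ≤ _ := by gcongr
  · calc (a + b) ^ p ≤ (2 * a) ^ p := rpow_le_rpow (by positivity) (by linarith) hp
      _ = 2 ^ p * a ^ p := mul_rpow (by norm_num) ha
      _ ≤ _ := by gcongr

lemma add_rpow_le4 {p a b c d : ℝ} (hp : 0 ≤ p) (ha : 0 ≤ a) (hb : 0 ≤ b) (hc : 0 ≤ c) (hd : 0 ≤ d) :
    (a + b + c + d) ^ p ≤ 4 ^ p * (a ^ p + b ^ p + c ^ p + d ^ p) := by
  have e : (4:ℝ) ^ p = 2 ^ p * 2 ^ p := by rw [← mul_rpow (by norm_num) (by norm_num)]; norm_num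
  have h2 : (0:ℝ) ≤ 2 ^ p := by positivity
  calc (a + b + c + d) ^ p = ((a + b) + (c + d)) ^ p := by ring_nf
    _ ≤ 2 ^ p * ((a + b) ^ p + (c + d) ^ p) := add_rpow_le2 hp (by positivity) (by positivity)
    _ ≤ 2 ^ p * (2 ^ p * (a ^ p + b ^ p) + 2 ^ p * (c ^ p + d ^ p)) := by
        gcongr <;> apply add_rpow_le2 <;> assumption
    _ = _ := by rw [e]; ring

lemma add_rpow_le3 {p a b c : ℝ} (hp : 0 < p) (ha : 0 ≤ a) (hb : 0 ≤ b) (hc : 0 ≤ c) :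
    (a + b + c) ^ p ≤ 4 ^ p * (a ^ p + b ^ p + c ^ p) := by
  have := add_rpow_le4 hp.le ha hb hc (le_refl (0:ℝ))
  simpa [zero_rpow hp.ne'] using this

section
variable {Ω : Set V2} {φ : V2 → ℝ}

/-- reflected field -/
def wf (φ χ : V2 → ℝ) (u : Fin 2 → V2 → ℝ) (a : Fin 2) (x : V2) : ℝ :=
  χ x * Qm φ a 0 x * u 0 (Rf φ x) + χ x * Qm φ a 1 x * u 1 (Rf φ x)

lemma wf_deriv (h : DomFn Ω φ) {χ : V2 → ℝ} (hχ : ContDiff ℝ (⊤ : ℕ∞) χ) {u : Fin 2 → V2 → ℝ}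
    (hu : ∀ i, ContDiff ℝ 1 (u i)) (a c : Fin 2) {x : V2} (hx : grad φ x ≠ 0) :
    pd c (wf φ χ u a) x =
      pd c (fun y => χ y * Qm φ a 0 y) x * u 0 (Rf φ x) + pd c (fun y => χ y * Qm φ a 1 y) x * u 1 (Rf φ x)
      + χ x * Qm φ a 0 x * (fderiv ℝ (Rf φ) x (Pi.single c 1) 0 * pd 0 (u 0) (Rf φ x)
          + fderiv ℝ (Rf φ) x (Pi.single c 1) 1 * pd 1 (u 0) (Rf φ x))
      + χ x * Qm φ a 1 x * (fderiv ℝ (Rf φ) x (Pi.single c 1) 0 * pd 0 (u 1) (Rf φ x)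
          + fderiv ℝ (Rf φ) x (Pi.single c 1) 1 * pd 1 (u 1) (Rf φ x)) := by
  have hR := ((Rf_smooth h hx).differentiableAt (by simp)).hasFDerivAt
  have hq : ∀ b, HasFDerivAt (fun y => χ y * Qm φ a b y) (fderiv ℝ (fun y => χ y * Qm φ a b y) x) x := fun b =>
    (((hχ.contDiffAt (x := x)).mul (Qm_smooth h a b hx)).differentiableAt (by simp)).hasFDerivAt
  have hc : ∀ b, HasFDerivAt (fun y => u b (Rf φ y)) ((fderiv ℝ (u b) (Rf φ x)).comp (fderiv ℝ (Rf φ) x)) x :=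
    fun b => (((hu b).differentiable (by simp) (Rf φ x)).hasFDerivAt).comp x hR
  have hw : HasFDerivAt (wf φ χ u a) _ x := ((hq 0).mul (hc 0)).add ((hq 1).mul (hc 1))
  have e : pd c (wf φ χ u a) x = fderiv ℝ (wf φ χ u a) x (Pi.single c 1) := rfl
  rw [e, hw.fderiv]
  simp only [ContinuousLinearMap.add_apply, ContinuousLinearMap.smul_apply, ContinuousLinearMap.comp_apply,
    smul_eq_mul, fderiv_eq_sum (u _) (Rf φ x)]
  unfold pd
  ring

lemma wf_contDiff (h : DomFn Ω φ) {χ : V2 → ℝ} (hχ : ContDiff ℝ (⊤ : ℕ∞) χ) {u : Fin 2 → V2 → ℝ}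
    (hu : ∀ i, ContDiff ℝ 1 (u i)) (hg : ∀ x ∈ tsupport χ, grad φ x ≠ 0) (a : Fin 2) :
    ContDiff ℝ 1 (wf φ χ u a) := by
  rw [contDiff_iff_contDiffAt]
  intro x
  by_cases hx : x ∈ tsupport χ
  · have hR : ContDiffAt ℝ 1 (Rf φ) x := (Rf_smooth h (hg x hx)).of_le (by simp)
    have hq : ∀ b, ContDiffAt ℝ 1 (Qm φ a b) x := fun b => (Qm_smooth h a b (hg x hx)).of_le (by simp)
    have hc : ContDiffAt ℝ 1 χ x := hχ.contDiffAt.of_le (by simp)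
    have hcc : ∀ b, ContDiffAt ℝ 1 (fun y => u b (Rf φ y)) x := fun b => (hu b).contDiffAt.comp x hR
    exact ((hc.mul (hq 0)).mul (hcc 0)).add ((hc.mul (hq 1)).mul (hcc 1))
  · have : wf φ χ u a =ᶠ[𝓝 x] fun _ => 0 := by
      filter_upwards [notMem_tsupport_iff_eventuallyEq.1 hx] with y hy
      simp [wf, hy]
    exact contDiffAt_const.congr_of_eventuallyEq this

/-- pointwise algebra -/
lemma alg_div (η k q r t : ℝ) (hq : q ^ 2 + r ^ 2 = 1) (ht : 0 ≤ t ∧ t ≤ 1)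
    (c : Fin 2 → Fin 2 → Fin 2 → ℝ) (hc : ∀ a b d, |c a b d| ≤ k)
    (E : Fin 2 → Fin 2 → ℝ) (v : Fin 2 → ℝ) (M : Fin 2 → Fin 2 → ℝ)
    (h00 : |E 0 0 - q| ≤ η) (h01 : |E 0 1 - r| ≤ η) (h10 : |E 1 0 - r| ≤ η) (h11 : |E 1 1 - (-q)| ≤ η) :
    |(c 0 0 0 * v 0 + c 0 0 1 * v 1 + t * q * (E 0 0 * M 0 0 + E 0 1 * M 1 0) + t * r * (E 0 0 * M 0 1 + E 0 1 * M 1 1))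
     + (c 1 1 0 * v 0 + c 1 1 1 * v 1 + t * r * (E 1 0 * M 0 0 + E 1 1 * M 1 0) + t * (-q) * (E 1 0 * M 0 1 + E 1 1 * M 1 1))|
    ≤ |M 0 0 + M 1 1| + 2 * η * (|M 0 0| + |M 0 1| + |M 1 0| + |M 1 1|) + 2 * k * (|v 0| + |v 1|) ∧
    |(c 1 0 0 * v 0 + c 1 0 1 * v 1 + t * r * (E 0 0 * M 0 0 + E 0 1 * M 1 0) + t * (-q) * (E 0 0 * M 0 1 + E 0 1 * M 1 1))
     - (c 0 1 0 * v 0 + c 0 1 1 * v 1 + t * q * (E 1 0 * M 0 0 + E 1 1 * M 1 0) + t * r * (E 1 0 * M 0 1 + E 1 1 * M 1 1))|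
    ≤ |M 0 1 - M 1 0| + 2 * η * (|M 0 0| + |M 0 1| + |M 1 0| + |M 1 1|) + 2 * k * (|v 0| + |v 1|) := by
  have hη : 0 ≤ η := (abs_nonneg _).trans h00
  have aq : |q| ≤ 1 := abs_le.2 ⟨by nlinarith [sq_nonneg r], by nlinarith [sq_nonneg r]⟩
  have ar : |r| ≤ 1 := abs_le.2 ⟨by nlinarith [sq_nonneg q], by nlinarith [sq_nonneg q]⟩
  have at' : |t| ≤ 1 := by rw [abs_of_nonneg ht.1]; exact ht.2
  have B3 : ∀ s e m : ℝ, |s| ≤ 1 → |e| ≤ η → |t * s * e * m| ≤ η * |m| := by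
    intro s e m hs he
    rw [abs_mul, abs_mul, abs_mul]
    have h1 : |t| * |s| ≤ 1 := mul_le_one₀ at' (abs_nonneg _) hs
    have h2 : |t| * |s| * |e| ≤ η := by
      calc |t| * |s| * |e| ≤ 1 * η := mul_le_mul h1 he (abs_nonneg _) zero_le_one
        _ = η := one_mul _
    exact mul_le_mul_of_nonneg_right h2 (abs_nonneg _)
  have Bv : ∀ a b d, |c a b d * v d| ≤ k * |v d| := fun a b d => by
    rw [abs_mul]; exact mul_le_mul_of_nonneg_right (hc a b d) (abs_nonneg _)
  have Bt : ∀ m : ℝ, |t * m| ≤ |m| := fun m => by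
    rw [abs_mul]; exact mul_le_of_le_one_left (abs_nonneg _) at'
  constructor
  · have e : (c 0 0 0 * v 0 + c 0 0 1 * v 1 + t * q * (E 0 0 * M 0 0 + E 0 1 * M 1 0) + t * r * (E 0 0 * M 0 1 + E 0 1 * M 1 1))
     + (c 1 1 0 * v 0 + c 1 1 1 * v 1 + t * r * (E 1 0 * M 0 0 + E 1 1 * M 1 0) + t * (-q) * (E 1 0 * M 0 1 + E 1 1 * M 1 1))
      = t * ((q ^ 2 + r ^ 2) * (M 0 0 + M 1 1)) + (c 0 0 0 * v 0 + c 0 0 1 * v 1 + c 1 1 0 * v 0 + c 1 1 1 * v 1)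
       + (t * q * (E 0 0 - q) * M 0 0 + t * q * (E 0 1 - r) * M 1 0 + t * r * (E 0 0 - q) * M 0 1 + t * r * (E 0 1 - r) * M 1 1)
       + (t * r * (E 1 0 - r) * M 0 0 + t * r * (E 1 1 - (-q)) * M 1 0 + t * (-q) * (E 1 0 - r) * M 0 1
          + t * (-q) * (E 1 1 - (-q)) * M 1 1) := by ring
    rw [e, hq, one_mul]
    have b0 := abs_le.1 (Bt (M 0 0 + M 1 1))
    have b1 := abs_le.1 (Bv 0 0 0)
    have b2 := abs_le.1 (Bv 0 0 1)
    have b3 := abs_le.1 (Bv 1 1 0)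
    have b4 := abs_le.1 (Bv 1 1 1)
    have anq : |-q| ≤ 1 := by rwa [abs_neg]
    have d1 := abs_le.1 (B3 q _ (M 0 0) aq h00)
    have d2 := abs_le.1 (B3 q _ (M 1 0) aq h01)
    have d3 := abs_le.1 (B3 r _ (M 0 1) ar h00)
    have d4 := abs_le.1 (B3 r _ (M 1 1) ar h01)
    have d5 := abs_le.1 (B3 r _ (M 0 0) ar h10)
    have d6 := abs_le.1 (B3 r _ (M 1 0) ar h11)
    have d7 := abs_le.1 (B3 (-q) _ (M 0 1) anq h10)
    have d8 := abs_le.1 (B3 (-q) _ (M 1 1) anq h11)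
    rw [abs_le]
    constructor <;> linarith
  · have e : (c 1 0 0 * v 0 + c 1 0 1 * v 1 + t * r * (E 0 0 * M 0 0 + E 0 1 * M 1 0) + t * (-q) * (E 0 0 * M 0 1 + E 0 1 * M 1 1))
     - (c 0 1 0 * v 0 + c 0 1 1 * v 1 + t * q * (E 1 0 * M 0 0 + E 1 1 * M 1 0) + t * r * (E 1 0 * M 0 1 + E 1 1 * M 1 1))
      = t * ((q ^ 2 + r ^ 2) * (M 1 0 - M 0 1)) + (c 1 0 0 * v 0 + c 1 0 1 * v 1 - c 0 1 0 * v 0 - c 0 1 1 * v 1)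
       + (t * r * (E 0 0 - q) * M 0 0 + t * r * (E 0 1 - r) * M 1 0 + t * (-q) * (E 0 0 - q) * M 0 1 + t * (-q) * (E 0 1 - r) * M 1 1)
       - (t * q * (E 1 0 - r) * M 0 0 + t * q * (E 1 1 - (-q)) * M 1 0 + t * r * (E 1 0 - r) * M 0 1
          + t * r * (E 1 1 - (-q)) * M 1 1) := by ring
    rw [e, hq, one_mul, abs_sub_comm (M 0 1)]
    have b0 := abs_le.1 (Bt (M 1 0 - M 0 1))
    have b1 := abs_le.1 (Bv 1 0 0)
    have b2 := abs_le.1 (Bv 1 0 1)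
    have b3 := abs_le.1 (Bv 0 1 0)
    have b4 := abs_le.1 (Bv 0 1 1)
    have anq : |-q| ≤ 1 := by rwa [abs_neg]
    have d1 := abs_le.1 (B3 q _ (M 0 0) aq h10)
    have d2 := abs_le.1 (B3 q _ (M 1 0) aq h11)
    have d3 := abs_le.1 (B3 r _ (M 0 1) ar h10)
    have d4 := abs_le.1 (B3 r _ (M 1 1) ar h11)
    have d5 := abs_le.1 (B3 r _ (M 0 0) ar h00)
    have d6 := abs_le.1 (B3 r _ (M 1 0) ar h01)
    have d7 := abs_le.1 (B3 (-q) _ (M 0 1) anq h00)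
    have d8 := abs_le.1 (B3 (-q) _ (M 1 1) anq h01)
    rw [abs_le]
    constructor <;> linarith

end



lemma DomFn.intOn {Ω : Set V2} {φ f : V2 → ℝ} (h : DomFn Ω φ) (hf : Continuous f) : IntegrableOn f Ω :=
  (hf.continuousOn.integrableOn_compact h.compact_cl).mono_set subset_closure

lemma cont_abspow {f : V2 → ℝ} (hf : Continuous f) {p : ℝ} (hp : 0 ≤ p) : Continuous (fun x => |f x| ^ p) :=
  hf.abs.rpow_const (fun _ => Or.inr hp)

lemma DomFn.split {Ω : Set V2} {φ : V2 → ℝ} (h : DomFn Ω φ) {f g1 g2 : V2 → ℝ} (h1 : ∀ x ∈ Ω, f x = g1 x)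
    (h2 : ∀ x ∈ (_root_.closure Ω)ᶜ, f x = g2 x) (i1 : IntegrableOn g1 Ω) (i2 : Integrable g2) :
    Integrable f ∧ ∫ x, f x = (∫ x in Ω, g1 x) + ∫ x in (_root_.closure Ω)ᶜ, g2 x := by
  have hae : (Ωᶜ : Set V2) =ᵐ[volume] (_root_.closure Ω)ᶜ := by
    have := (h.conv.addHaar_frontier volume)
    have h3 : (_root_.closure Ω) =ᵐ[volume] Ω := by
      refine (ae_eq_set.2 ⟨?_, ?_⟩)
      · rw [← h.isOpen.frontier_eq]; exact this
      · rw [Set.sdiff_eq_empty.2 subset_closure]; simp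
    exact h3.compl.symm
  have mo := h.isOpen.measurableSet
  have mc : MeasurableSet (_root_.closure Ω)ᶜ := isClosed_closure.measurableSet.compl
  have j1 : IntegrableOn f Ω := i1.congr_fun (fun x hx => (h1 x hx).symm) mo
  have j2 : IntegrableOn f (_root_.closure Ω)ᶜ := (i2.integrableOn (s := (_root_.closure Ω)ᶜ)).congr_fun (fun x hx => (h2 x hx).symm) mc
  have j3 : IntegrableOn f Ωᶜ := j2.congr_set_ae hae
  have j : Integrable f := by
    rw [← integrableOn_univ, ← union_compl_self Ω]; exact j1.union j3
  refine ⟨j, ?_⟩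
  have e1 : ∫ x in Ωᶜ, f x = ∫ x in (_root_.closure Ω)ᶜ, f x := setIntegral_congr_set hae
  have e2 : ∫ x in (_root_.closure Ω)ᶜ, f x = ∫ x in (_root_.closure Ω)ᶜ, g2 x := setIntegral_congr_fun mc h2
  rw [← integral_add_compl mo j, setIntegral_congr_fun mo h1, e1, e2]

lemma ion_add {Ω : Set V2} {f g : V2 → ℝ} (hf : IntegrableOn f Ω) (hg : IntegrableOn g Ω) :
    IntegrableOn (fun x => f x + g x) Ω := hf.add hg

lemma ext_cov {Ω W S : Set V2} {φ : V2 → ℝ} (h : DomFn Ω φ) (hS : MeasurableSet S) (hSW : S ⊆ W) (hinj : InjOn (Rf φ) W)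
    (hg : ∀ x ∈ W, grad φ x ≠ 0) (hdet : ∀ x ∈ W, 1 / 2 ≤ |(fderiv ℝ (Rf φ) x).det|)
    (hmap : ∀ x ∈ S, Rf φ x ∈ Ω) {F H : V2 → ℝ} (hF : ∀ x, 0 ≤ F x) (hH : Continuous H) (hH0 : ∀ x, 0 ≤ H x)
    (hFH : ∀ x ∈ S, F x ≤ H (Rf φ x)) : ∫ x in S, F x ≤ 2 * ∫ x in Ω, H x := by
  have hd : ∀ x ∈ S, HasFDerivWithinAt (Rf φ) (fderiv ℝ (Rf φ) x) S x := fun x hx =>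
    ((Rf_smooth h (hg x (hSW hx))).differentiableAt (by simp)).hasFDerivAt.hasFDerivWithinAt
  have hsub : Rf φ '' S ⊆ Ω := by rintro _ ⟨x, hx, rfl⟩; exact hmap x hx
  have hi : IntegrableOn H (Rf φ '' S) := (h.intOn hH).mono_set hsub
  have hi2 := (integrableOn_image_iff_integrableOn_abs_det_fderiv_smul volume hS hd (hinj.mono hSW) H).1 hi
  have e := integral_image_eq_integral_abs_det_fderiv_smul volume hS hd (hinj.mono hSW) H
  have h1 : ∫ x in Rf φ '' S, H x ≤ ∫ x in Ω, H x :=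
    setIntegral_mono_set (h.intOn hH) (ae_of_all _ hH0) hsub.eventuallyLE
  have h2 : ∫ x in S, F x ≤ ∫ x in S, 2 * (|(fderiv ℝ (Rf φ) x).det| • H (Rf φ x)) := by
    refine integral_mono_of_nonneg (ae_of_all _ hF) (hi2.const_mul 2) ?_
    rw [EventuallyLE, ae_restrict_iff' hS]
    refine ae_of_all _ fun x hx => (hFH x hx).trans ?_
    have := hdet x (hSW hx)
    have h0 := hH0 (Rf φ x)
    simp only [smul_eq_mul]
    nlinarith
  rw [integral_const_mul, ← e] at h2
  linarith

/-- the sum of the `p`-th powers of all derivatives -/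
def Asum (p : ℝ) (Ω : Set V2) (u : Fin 2 → V2 → ℝ) : ℝ :=
  (∫ x in Ω, |pd 0 (u 0) x| ^ p) + (∫ x in Ω, |pd 0 (u 1) x| ^ p) + (∫ x in Ω, |pd 1 (u 0) x| ^ p)
    + ∫ x in Ω, |pd 1 (u 1) x| ^ p

/-- The function controlling the exterior part. -/
def Hf (p η k : ℝ) (u : Fin 2 → V2 → ℝ) (f : V2 → ℝ) (y : V2) : ℝ :=
  4 ^ p * (|f y| ^ p + (2 * η) ^ p * (4 ^ p * (|pd 0 (u 0) y| ^ p + |pd 0 (u 1) y| ^ p + |pd 1 (u 0) y| ^ p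
    + |pd 1 (u 1) y| ^ p)) + (2 * k) ^ p * (2 ^ p * (|u 0 y| ^ p + |u 1 y| ^ p)))

lemma Hf_bound {p η k : ℝ} (hp : 0 < p) (hη : 0 ≤ η) (hk : 0 ≤ k) (u : Fin 2 → V2 → ℝ) (f : V2 → ℝ) (y : V2) (s : ℝ)
    (hs : |s| ≤ |f y| + 2 * η * (|pd 0 (u 0) y| + |pd 0 (u 1) y| + |pd 1 (u 0) y| + |pd 1 (u 1) y|)
      + 2 * k * (|u 0 y| + |u 1 y|)) : |s| ^ p ≤ Hf p η k u f y := by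
  unfold Hf
  refine (rpow_le_rpow (abs_nonneg _) hs hp.le).trans ?_
  refine (add_rpow_le3 hp (by positivity) (by positivity) (by positivity)).trans ?_
  rw [mul_rpow (by positivity) (by positivity), mul_rpow (x := 2 * k) (by positivity) (by positivity)]
  gcongr
  · exact add_rpow_le4 hp.le (by positivity) (by positivity) (by positivity) (by positivity)
  · exact add_rpow_le2 hp.le (by positivity) (by positivity)

lemma cont_pd {f : V2 → ℝ} (hf : ContDiff ℝ 1 f) (i : Fin 2) : Continuous (pd i f) :=
  (contDiff_pd (m := 0) hf (by simp) i).continuous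

lemma Hf_cont {p η k : ℝ} (hp : 0 < p) {u : Fin 2 → V2 → ℝ} (hu : ∀ i, ContDiff ℝ 1 (u i)) {f : V2 → ℝ}
    (hf : Continuous f) : Continuous (Hf p η k u f) := by
  unfold Hf
  have c1 := fun i j => cont_abspow (cont_pd (hu i) j) hp.le
  have c2 := fun i => cont_abspow (hu i).continuous hp.le
  have c3 := cont_abspow hf hp.le
  exact continuous_const.mul ((c3.add (continuous_const.mul (continuous_const.mul
    ((((c1 0 0).add (c1 1 0)).add (c1 0 1)).add (c1 1 1))))).add (continuous_const.mul (continuous_const.mul ((c2 0).add (c2 1)))))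

lemma Hf_nonneg {p η k : ℝ} (hη : 0 ≤ η) (hk : 0 ≤ k) (u : Fin 2 → V2 → ℝ) (f : V2 → ℝ) (y : V2) :
    0 ≤ Hf p η k u f y := by
  unfold Hf; positivity

lemma Hf_int {Ω : Set V2} {φ : V2 → ℝ} (h : DomFn Ω φ) {p η k : ℝ} (hp : 0 < p) {u : Fin 2 → V2 → ℝ} (hu : ∀ i, ContDiff ℝ 1 (u i)) {f : V2 → ℝ}
    (hf : Continuous f) : ∫ x in Ω, Hf p η k u f x = 4 ^ p * ((∫ x in Ω, |f x| ^ p) + (2 * η) ^ p * (4 ^ p * Asum p Ω u)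
      + (2 * k) ^ p * (2 ^ p * ((∫ x in Ω, |u 0 x| ^ p) + ∫ x in Ω, |u 1 x| ^ p))) := by
  have c1 := fun i j => h.intOn (cont_abspow (cont_pd (hu i) j) hp.le)
  have c2 := fun i => h.intOn (cont_abspow (hu i).continuous hp.le)
  have c3 := h.intOn (cont_abspow hf hp.le)
  unfold Hf Asum
  have j2 := ion_add (c1 0 0) (c1 1 0)
  have j3 := ion_add j2 (c1 0 1)
  have i4 := ion_add j3 (c1 1 1)
  have i2 := ion_add (c2 0) (c2 1)
  have k4 := (i4.const_mul (4 ^ p)).const_mul ((2 * η) ^ p)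
  have k2 := (i2.const_mul (2 ^ p)).const_mul ((2 * k) ^ p)
  rw [integral_const_mul, integral_add (ion_add c3 k4) k2,
    integral_add c3 k4, integral_const_mul, integral_const_mul, integral_const_mul, integral_const_mul,
    integral_add j3 (c1 1 1), integral_add j2 (c1 0 1),
    integral_add (c1 0 0) (c1 1 0), integral_add (c2 0) (c2 1)]



lemma pd_congr {f g : V2 → ℝ} {x : V2} (h : f =ᶠ[𝓝 x] g) (i : Fin 2) : pd i f x = pd i g x := by
  unfold pd; rw [h.fderiv_eq]

lemma wf_fr {φ χ : V2 → ℝ} (u : Fin 2 → V2 → ℝ) {x : V2} (hg : grad φ x ≠ 0)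
    (h0 : φ x = 0) (hχ : χ x = 1) (hb : u 0 x * pd 0 φ x + u 1 x * pd 1 φ x = 0) (a : Fin 2) : u a x = wf φ χ u a x := by
  unfold wf
  rw [Rf_fr h0, hχ]
  have hs := (nsq_pos hg).ne'
  have e : Qm φ a 0 x * u 0 x + Qm φ a 1 x * u 1 x = u a x
      - 2 * (pd a φ x / nsq (grad φ x)) * (u 0 x * pd 0 φ x + u 1 x * pd 1 φ x) := by
    unfold Qm
    fin_cases a <;> simp <;> ring
  rw [one_mul, one_mul, e, hb]; ring

lemma divcurl_dom {Ω : Set V2} {φ : V2 → ℝ} (h : DomFn Ω φ) (p : ℝ) (hp : 2 < p) : ∃ C > (0:ℝ), ∀ u : Fin 2 → V2 → ℝ,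
    (∀ i, ContDiff ℝ 1 (u i)) → (∀ x ∈ frontier Ω, u 0 x * pd 0 φ x + u 1 x * pd 1 φ x = 0) →
    Asum p Ω u ≤ C * ((∫ x in Ω, |pd 0 (u 0) x + pd 1 (u 1) x| ^ p) + (∫ x in Ω, |pd 0 (u 1) x - pd 1 (u 0) x| ^ p)
      + ((∫ x in Ω, |u 0 x| ^ p) + ∫ x in Ω, |u 1 x| ^ p)) := by
  have hp0 : 0 < p := by linarith
  obtain ⟨Cp, hCp, HP⟩ := divcurl_plane p hp
  have h4 : (0:ℝ) < 4 ^ p := by positivity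
  obtain ⟨T, hT⟩ : ∃ T, T = 1 / (32 * Cp * 4 ^ p) := ⟨_, rfl⟩
  have hTpos : 0 < T := by rw [hT]; positivity
  obtain ⟨η, hη⟩ : ∃ η, η = T ^ (1 / p) / 8 := ⟨_, rfl⟩
  have hηpos : 0 < η := by rw [hη]; positivity
  have hηT : (2 * η) ^ p * 4 ^ p = T := by
    rw [← mul_rpow (by positivity) (by norm_num), hη]
    have : 2 * (T ^ (1 / p) / 8) * 4 = T ^ (1 / p) := by ring
    rw [this, ← rpow_mul hTpos.le, one_div_mul_cancel hp0.ne', rpow_one]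
  obtain ⟨W, hWo, hWf, hinj, hWg, hWE, hWdet, hWmap⟩ := exists_collar h η hηpos
  obtain ⟨χ, hχs, hχ01, hχ1, hχc, hχW⟩ := exists_cutoff h.compact_fr hWo hWf
  obtain ⟨k, hk0, hk⟩ : ∃ k : ℝ, 0 ≤ k ∧ ∀ a c b, ∀ x ∈ tsupport χ, |pd c (fun y => χ y * Qm φ a b y) x| ≤ k := by
    obtain ⟨k, hk⟩ := hχc.isCompact.exists_bound_of_continuousOn
      (f := fun x => (fun a c b => pd c (fun y => χ y * Qm φ a b y) x : Fin 2 → Fin 2 → Fin 2 → ℝ)) (by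
        refine continuousOn_pi.2 fun a => continuousOn_pi.2 fun c => continuousOn_pi.2 fun b => fun x hx => ?_
        have hs : ContDiffAt ℝ (⊤ : ℕ∞) (fun y => χ y * Qm φ a b y) x :=
          hχs.contDiffAt.mul (Qm_smooth h a b (hWg x (hχW hx)))
        exact ((hs.fderiv_right (m := 0) (by simp)).continuousAt.clm_apply continuousAt_const).continuousWithinAt)
    refine ⟨max k 0, le_max_right _ _, fun a c b x hx => ?_⟩
    refine le_trans ?_ ((hk x hx).trans (le_max_left _ _))
    have n1 := norm_le_pi_norm (fun a c b => pd c (fun y => χ y * Qm φ a b y) x : Fin 2 → Fin 2 → Fin 2 → ℝ) a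
    have n2 := norm_le_pi_norm (fun c b => pd c (fun y => χ y * Qm φ a b y) x : Fin 2 → Fin 2 → ℝ) c
    have n3 := norm_le_pi_norm (fun b => pd c (fun y => χ y * Qm φ a b y) x : Fin 2 → ℝ) b
    rw [Real.norm_eq_abs] at n3
    exact n3.trans (n2.trans n1)
  refine ⟨8 * Cp * (1 + 2 * 4 ^ p + 4 * 4 ^ p * ((2 * k) ^ p * 2 ^ p)), by positivity, ?_⟩
  intro u hu hb
  have hfr0 : ∀ x ∈ frontier Ω, φ x = 0 := fun x hx => by rw [h.fr] at hx; exact hx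
  have wC : ∀ a, ContDiff ℝ 1 (wf φ χ u a) := wf_contDiff h hχs hu (fun x hx => hWg x (hχW hx))
  have wz : ∀ a x, x ∉ tsupport χ → wf φ χ u a =ᶠ[𝓝 x] fun _ => 0 := fun a x hx => by
    filter_upwards [notMem_tsupport_iff_eventuallyEq.1 hx] with y hy
    simp [wf, hy]
  have wsupp : ∀ a, HasCompactSupport (wf φ χ u a) := fun a =>
    HasCompactSupport.intro hχc.isCompact (fun x hx => (wz a x hx).self_of_nhds)
  have wpz : ∀ a c x, x ∉ tsupport χ → pd c (wf φ χ u a) x = 0 := fun a c x hx => by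
    rw [pd_congr (wz a x hx)]; simp [pd]
  -- the extension
  let e : Fin 2 → V2 → ℝ := fun a x => Ω.indicator (u a) x + Ωᶜ.indicator (wf φ χ u a) x
  have e1 : ∀ a, ∀ x ∈ Ω, e a x = u a x := fun a x hx => by simp [e, hx]
  have e2 : ∀ a x, x ∉ Ω → e a x = wf φ χ u a x := fun a x hx => by simp [e, hx]
  have ecs : ∀ a, HasCompactSupport (e a) := fun a => by
    refine HasCompactSupport.intro (h.compact_cl.union hχc.isCompact) (fun x hx => ?_)
    rw [mem_union, not_or] at hx
    rw [e2 a x (fun hh => hx.1 (subset_closure hh))]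
    exact (wz a x hx.2).self_of_nhds
  have elip : ∀ a, ∃ K, LipschitzWith K (e a) := fun a => by
    obtain ⟨K1, h1⟩ := (hu a).contDiffOn.exists_lipschitzOnWith (s := closure Ω) (by simp) h.conv.closure h.compact_cl
    obtain ⟨K2, h2⟩ := ContDiff.lipschitzWith_of_hasCompactSupport (wsupp a) (wC a) (by simp)
    refine ⟨max K1 K2, glue_lip h.isOpen (h1.weaken (le_max_left _ _)) (h2.weaken (le_max_right _ _))
      (fun x hx => wf_fr u (h.gr x hx) (hfr0 x hx) (hχ1 x hx) (hb x hx) a) (e1 a) (e2 a)⟩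
  have p1 : ∀ a c, ∀ x ∈ Ω, pd c (e a) x = pd c (u a) x := fun a c x hx =>
    pd_congr (by filter_upwards [h.isOpen.mem_nhds hx] with y hy using e1 a y hy) c
  have p2 : ∀ a c, ∀ x ∈ (closure Ω)ᶜ, pd c (e a) x = pd c (wf φ χ u a) x := fun a c x hx =>
    pd_congr (by
      filter_upwards [isClosed_closure.isOpen_compl.mem_nhds hx] with y hy
        using e2 a y (fun hh => hy (subset_closure hh))) c
  have wpc : ∀ a c, CC (pd c (wf φ χ u a)) := fun a c =>
    ⟨cont_pd (wC a) c, HasCompactSupport.intro hχc.isCompact (wpz a c)⟩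
  have upc : ∀ a c, Continuous (pd c (u a)) := fun a c => cont_pd (hu a) c
  -- pieces
  obtain ⟨K0, L0⟩ := elip 0
  obtain ⟨K1, L1⟩ := elip 1
  have PL := HP (e 0) (e 1) K0 K1 L0 L1 (ecs 0) (ecs 1)
  have low : ∀ a c, ∫ x in Ω, |pd c (u a) x| ^ p ≤ ∫ x, |pd c (e a) x| ^ p := fun a c => by
    have := h.split (f := fun x => |pd c (e a) x| ^ p) (g1 := fun x => |pd c (u a) x| ^ p)
      (g2 := fun x => |pd c (wf φ χ u a) x| ^ p) (fun x hx => by rw [p1 a c x hx]) (fun x hx => by rw [p2 a c x hx])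
      (h.intOn (cont_abspow (upc a c) hp0.le)) ((wpc a c).abspow hp0).integrable
    rw [this.2]
    exact le_add_of_nonneg_right (integral_nonneg fun x => by positivity)
  -- pointwise
  let S : Set V2 := (closure Ω)ᶜ ∩ tsupport χ
  have hSm : MeasurableSet S := isClosed_closure.measurableSet.compl.inter (isClosed_tsupport χ).measurableSet
  have hSW : S ⊆ W := fun x hx => hχW hx.2
  have hSmap : ∀ x ∈ S, Rf φ x ∈ Ω := fun x hx => hWmap x (hSW hx) (by
    have := hx.1
    rw [h.closure] at this
    simpa using this)
  have pw : ∀ x ∈ S, |pd 0 (wf φ χ u 0) x + pd 1 (wf φ χ u 1) x| ^ p ≤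
        Hf p η k u (fun y => pd 0 (u 0) y + pd 1 (u 1) y) (Rf φ x) ∧
      |pd 0 (wf φ χ u 1) x - pd 1 (wf φ χ u 0) x| ^ p ≤
        Hf p η k u (fun y => pd 0 (u 1) y - pd 1 (u 0) y) (Rf φ x) := by
    intro x hx
    have hg := hWg x (hSW hx)
    obtain ⟨q1, q2, q3⟩ := Qm_rel hg
    have E := hWE x (hSW hx)
    have al := alg_div η k (Qm φ 0 0 x) (Qm φ 0 1 x) (χ x) q3 (hχ01 x)
      (fun a c b => pd c (fun y => χ y * Qm φ a b y) x) (fun a c b => hk a c b x hx.2)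
      (fun c d => fderiv ℝ (Rf φ) x (Pi.single c 1) d) (fun b => u b (Rf φ x)) (fun d b => pd d (u b) (Rf φ x))
      (E 0 0) (by have := E 0 1; rwa [q1] at this) (E 1 0) (by have := E 1 1; rwa [q2] at this)
    constructor
    · apply Hf_bound hp0 hηpos.le hk0
      rw [wf_deriv h hχs hu 0 0 hg, wf_deriv h hχs hu 1 1 hg, q1, q2]
      exact al.1
    · apply Hf_bound hp0 hηpos.le hk0
      rw [wf_deriv h hχs hu 1 0 hg, wf_deriv h hχs hu 0 1 hg, q1, q2]
      exact al.2
  have dcont : Continuous (fun y => pd 0 (u 0) y + pd 1 (u 1) y) := (upc 0 0).add (upc 1 1)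
  have ccont : Continuous (fun y => pd 0 (u 1) y - pd 1 (u 0) y) := (upc 1 0).sub (upc 0 1)
  have toS : ∀ F : V2 → ℝ, (∀ x, x ∉ tsupport χ → F x = 0) → ∫ x in (closure Ω)ᶜ, F x = ∫ x in S, F x := by
    intro F hF
    refine (setIntegral_eq_of_subset_of_forall_sdiff_eq_zero isClosed_closure.measurableSet.compl inter_subset_left ?_)
    intro x hx
    exact hF x (fun hh => hx.2 ⟨hx.1, hh⟩)
  have updiv : ∫ x, |pd 0 (e 0) x + pd 1 (e 1) x| ^ p ≤ (∫ x in Ω, |pd 0 (u 0) x + pd 1 (u 1) x| ^ p)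
      + 2 * ∫ x in Ω, Hf p η k u (fun y => pd 0 (u 0) y + pd 1 (u 1) y) x := by
    have := h.split (f := fun x => |pd 0 (e 0) x + pd 1 (e 1) x| ^ p) (g1 := fun x => |pd 0 (u 0) x + pd 1 (u 1) x| ^ p)
      (g2 := fun x => |pd 0 (wf φ χ u 0) x + pd 1 (wf φ χ u 1) x| ^ p)
      (fun x hx => by rw [p1 _ _ x hx, p1 _ _ x hx]) (fun x hx => by rw [p2 _ _ x hx, p2 _ _ x hx])
      (h.intOn (cont_abspow dcont hp0.le)) (((wpc 0 0).add (wpc 1 1)).abspow hp0).integrable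
    rw [this.2, toS _ (fun x hx => by rw [wpz _ _ x hx, wpz _ _ x hx]; simp [hp0.ne'])]
    gcongr
    exact ext_cov h hSm hSW hinj hWg hWdet hSmap (fun x => by positivity) (Hf_cont hp0 hu dcont)
      (Hf_nonneg hηpos.le hk0 u _) (fun x hx => (pw x hx).1)
  have upcurl : ∫ x, |pd 0 (e 1) x - pd 1 (e 0) x| ^ p ≤ (∫ x in Ω, |pd 0 (u 1) x - pd 1 (u 0) x| ^ p)
      + 2 * ∫ x in Ω, Hf p η k u (fun y => pd 0 (u 1) y - pd 1 (u 0) y) x := by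
    have := h.split (f := fun x => |pd 0 (e 1) x - pd 1 (e 0) x| ^ p) (g1 := fun x => |pd 0 (u 1) x - pd 1 (u 0) x| ^ p)
      (g2 := fun x => |pd 0 (wf φ χ u 1) x - pd 1 (wf φ χ u 0) x| ^ p)
      (fun x hx => by rw [p1 _ _ x hx, p1 _ _ x hx]) (fun x hx => by rw [p2 _ _ x hx, p2 _ _ x hx])
      (h.intOn (cont_abspow ccont hp0.le)) (((wpc 1 0).sub (wpc 0 1)).abspow hp0).integrable
    rw [this.2, toS _ (fun x hx => by rw [wpz _ _ x hx, wpz _ _ x hx]; simp [hp0.ne'])]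
    gcongr
    exact ext_cov h hSm hSW hinj hWg hWdet hSmap (fun x => by positivity) (Hf_cont hp0 hu ccont)
      (Hf_nonneg hηpos.le hk0 u _) (fun x hx => (pw x hx).2)
  rw [Hf_int h hp0 hu dcont] at updiv
  rw [Hf_int h hp0 hu ccont] at upcurl
  have a00 := (low 0 0).trans (PL 0).1
  have a10 := (low 1 0).trans (PL 0).2
  have a01 := (low 0 1).trans (PL 1).1
  have a11 := (low 1 1).trans (PL 1).2
  have hA : Asum p Ω u ≤ 4 * (Cp * ((∫ x, |pd 0 (e 0) x + pd 1 (e 1) x| ^ p) + ∫ x, |pd 0 (e 1) x - pd 1 (e 0) x| ^ p)) := by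
    unfold Asum; linarith
  have hU0 : 0 ≤ (∫ x in Ω, |u 0 x| ^ p) + ∫ x in Ω, |u 1 x| ^ p :=
    add_nonneg (integral_nonneg fun x => by positivity) (integral_nonneg fun x => by positivity)
  have hD0 : 0 ≤ (∫ x in Ω, |pd 0 (u 0) x + pd 1 (u 1) x| ^ p) := integral_nonneg fun x => by positivity
  have hR0 : 0 ≤ (∫ x in Ω, |pd 0 (u 1) x - pd 1 (u 0) x| ^ p) := integral_nonneg fun x => by positivity
  generalize (∫ x in Ω, |u 0 x| ^ p) + ∫ x in Ω, |u 1 x| ^ p = U at *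
  generalize (∫ x in Ω, |pd 0 (u 0) x + pd 1 (u 1) x| ^ p) = D at *
  generalize (∫ x in Ω, |pd 0 (u 1) x - pd 1 (u 0) x| ^ p) = R at *
  generalize Asum p Ω u = A at *
  have hκ : (0:ℝ) ≤ (2 * k) ^ p * 2 ^ p := by positivity
  have r1 : ∀ D : ℝ, 4 ^ p * (D + (2 * η) ^ p * (4 ^ p * A) + (2 * k) ^ p * (2 ^ p * U))
      = 4 ^ p * (D + T * A + (2 * k) ^ p * 2 ^ p * U) := fun D => by rw [← hηT]; ring
  rw [r1] at updiv upcurl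
  have hT2 : 32 * Cp * 4 ^ p * T = 1 := by rw [hT]; field_simp
  generalize (2 * k) ^ p * 2 ^ p = κ at *
  have fin : A ≤ 4 * (Cp * ((D + 2 * (4 ^ p * (D + T * A + κ * U))) + (R + 2 * (4 ^ p * (R + T * A + κ * U))))) :=
    hA.trans (by gcongr)
  have e3 : 4 * (Cp * ((D + 2 * (4 ^ p * (D + T * A + κ * U))) + (R + 2 * (4 ^ p * (R + T * A + κ * U)))))
    = (32 * Cp * 4 ^ p * T) * A / 2 + 4 * Cp * ((1 + 2 * 4 ^ p) * (D + R) + 4 * 4 ^ p * κ * U) := by ring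
  rw [e3, hT2] at fin
  have n1 : 0 ≤ Cp * (1 + 2 * 4 ^ p) * U := by positivity
  have n2 : 0 ≤ Cp * (4 * 4 ^ p * κ) * (D + R) := by positivity
  nlinarith



lemma int_pd_zero {f : V2 → ℝ} (hf : ContDiff ℝ 1 f) (hc : HasCompactSupport f) (i : Fin 2) : ∫ x, pd i f x = 0 := by
  have hpc : CC (pd i f) := ⟨cont_pd hf i, by
    have := hc.fderiv_apply (𝕜 := ℝ) (Pi.single i 1); exact this⟩
  have := integral_mul_fderiv_eq_neg_fderiv_mul_of_integrable (μ := (volume : Measure V2)) (f := fun _ => (1:ℝ)) (g := f)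
    (v := Pi.single i 1) (by simp) (by simp only [one_mul]; exact hpc.integrable)
    (by simpa using hf.continuous.integrable_of_hasCompactSupport hc) (fun x _ => by simp)
    (fun x _ => hf.differentiable (by simp) x)
  simp only [one_mul, fderiv_fun_const, Pi.zero_apply, ContinuousLinearMap.zero_apply, zero_mul, integral_zero, neg_zero] at this
  exact this

lemma pd_mul {f g : V2 → ℝ} {x : V2} (hf : DifferentiableAt ℝ f x) (hg : DifferentiableAt ℝ g x) (i : Fin 2) :
    pd i (fun y => f y * g y) x = f x * pd i g x + pd i f x * g x := by
  unfold pd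
  have : HasFDerivAt (fun y => f y * g y) _ x := hf.hasFDerivAt.mul hg.hasFDerivAt
  rw [this.fderiv]
  simp [mul_comm]

lemma pd_add {f g : V2 → ℝ} {x : V2} (hf : DifferentiableAt ℝ f x) (hg : DifferentiableAt ℝ g x) (i : Fin 2) :
    pd i (fun y => f y + g y) x = pd i f x + pd i g x := by
  unfold pd
  have : HasFDerivAt (fun y => f y + g y) _ x := hf.hasFDerivAt.add hg.hasFDerivAt
  rw [this.fderiv]; simp

lemma pd_sub {f g : V2 → ℝ} {x : V2} (hf : DifferentiableAt ℝ f x) (hg : DifferentiableAt ℝ g x) (i : Fin 2) :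
    pd i (fun y => f y - g y) x = pd i f x - pd i g x := by
  unfold pd
  have : HasFDerivAt (fun y => f y - g y) _ x := hf.hasFDerivAt.sub hg.hasFDerivAt
  rw [this.fderiv]; simp

lemma pd_const_mul {f : V2 → ℝ} {x : V2} (c : ℝ) (hf : DifferentiableAt ℝ f x) (i : Fin 2) :
    pd i (fun y => c * f y) x = c * pd i f x := by
  rw [pd_mul (differentiableAt_const c) hf]; simp [pd]

lemma pd_coord (i j : Fin 2) (c : ℝ) (x : V2) : pd i (fun y => y j - c) x = if j = i then 1 else 0 := by
  unfold pd
  have : HasFDerivAt (fun y : V2 => y j - c) (ContinuousLinearMap.proj j) x :=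
    (ContinuousLinearMap.hasFDerivAt (ContinuousLinearMap.proj (R := ℝ) (φ := fun _ : Fin 2 => ℝ) j)).sub_const c
  rw [this.fderiv]; simp [Pi.single_apply]

/-- the profile -/
def psi (s : ℝ) : ℝ := Real.smoothTransition (s - 1)

lemma psi_smooth : ContDiff ℝ (⊤ : ℕ∞) psi := Real.smoothTransition.contDiff.comp (contDiff_id.sub contDiff_const)

lemma psi_deriv_zero {s : ℝ} (hs : deriv psi s ≠ 0) : 1 ≤ s ∧ s ≤ 2 := by
  constructor
  · by_contra hc
    push Not at hc
    apply hs
    have : psi =ᶠ[𝓝 s] fun _ => 0 := by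
      filter_upwards [Iio_mem_nhds hc] with y hy
      exact Real.smoothTransition.zero_of_nonpos (by rw [mem_Iio] at hy; linarith)
    rw [this.deriv_eq]; simp
  · by_contra hc
    push Not at hc
    apply hs
    have : psi =ᶠ[𝓝 s] fun _ => 1 := by
      filter_upwards [Ioi_mem_nhds hc] with y hy
      exact Real.smoothTransition.one_of_one_le (by rw [mem_Ioi] at hy; linarith)
    rw [this.deriv_eq]; simp

lemma psi_deriv_nonneg (s : ℝ) : 0 ≤ deriv psi s :=
  Monotone.deriv_nonneg (fun a b hab => Real.smoothTransition.monotone (by linarith))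

/-- cutoff -/
def cut (φ : V2 → ℝ) (n : ℕ) (x : V2) : ℝ := psi (-(((n:ℝ) + 1) * φ x))
/-- minus its normal derivative -/
def kap (φ : V2 → ℝ) (n : ℕ) (x : V2) : ℝ := ((n:ℝ) + 1) * deriv psi (-(((n:ℝ) + 1) * φ x))

section
variable {Ω : Set V2} {φ : V2 → ℝ}

lemma cut_smooth (h : DomFn Ω φ) (n : ℕ) : ContDiff ℝ (⊤ : ℕ∞) (cut φ n) :=
  psi_smooth.comp (contDiff_const.mul h.smooth).neg

lemma cut_01 (n : ℕ) (x : V2) : 0 ≤ cut φ n x ∧ cut φ n x ≤ 1 :=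
  ⟨Real.smoothTransition.nonneg _, Real.smoothTransition.le_one _⟩

lemma cut_supp (h : DomFn Ω φ) (n : ℕ) : HasCompactSupport (cut φ n) ∧ ∀ x, x ∉ Ω → cut φ n x = 0 := by
  have hz : ∀ x, x ∉ Ω → cut φ n x = 0 := fun x hx => by
    rw [h.eq] at hx
    simp only [mem_ofPred_eq, not_lt] at hx
    apply Real.smoothTransition.zero_of_nonpos
    have : 0 ≤ ((n:ℝ) + 1) * φ x := by positivity
    linarith
  exact ⟨HasCompactSupport.intro h.compact_cl (fun x hx => hz x (fun hh => hx (subset_closure hh))), hz⟩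

lemma cut_pd (h : DomFn Ω φ) (n : ℕ) (i : Fin 2) (x : V2) : pd i (cut φ n) x = - (kap φ n x * pd i φ x) := by
  have h1 : HasFDerivAt φ (fderiv ℝ φ x) x := (h.smooth.differentiable (by simp) x).hasFDerivAt
  have h2 : HasDerivAt psi (deriv psi (-(((n:ℝ) + 1) * φ x))) (-(((n:ℝ) + 1) * φ x)) :=
    (psi_smooth.differentiable (by simp) _).hasDerivAt
  have h3 : HasFDerivAt (cut φ n) _ x := h2.comp_hasFDerivAt x (h1.const_mul ((n:ℝ) + 1)).neg
  have e : pd i (cut φ n) x = fderiv ℝ (cut φ n) x (Pi.single i 1) := rfl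
  rw [e, h3.fderiv]
  simp [kap, pd]; ring

lemma kap_cont (h : DomFn Ω φ) (n : ℕ) : Continuous (kap φ n) :=
  continuous_const.mul ((psi_smooth.continuous_deriv (by simp)).comp (continuous_const.mul h.smooth.continuous).neg)

lemma kap_nonneg (n : ℕ) (x : V2) : 0 ≤ kap φ n x := mul_nonneg (by positivity) (psi_deriv_nonneg _)

lemma kap_strip {n : ℕ} {x : V2} (hx : kap φ n x ≠ 0) : -(2 / ((n:ℝ) + 1)) ≤ φ x ∧ φ x ≤ 0 := by
  have hn : (0:ℝ) < (n:ℝ) + 1 := by positivity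
  have := psi_deriv_zero (right_ne_zero_of_mul hx)
  constructor
  · rw [neg_le, div_eq_inv_mul, ← div_eq_inv_mul, le_div_iff₀ hn]; linarith
  · by_contra hc
    push Not at hc
    nlinarith

lemma kap_CC (h : DomFn Ω φ) (n : ℕ) : CC (kap φ n) :=
  ⟨kap_cont h n, HasCompactSupport.intro h.compact_cl (fun x hx => by
    by_contra hc
    apply hx
    rw [h.closure]; exact (kap_strip hc).2)⟩

lemma strip_ev (h : DomFn Ω φ) {g : V2 → ℝ} (hg : Continuous g) (hpos : ∀ x ∈ frontier Ω, 0 < g x) :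
    ∀ᶠ n : ℕ in atTop, ∀ x, kap φ n x ≠ 0 → 0 < g x := by
  have hK : IsCompact (closure Ω ∩ {x | g x ≤ 0}) := h.compact_cl.inter_right (isClosed_le hg continuous_const)
  have hneg : ∀ x ∈ closure Ω ∩ {x | g x ≤ 0}, φ x < 0 := by
    rintro x ⟨hx, hx2⟩
    rw [h.closure] at hx
    refine lt_of_le_of_ne hx fun h0 => ?_
    have : x ∈ frontier Ω := by rw [h.fr]; exact h0
    exact absurd (hpos x this) (not_lt.2 hx2)
  obtain ⟨m, hm, hmb⟩ : ∃ m > (0:ℝ), ∀ x ∈ closure Ω ∩ {x | g x ≤ 0}, φ x ≤ -m := by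
    rcases (closure Ω ∩ {x | g x ≤ 0}).eq_empty_or_nonempty with he | hne
    · exact ⟨1, one_pos, fun x hx => by rw [he] at hx; exact hx.elim⟩
    · obtain ⟨x0, hx0, hmax⟩ := hK.exists_isMaxOn hne h.smooth.continuous.continuousOn
      exact ⟨-φ x0, neg_pos.2 (hneg x0 hx0), fun x hx => by rw [neg_neg]; exact hmax hx⟩
  have lim : Tendsto (fun n : ℕ => 2 / ((n:ℝ) + 1)) atTop (𝓝 0) := by
    have := (tendsto_one_div_add_atTop_nhds_zero_nat (𝕜 := ℝ)).const_mul 2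
    simpa [div_eq_mul_inv] using this
  filter_upwards [lim.eventually_lt_const hm] with n hn x hx
  by_contra hc
  push Not at hc
  have hs := kap_strip hx
  have := hmb x ⟨by rw [h.closure]; exact hs.2, hc⟩
  linarith

lemma cut_lim (h : DomFn Ω φ) {f : V2 → ℝ} (hf : Continuous f) :
    Tendsto (fun n => ∫ x, cut φ n x * f x) atTop (𝓝 (∫ x in Ω, f x)) := by
  have e : ∀ n, ∫ x, cut φ n x * f x = ∫ x in Ω, cut φ n x * f x := fun n => by
    rw [setIntegral_eq_integral_of_forall_compl_eq_zero]
    intro x hx; rw [(cut_supp h n).2 x hx, zero_mul]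
  simp_rw [e]
  refine tendsto_integral_of_dominated_convergence (fun x => |f x|) ?_ (h.intOn hf.abs) ?_ ?_
  · intro n; exact ((cut_smooth h n).continuous.mul hf).aestronglyMeasurable
  · intro n; refine ae_of_all _ fun x => ?_
    rw [Real.norm_eq_abs, abs_mul, abs_of_nonneg (cut_01 n x).1]
    exact mul_le_of_le_one_left (abs_nonneg _) (cut_01 n x).2
  · rw [ae_restrict_iff' h.isOpen.measurableSet]
    refine ae_of_all _ fun x hx => ?_
    rw [h.eq] at hx
    have hx : φ x < 0 := hx
    refine tendsto_const_nhds.congr' ?_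
    have t : Tendsto (fun n : ℕ => ((n:ℝ) + 1) * (-φ x)) atTop atTop :=
      (tendsto_natCast_atTop_atTop.atTop_add tendsto_const_nhds).atTop_mul_const (by linarith)
    filter_upwards [t.eventually_ge_atTop 2] with n hn
    have : cut φ n x = 1 := Real.smoothTransition.one_of_one_le (by linarith)
    rw [this, one_mul]

/-- divergence identity with cutoff -/
lemma cut_div (h : DomFn Ω φ) (n : ℕ) {V0 V1 : V2 → ℝ} (h0 : ContDiff ℝ 1 V0) (h1 : ContDiff ℝ 1 V1) :
    ∫ x, cut φ n x * (pd 0 V0 x + pd 1 V1 x) = ∫ x, kap φ n x * (V0 x * pd 0 φ x + V1 x * pd 1 φ x) := by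
  have hc := cut_smooth h n
  have c1 : ContDiff ℝ 1 (cut φ n) := hc.of_le (by simp)
  have z0 := int_pd_zero (c1.mul h0) ((cut_supp h n).1.mul_right) 0
  have z1 := int_pd_zero (c1.mul h1) ((cut_supp h n).1.mul_right) 1
  have ccut : ∀ f : V2 → ℝ, Continuous f → Integrable (fun x => cut φ n x * f x) := fun f hf =>
    (hc.continuous.mul hf).integrable_of_hasCompactSupport ((cut_supp h n).1.mul_right)
  have ckap : ∀ f : V2 → ℝ, Continuous f → Integrable (fun x => kap φ n x * f x) := fun f hf =>
    ((kap_cont h n).mul hf).integrable_of_hasCompactSupport ((kap_CC h n).2.mul_right)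
  have d0 := fun x => pd_mul (x := x) (c1.differentiable (by simp) x) (h0.differentiable (by simp) x) 0
  have d1 := fun x => pd_mul (x := x) (c1.differentiable (by simp) x) (h1.differentiable (by simp) x) 1
  have s0 := fun i => (smooth_pd h.smooth i).continuous
  have E0 : ∫ x, cut φ n x * pd 0 V0 x = ∫ x, kap φ n x * (V0 x * pd 0 φ x) := by
    rw [← sub_eq_zero, ← integral_sub (ccut _ (cont_pd h0 0)) (ckap (fun x => V0 x * pd 0 φ x) (h0.continuous.mul (s0 0))), ← z0]
    congr 1; ext x
    rw [d0, cut_pd h]; ring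
  have E1 : ∫ x, cut φ n x * pd 1 V1 x = ∫ x, kap φ n x * (V1 x * pd 1 φ x) := by
    rw [← sub_eq_zero, ← integral_sub (ccut _ (cont_pd h1 1)) (ckap (fun x => V1 x * pd 1 φ x) (h1.continuous.mul (s0 1))), ← z1]
    congr 1; ext x
    rw [d1, cut_pd h]; ring
  simp_rw [mul_add]
  rw [integral_add (ccut _ (cont_pd h0 0)) (ccut _ (cont_pd h1 1)),
    integral_add (ckap (fun x => V0 x * pd 0 φ x) (h0.continuous.mul (s0 0))) (ckap (fun x => V1 x * pd 1 φ x) (h1.continuous.mul (s0 1))), E0, E1]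

lemma star_fr (h : DomFn Ω φ) {x0 : V2} (hx0 : x0 ∈ Ω) {x : V2} (hx : x ∈ frontier Ω) :
    0 < (x 0 - x0 0) * pd 0 φ x + (x 1 - x0 1) * pd 1 φ x := by
  have hφx : φ x = 0 := by rw [h.fr] at hx; exact hx
  have hxc : x ∈ closure Ω := frontier_subset_closure hx
  have base : ∀ y ∈ Ω, fderiv ℝ φ x (y - x) ≤ 0 := by
    intro y hy
    have hd : HasFDerivAt φ (fderiv ℝ φ x) x := (h.smooth.differentiable (by simp) x).hasFDerivAt
    have hdd : HasDerivWithinAt (fun t : ℝ => φ (x + t • (y - x))) (fderiv ℝ φ x (y - x)) (Ici 0) 0 := by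
      have hl : HasDerivAt (fun t : ℝ => x + t • (y - x)) (y - x) 0 := by
        have := ((hasDerivAt_id (0:ℝ)).smul_const (y - x)).const_add x
        simpa using this
      have hd' : HasFDerivAt φ (fderiv ℝ φ x) (x + (0:ℝ) • (y - x)) := by simpa using hd
      exact (hd'.comp_hasDerivAt (0:ℝ) hl).hasDerivWithinAt
    by_contra hc
    push Not at hc
    have hsl := hasDerivWithinAt_iff_tendsto_slope.1 hdd
    rw [show (Ici (0:ℝ)) \ {0} = Ioi 0 from by ext z; simp [lt_iff_le_and_ne, eq_comm]] at hsl
    have ev := hsl.eventually (lt_mem_nhds hc)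
    have ev2 : ∀ᶠ t : ℝ in 𝓝[>] 0, t < 1 := nhdsWithin_le_nhds (Iio_mem_nhds one_pos)
    obtain ⟨t, ht, ht1, ht0⟩ := (ev.and (ev2.and self_mem_nhdsWithin)).exists
    have ht0 : 0 < t := ht0
    have hmem : x + t • (y - x) ∈ closure Ω := by
      have := h.conv.closure hxc (subset_closure hy) (show 0 ≤ 1 - t by linarith) ht0.le (by ring)
      convert this using 1
      module
    rw [h.closure] at hmem
    have hmem : φ (x + t • (y - x)) ≤ 0 := hmem
    rw [slope_def_field] at ht
    simp only [zero_smul, add_zero, hφx, sub_zero] at ht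
    have : φ (x + t • (y - x)) / t ≤ 0 := div_nonpos_of_nonpos_of_nonneg hmem ht0.le
    linarith
  have hlim : Tendsto (fun t : ℝ => x0 + t • grad φ x) (𝓝[>] 0) (𝓝 x0) := by
    have : Continuous (fun t : ℝ => x0 + t • grad φ x) := by fun_prop
    have := this.tendsto 0
    simp only [zero_smul, add_zero] at this
    exact this.mono_left nhdsWithin_le_nhds
  obtain ⟨t, ht, ht0⟩ := ((hlim.eventually (h.isOpen.mem_nhds hx0)).and self_mem_nhdsWithin).exists
  have ht0 : 0 < t := ht0
  have := base _ ht
  rw [fderiv_eq_sum] at this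
  have hs := nsq_pos (h.gr x hx)
  have e : nsq (grad φ x) = pd 0 φ x ^ 2 + pd 1 φ x ^ 2 := by simp [nsq, grad]
  rw [e] at hs
  simp only [Pi.sub_apply, Pi.add_apply, Pi.smul_apply, smul_eq_mul, grad] at this
  nlinarith [mul_pos ht0 hs]

end



section
variable {Ω : Set V2} {φ : V2 → ℝ}

lemma DomFn.coord_bdd (h : DomFn Ω φ) : ∃ R > (0:ℝ), ∀ x ∈ Ω, ∀ i, |x i| ≤ R := by
  obtain ⟨R, hR⟩ := h.bdd.exists_norm_le
  refine ⟨max R 1, by positivity, fun x hx i => ?_⟩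
  exact ((norm_le_pi_norm x i).trans (hR x hx)).trans (le_max_left _ _)

lemma star_unif (h : DomFn Ω φ) {x0 : V2} (hx0 : x0 ∈ Ω) : ∃ c > (0:ℝ), ∀ᶠ n : ℕ in atTop, ∀ x, kap φ n x ≠ 0 →
    c < (x 0 - x0 0) * pd 0 φ x + (x 1 - x0 1) * pd 1 φ x := by
  have s0 := fun i => (smooth_pd h.smooth i).continuous
  have hcont : Continuous (fun x : V2 => (x 0 - x0 0) * pd 0 φ x + (x 1 - x0 1) * pd 1 φ x) := by
    have := s0 0
    have := s0 1
    fun_prop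
  obtain ⟨c, hc, hcb⟩ : ∃ c > (0:ℝ), ∀ x ∈ frontier Ω, c < (x 0 - x0 0) * pd 0 φ x + (x 1 - x0 1) * pd 1 φ x := by
    rcases (frontier Ω).eq_empty_or_nonempty with he | hne
    · exact ⟨1, one_pos, fun x hx => by rw [he] at hx; exact hx.elim⟩
    · obtain ⟨z, hz, hmin⟩ := h.compact_fr.exists_isMinOn hne hcont.continuousOn
      have hp := star_fr h hx0 hz
      refine ⟨_, half_pos hp, fun x hx => lt_of_lt_of_le (half_lt_self hp) (hmin hx)⟩
  refine ⟨c, hc, ?_⟩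
  have := strip_ev h (g := fun x : V2 => (x 0 - x0 0) * pd 0 φ x + (x 1 - x0 1) * pd 1 φ x - c) (hcont.sub continuous_const)
    (fun x hx => sub_pos.2 (hcb x hx))
  filter_upwards [this] with n hn x hx
  exact sub_pos.1 (hn x hx)

lemma cut_int (h : DomFn Ω φ) (n : ℕ) {f : V2 → ℝ} (hf : Continuous f) : Integrable (fun x => cut φ n x * f x) :=
  ((cut_smooth h n).continuous.mul hf).integrable_of_hasCompactSupport ((cut_supp h n).1.mul_right)

lemma kap_int (h : DomFn Ω φ) (n : ℕ) {f : V2 → ℝ} (hf : Continuous f) : Integrable (fun x => kap φ n x * f x) :=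
  ((kap_cont h n).mul hf).integrable_of_hasCompactSupport ((kap_CC h n).2.mul_right)

/-- trace bound -/
lemma kap_bound (h : DomFn Ω φ) : ∃ K > (0:ℝ), ∀ g : V2 → ℝ, ContDiff ℝ 1 g → (∀ x, 0 ≤ g x) →
    ∀ᶠ n : ℕ in atTop, ∫ x, kap φ n x * g x ≤ K * ∫ x, cut φ n x * (|pd 0 g x| + |pd 1 g x| + g x) := by
  obtain ⟨x0, hx0⟩ := h.ne
  obtain ⟨c, hc, hev⟩ := star_unif h hx0
  obtain ⟨R, hR, hRb⟩ := h.coord_bdd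
  have s0 := fun i => (smooth_pd h.smooth i).continuous
  refine ⟨c⁻¹ * (2 * R + 2), by positivity, fun g hg hg0 => ?_⟩
  filter_upwards [hev] with n hn
  have hgc := hg.continuous
  have hV : ∀ j : Fin 2, ContDiff ℝ 1 (fun x : V2 => g x * (x j - x0 j)) := fun j => by fun_prop
  have hdiv := cut_div h n (hV 0) (hV 1)
  have hdv : ∀ x, pd 0 (fun x : V2 => g x * (x 0 - x0 0)) x + pd 1 (fun x : V2 => g x * (x 1 - x0 1)) x
      = 2 * g x + (pd 0 g x * (x 0 - x0 0) + pd 1 g x * (x 1 - x0 1)) := fun x => by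
    rw [pd_mul (hg.differentiable (by simp) x) (by fun_prop), pd_mul (hg.differentiable (by simp) x) (by fun_prop),
      pd_coord, pd_coord]
    simp; ring
  have hVc := fun j => (hV j).continuous
  have c0 := s0 0
  have c1 := s0 1
  have g0 := cont_pd hg 0
  have g1 := cont_pd hg 1
  have v0 := hVc 0
  have v1 := hVc 1
  have e1 : ∫ x, kap φ n x * g x ≤ c⁻¹ * ∫ x, kap φ n x * (g x * (x 0 - x0 0) * pd 0 φ x + g x * (x 1 - x0 1) * pd 1 φ x) := by
    rw [← integral_const_mul]
    apply integral_mono (kap_int h n hgc) ((kap_int h n (by fun_prop)).const_mul _)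
    intro x
    show kap φ n x * g x ≤ c⁻¹ * (kap φ n x * (g x * (x 0 - x0 0) * pd 0 φ x + g x * (x 1 - x0 1) * pd 1 φ x))
    by_cases hk : kap φ n x = 0
    · simp [hk]
    · have := hn x hk
      rw [inv_mul_eq_div, le_div_iff₀ hc]
      have hk0 := mul_nonneg (kap_nonneg (φ := φ) n x) (hg0 x)
      nlinarith
  have e2 : ∫ x, cut φ n x * (pd 0 (fun x : V2 => g x * (x 0 - x0 0)) x + pd 1 (fun x : V2 => g x * (x 1 - x0 1)) x)
      ≤ (2 * R + 2) * ∫ x, cut φ n x * (|pd 0 g x| + |pd 1 g x| + g x) := by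
    rw [← integral_const_mul]
    apply integral_mono
    · exact cut_int h n ((cont_pd (hV 0) 0).add (cont_pd (hV 1) 1))
    · exact (cut_int h n (by fun_prop)).const_mul _
    intro x
    show cut φ n x * _ ≤ (2 * R + 2) * (cut φ n x * (|pd 0 g x| + |pd 1 g x| + g x))
    rw [hdv]
    by_cases hx : x ∈ Ω
    · have b : ∀ j, |x j - x0 j| ≤ 2 * R := fun j => by
        have := abs_sub (x j) (x0 j)
        have := hRb x hx j
        have := hRb x0 hx0 j
        linarith
      have t : ∀ i : Fin 2, pd i g x * (x i - x0 i) ≤ |pd i g x| * (2 * R) := fun i =>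
        (le_abs_self _).trans (by rw [abs_mul]; exact mul_le_mul_of_nonneg_left (b i) (abs_nonneg _))
      have t0 := t 0
      have t1 := t 1
      have := (cut_01 (φ := φ) n x).1
      have hgx := hg0 x
      have key : 2 * g x + (pd 0 g x * (x 0 - x0 0) + pd 1 g x * (x 1 - x0 1)) ≤ (2 * R + 2) * (|pd 0 g x| + |pd 1 g x| + g x) := by
        nlinarith [abs_nonneg (pd 0 g x), abs_nonneg (pd 1 g x), mul_nonneg hR.le hgx]
      calc _ ≤ _ := mul_le_mul_of_nonneg_left key this
        _ = _ := by ring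
    · rw [(cut_supp h n).2 x hx]; simp
  rw [hdiv] at e2
  calc _ ≤ _ := e1
    _ ≤ c⁻¹ * ((2 * R + 2) * ∫ x, cut φ n x * (|pd 0 g x| + |pd 1 g x| + g x)) := by gcongr
    _ = _ := by ring

/-- divergence theorem for tangential fields -/
lemma div_zero_tan (h : DomFn Ω φ) {V0 V1 : V2 → ℝ} (h0 : ContDiff ℝ 1 V0) (h1 : ContDiff ℝ 1 V1)
    (hb : ∀ x ∈ frontier Ω, V0 x * pd 0 φ x + V1 x * pd 1 φ x = 0) : ∫ x in Ω, (pd 0 V0 x + pd 1 V1 x) = 0 := by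
  obtain ⟨K, hK, hKb⟩ := kap_bound h
  have hk1 := hKb (fun _ => 1) contDiff_const (fun _ => zero_le_one)
  have cd : Continuous (fun x => pd 0 V0 x + pd 1 V1 x) := (cont_pd h0 0).add (cont_pd h1 1)
  have s0 := (smooth_pd h.smooth 0).continuous
  have s1 := (smooth_pd h.smooth 1).continuous
  have k0 := h0.continuous
  have k1 := h1.continuous
  have cV : Continuous (fun x => V0 x * pd 0 φ x + V1 x * pd 1 φ x) := by fun_prop
  have l1 := (cut_lim h cd).abs
  have hcc : Continuous (fun x : V2 => |pd 0 (fun _ : V2 => (1:ℝ)) x| + |pd 1 (fun _ : V2 => (1:ℝ)) x| + 1) := by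
    simp only [pd, fderiv_fun_const]; simp; fun_prop
  have l2 := cut_lim h hcc
  set M := ∫ x in Ω, (|pd 0 (fun _ : V2 => (1:ℝ)) x| + |pd 1 (fun _ : V2 => (1:ℝ)) x| + 1) with hM
  have main : ∀ τ > 0, |∫ x in Ω, (pd 0 V0 x + pd 1 V1 x)| ≤ τ * (K * M) := by
    intro τ hτ
    refine le_of_tendsto_of_tendsto l1 ((l2.const_mul K).const_mul τ) ?_
    have hs := strip_ev h (g := fun x => τ - |V0 x * pd 0 φ x + V1 x * pd 1 φ x|) (continuous_const.sub cV.abs)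
      (fun x hx => by rw [hb x hx]; simpa using hτ)
    filter_upwards [hs, hk1] with n hn hn1
    rw [cut_div h n h0 h1]
    calc |∫ x, kap φ n x * (V0 x * pd 0 φ x + V1 x * pd 1 φ x)|
        ≤ ∫ x, |kap φ n x * (V0 x * pd 0 φ x + V1 x * pd 1 φ x)| := abs_integral_le_integral_abs
      _ ≤ ∫ x, τ * (kap φ n x * 1) := by
        apply integral_mono (kap_int h n cV).abs ((kap_int h n continuous_const).const_mul _)
        intro x
        show |kap φ n x * _| ≤ τ * (kap φ n x * 1)
        rw [abs_mul, abs_of_nonneg (kap_nonneg n x)]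
        by_cases hk : kap φ n x = 0
        · simp [hk]
        · have := hn x hk
          have := kap_nonneg (φ := φ) n x
          nlinarith
      _ = τ * ∫ x, kap φ n x * 1 := integral_const_mul _ _
      _ ≤ _ := by gcongr
  have : |∫ x in Ω, (pd 0 V0 x + pd 1 V1 x)| ≤ 0 := by
    have t : Tendsto (fun τ : ℝ => τ * (K * M)) (𝓝[>] 0) (𝓝 0) := by
      have : Continuous (fun τ : ℝ => τ * (K * M)) := by fun_prop
      have := this.tendsto 0
      rw [zero_mul] at this
      exact this.mono_left nhdsWithin_le_nhds
    exact ge_of_tendsto t (by filter_upwards [self_mem_nhdsWithin] with τ hτ using main τ hτ)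
  exact abs_nonpos_iff.1 this

/-- Poincare inequality for tangential fields -/
lemma poincare_tan (h : DomFn Ω φ) : ∃ C > (0:ℝ), ∀ u : Fin 2 → V2 → ℝ, (∀ i, ContDiff ℝ 1 (u i)) →
    (∀ x ∈ frontier Ω, u 0 x * pd 0 φ x + u 1 x * pd 1 φ x = 0) →
    ∫ x in Ω, (u 0 x ^ 2 + u 1 x ^ 2) ≤
      C * ∫ x in Ω, (pd 0 (u 0) x ^ 2 + pd 0 (u 1) x ^ 2 + pd 1 (u 0) x ^ 2 + pd 1 (u 1) x ^ 2) := by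
  obtain ⟨R, hR, hRb⟩ := h.coord_bdd
  refine ⟨24 * R ^ 2, by positivity, fun u hu hb => ?_⟩
  have hu0 := hu 0
  have hu1 := hu 1
  have hS : ContDiff ℝ 1 (fun x : V2 => (x 0 - 0) * u 0 x + (x 1 - 0) * u 1 x) := by fun_prop
  have z := div_zero_tan h (hS.mul hu0) (hS.mul hu1) (fun x hx => by
    have := hb x hx
    linear_combination ((x 0 - 0) * u 0 x + (x 1 - 0) * u 1 x) * this)
  have d0 := fun x => hu0.differentiable (by simp) x
  have d1 := fun x => hu1.differentiable (by simp) x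
  have dS := fun x => hS.differentiable (by simp) x
  have ex : ∀ j : Fin 2, ∀ x, DifferentiableAt ℝ (fun x : V2 => x j - 0) x := fun j x => by fun_prop
  have eS : ∀ i x, pd i (fun x : V2 => (x 0 - 0) * u 0 x + (x 1 - 0) * u 1 x) x =
      (x 0 * pd i (u 0) x + (if (0:Fin 2) = i then 1 else 0) * u 0 x) +
      (x 1 * pd i (u 1) x + (if (1:Fin 2) = i then 1 else 0) * u 1 x) := fun i x => by
    rw [pd_add (f := fun x : V2 => (x 0 - 0) * u 0 x) (g := fun x : V2 => (x 1 - 0) * u 1 x) ((ex 0 x).mul (d0 x)) ((ex 1 x).mul (d1 x)), pd_mul (ex 0 x) (d0 x), pd_mul (ex 1 x) (d1 x),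
      pd_coord, pd_coord, sub_zero, sub_zero]
  have a0 := cont_pd hu0 0
  have a1 := cont_pd hu0 1
  have b0 := cont_pd hu1 0
  have b1 := cont_pd hu1 1
  have k0 := hu0.continuous
  have k1 := hu1.continuous
  have I1 : IntegrableOn (fun x => u 0 x ^ 2 + u 1 x ^ 2) Ω := h.intOn (by fun_prop)
  have I2 : IntegrableOn (fun x => pd 0 (u 0) x ^ 2 + pd 0 (u 1) x ^ 2 + pd 1 (u 0) x ^ 2 + pd 1 (u 1) x ^ 2) Ω :=
    h.intOn (by fun_prop)
  have I3 : IntegrableOn (fun x => pd 0 (fun x => ((x 0 - 0) * u 0 x + (x 1 - 0) * u 1 x) * u 0 x) x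
      + pd 1 (fun x => ((x 0 - 0) * u 0 x + (x 1 - 0) * u 1 x) * u 1 x) x) Ω :=
    h.intOn ((cont_pd (hS.mul hu0) 0).add (cont_pd (hS.mul hu1) 1))
  have key : ∫ x in Ω, (u 0 x ^ 2 + u 1 x ^ 2) ≤ ∫ x in Ω, ((24 * R ^ 2) * (pd 0 (u 0) x ^ 2 + pd 0 (u 1) x ^ 2 + pd 1 (u 0) x ^ 2 + pd 1 (u 1) x ^ 2)
      + 2 * (pd 0 (fun x => ((x 0 - 0) * u 0 x + (x 1 - 0) * u 1 x) * u 0 x) x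
      + pd 1 (fun x => ((x 0 - 0) * u 0 x + (x 1 - 0) * u 1 x) * u 1 x) x)) := by
    apply setIntegral_mono_on I1 (ion_add (I2.const_mul _) (I3.const_mul _)) h.isOpen.measurableSet
    intro x hx
    rw [pd_mul (dS x) (d0 x), pd_mul (dS x) (d1 x), eS, eS]
    have q : ∀ i : Fin 2, ∀ d w : ℝ, 0 ≤ 4 * R ^ 2 * d ^ 2 + x i * d * w + w ^ 2 / 16 := fun i d w => by
      have : x i ^ 2 ≤ R ^ 2 := sq_le_sq' (abs_le.1 (hRb x hx i)).1 (abs_le.1 (hRb x hx i)).2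
      nlinarith [sq_nonneg (2 * x i * d + w / 4), mul_le_mul_of_nonneg_right this (sq_nonneg d)]
    generalize pd 0 (u 0) x = A
    generalize pd 0 (u 1) x = B
    generalize pd 1 (u 0) x = C
    generalize pd 1 (u 1) x = D
    have q1 := q 0 A (u 0 x)
    have q2 := q 1 B (u 0 x)
    have q3 := q 0 C (u 1 x)
    have q4 := q 1 D (u 1 x)
    have q5 := q 0 D (u 0 x)
    have q6 := q 1 A (u 1 x)
    simp
    nlinarith [mul_nonneg (sq_nonneg R) (sq_nonneg B), mul_nonneg (sq_nonneg R) (sq_nonneg C), mul_nonneg (sq_nonneg R) (sq_nonneg A), mul_nonneg (sq_nonneg R) (sq_nonneg D), sq_nonneg (u 0 x), sq_nonneg (u 1 x)]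
  rw [integral_add (I2.const_mul _) (I3.const_mul _), integral_const_mul, integral_const_mul, z] at key
  simpa using key

lemma pd_symm {f : V2 → ℝ} (hf : ContDiff ℝ 2 f) (x : V2) : pd 0 (pd 1 f) x = pd 1 (pd 0 f) x := by
  have hs := (hf.contDiffAt (x := x)).isSymmSndFDerivAt (by simp)
  have hd : DifferentiableAt ℝ (fderiv ℝ f) x := (hf.fderiv_right (m := 1) (by norm_num)).differentiable (by simp) x
  have e : ∀ i j : Fin 2, pd i (pd j f) x = fderiv ℝ (fderiv ℝ f) x (Pi.single i 1) (Pi.single j 1) := fun i j => by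
    have : HasFDerivAt (pd j f) _ x := hd.hasFDerivAt.clm_apply (hasFDerivAt_const (Pi.single j (1:ℝ) : V2) x)
    have e : pd i (pd j f) x = fderiv ℝ (pd j f) x (Pi.single i 1) := rfl
    rw [e, this.fderiv]; simp
  rw [e, e]; exact hs.eq _ _

/-- orthogonality -/
lemma orth (h : DomFn Ω φ) {G w : V2 → ℝ} (hG : ContDiff ℝ 1 G) (hw : ContDiff ℝ 2 w) (hb : ∀ x ∈ frontier Ω, w x = 0) :
    ∫ x in Ω, (pd 1 G x * pd 0 w x - pd 0 G x * pd 1 w x) = 0 := by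
  have w0 := contDiff_pd (m := 1) hw (by norm_num) 0
  have w1 := contDiff_pd (m := 1) hw (by norm_num) 1
  have z := div_zero_tan h (V0 := fun x => G x * (-1 * pd 1 w x)) (V1 := fun x => G x * pd 0 w x) (by fun_prop) (by fun_prop) (fun x hx => by
    have hφx : φ x = 0 := by rw [h.fr] at hx; exact hx
    have hext : IsLocalExtrOn w {y | φ y = φ x} x := by
      left
      filter_upwards [self_mem_nhdsWithin] with y hy
      have hy : φ y = φ x := hy
      rw [hb x hx, hb y (by rw [h.fr]; exact hy.trans hφx)]
    obtain ⟨a, b, hab, he⟩ := hext.exists_multipliers_of_hasStrictFDerivAt_1d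
      (h.smooth.contDiffAt.hasStrictFDerivAt (by simp)) (hw.contDiffAt.hasStrictFDerivAt (by simp))
    have e0 : a * pd 0 φ x + b * pd 0 w x = 0 := DFunLike.congr_fun he (Pi.single 0 1)
    have e1 : a * pd 1 φ x + b * pd 1 w x = 0 := DFunLike.congr_fun he (Pi.single 1 1)
    have hbne : b ≠ 0 := by
      rintro rfl
      have ha : a ≠ 0 := fun h' => hab (by simp [h'])
      apply h.gr x hx
      funext i
      fin_cases i
      · simpa [grad, ha] using e0
      · simpa [grad, ha] using e1
    apply mul_left_cancel₀ hbne
    linear_combination G x * (-pd 0 φ x) * e1 + G x * pd 1 φ x * e0)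
  rw [← z]
  congr 1; ext x
  have dG := hG.differentiable (by simp) x
  have dw0 := w0.differentiable (by simp) x
  have dw1 := w1.differentiable (by simp) x
  rw [pd_mul dG (dw1.const_mul _), pd_mul dG dw0, pd_const_mul _ dw1, pd_symm hw]
  ring

end



lemma norm_fderiv_le (f : V2 → ℝ) (x : V2) : ‖fderiv ℝ f x‖ ≤ |pd 0 f x| + |pd 1 f x| := by
  apply ContinuousLinearMap.opNorm_le_bound _ (by positivity)
  intro v
  rw [fderiv_eq_sum, Real.norm_eq_abs]
  have h0 : |v 0| ≤ ‖v‖ := norm_le_pi_norm v 0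
  have h1 : |v 1| ≤ ‖v‖ := norm_le_pi_norm v 1
  calc |v 0 * pd 0 f x + v 1 * pd 1 f x| ≤ |v 0| * |pd 0 f x| + |v 1| * |pd 1 f x| := by
        rw [← abs_mul, ← abs_mul]; exact abs_add_le _ _
    _ ≤ ‖v‖ * |pd 0 f x| + ‖v‖ * |pd 1 f x| := by gcongr
    _ = _ := by ring

lemma sob_cc {f : V2 → ℝ} (hf : ContDiff ℝ 1 f) (hc : HasCompactSupport f) :
    ∫ x, f x ^ 2 ≤ (∫ x, (|pd 0 f x| + |pd 1 f x|)) ^ 2 := by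
  have hcpd : ∀ i, CC (pd i f) := fun i => ⟨cont_pd hf i, by
    have := hc.fderiv_apply (𝕜 := ℝ) (Pi.single i 1); exact this⟩
  have hI : Integrable (fun x => |pd 0 f x| + |pd 1 f x|) := ((hcpd 0).abs.add (hcpd 1).abs).integrable
  have hF : CC f := ⟨hf.continuous, hc⟩
  have hI2 : Integrable (fun x => f x ^ 2) := by
    have := (hF.mul hF).integrable
    simpa [sq] using this
  have hp : Real.HolderConjugate (Fintype.card (Fin 2) : ℝ) 2 := by
    rw [Fintype.card_fin]; exact Real.holderConjugate_iff.2 ⟨by norm_num, by norm_num⟩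
  have key := lintegral_pow_le_pow_lintegral_fderiv_aux hp hf hc
  have e1 : ∫⁻ x, ‖f x‖ₑ ^ (2:ℝ) = ENNReal.ofReal (∫ x, f x ^ 2) := by
    rw [ofReal_integral_eq_lintegral_ofReal hI2 (ae_of_all _ fun x => sq_nonneg _)]
    congr 1; ext x
    rw [Real.enorm_eq_ofReal_abs, ENNReal.ofReal_rpow_of_nonneg (abs_nonneg _) (by norm_num), Real.rpow_two, sq_abs]
  have e2 : ∫⁻ x, ‖fderiv ℝ f x‖ₑ ≤ ENNReal.ofReal (∫ x, (|pd 0 f x| + |pd 1 f x|)) := by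
    rw [ofReal_integral_eq_lintegral_ofReal hI (ae_of_all _ fun x => by positivity)]
    apply lintegral_mono
    intro x
    show ‖fderiv ℝ f x‖ₑ ≤ _
    rw [← ofReal_norm_eq_enorm]
    exact ENNReal.ofReal_le_ofReal (norm_fderiv_le f x)
  have hnn : 0 ≤ ∫ x, (|pd 0 f x| + |pd 1 f x|) := integral_nonneg fun x => by positivity
  rw [e1] at key
  have := key.trans (ENNReal.rpow_le_rpow e2 (by norm_num))
  rw [ENNReal.ofReal_rpow_of_nonneg hnn (by norm_num), Real.rpow_two] at this
  exact (ENNReal.ofReal_le_ofReal_iff (by positivity)).1 this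

section
variable {Ω : Set V2} {φ : V2 → ℝ}

lemma sob_dom (h : DomFn Ω φ) : ∃ C > (0:ℝ), ∀ g : V2 → ℝ, ContDiff ℝ 1 g → (∀ x, 0 ≤ g x) →
    ∫ x in Ω, g x ^ 2 ≤ C * (∫ x in Ω, (|pd 0 g x| + |pd 1 g x| + g x)) ^ 2 := by
  obtain ⟨K, hK, hKb⟩ := kap_bound h
  have s0 := (smooth_pd h.smooth 0).continuous
  have s1 := (smooth_pd h.smooth 1).continuous
  obtain ⟨M, hM⟩ := h.compact_cl.exists_bound_of_continuousOn (f := fun x => |pd 0 φ x| + |pd 1 φ x|) (by fun_prop)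
  have hM0 : 0 ≤ M := by
    obtain ⟨x, hx⟩ := h.ne
    exact (norm_nonneg _).trans (hM x (subset_closure hx))
  refine ⟨(1 + M * K) ^ 2, by positivity, fun g hg hg0 => ?_⟩
  have gc := hg.continuous
  have g0 := cont_pd hg 0
  have g1 := cont_pd hg 1
  have cE : Continuous (fun x => |pd 0 g x| + |pd 1 g x| + g x) := by fun_prop
  have c2 : Continuous (fun x => g x ^ 2) := by fun_prop
  have l1 := ((cut_lim h c2).const_mul 2).sub_const (∫ x in Ω, g x ^ 2)
  have l2 := ((cut_lim h cE).pow 2).const_mul ((1 + M * K) ^ 2)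
  have : 2 * (∫ x in Ω, g x ^ 2) - (∫ x in Ω, g x ^ 2) ≤ (1 + M * K) ^ 2 * (∫ x in Ω, (|pd 0 g x| + |pd 1 g x| + g x)) ^ 2 := by
    refine le_of_tendsto_of_tendsto l1 l2 ?_
    filter_upwards [hKb g hg hg0] with n hn
    have hc := cut_smooth h n
    have c1 : ContDiff ℝ 1 (cut φ n) := hc.of_le (by simp)
    have hcc := c1.continuous
    have hkc := kap_cont h n
    have hf : ContDiff ℝ 1 (fun x => cut φ n x * g x) := c1.mul hg
    have hfs : HasCompactSupport (fun x => cut φ n x * g x) := (cut_supp h n).1.mul_right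
    have key := sob_cc hf hfs
    have A : 2 * (∫ x, cut φ n x * g x ^ 2) - (∫ x in Ω, g x ^ 2) ≤ ∫ x, (cut φ n x * g x) ^ 2 := by
      have e1 : ∫ x, cut φ n x * g x ^ 2 = ∫ x in Ω, cut φ n x * g x ^ 2 := by
        rw [setIntegral_eq_integral_of_forall_compl_eq_zero]
        intro x hx; rw [(cut_supp h n).2 x hx, zero_mul]
      have e2 : ∫ x, (cut φ n x * g x) ^ 2 = ∫ x in Ω, (cut φ n x * g x) ^ 2 := by
        rw [setIntegral_eq_integral_of_forall_compl_eq_zero]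
        intro x hx; rw [(cut_supp h n).2 x hx]; simp
      rw [e1, e2, ← integral_const_mul, ← integral_sub (h.intOn (by fun_prop)) (h.intOn (by fun_prop))]
      apply integral_mono (h.intOn (by fun_prop)) (h.intOn (by fun_prop))
      intro x
      show 2 * (cut φ n x * g x ^ 2) - g x ^ 2 ≤ (cut φ n x * g x) ^ 2
      nlinarith [mul_nonneg (sq_nonneg (cut φ n x - 1)) (sq_nonneg (g x))]
    have B : ∫ x, (|pd 0 (fun x => cut φ n x * g x) x| + |pd 1 (fun x => cut φ n x * g x) x|) ≤
        (1 + M * K) * ∫ x, cut φ n x * (|pd 0 g x| + |pd 1 g x| + g x) := by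
      have b1 : ∫ x, (|pd 0 (fun x => cut φ n x * g x) x| + |pd 1 (fun x => cut φ n x * g x) x|) ≤
          ∫ x, (cut φ n x * (|pd 0 g x| + |pd 1 g x| + g x) + M * (kap φ n x * g x)) := by
        apply integral_mono
        · have hcpd : ∀ i, CC (pd i (fun x => cut φ n x * g x)) := fun i => ⟨cont_pd hf i, by
            have := hfs.fderiv_apply (𝕜 := ℝ) (Pi.single i 1); exact this⟩
          exact ((hcpd 0).abs.add (hcpd 1).abs).integrable
        · exact (cut_int h n cE).add ((kap_int h n gc).const_mul _)
        intro x
        show |pd 0 (fun x => cut φ n x * g x) x| + |pd 1 (fun x => cut φ n x * g x) x| ≤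
          cut φ n x * (|pd 0 g x| + |pd 1 g x| + g x) + M * (kap φ n x * g x)
        have d1 := c1.differentiable (by simp) x
        have d2 := hg.differentiable (by simp) x
        have ck := kap_nonneg (φ := φ) n x
        have cc := (cut_01 (φ := φ) n x).1
        have gx := hg0 x
        have t : ∀ i, |pd i (fun x => cut φ n x * g x) x| ≤ cut φ n x * |pd i g x| + kap φ n x * g x * |pd i φ x| := fun i => by
          rw [pd_mul d1 d2, cut_pd h]
          refine (abs_add_le _ _).trans ?_
          rw [abs_mul, abs_mul, abs_neg, abs_mul, abs_of_nonneg ck, abs_of_nonneg cc, abs_of_nonneg gx]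
          apply le_of_eq; ring
        have t0 := t 0
        have t1 := t 1
        have t2 : kap φ n x * g x * (|pd 0 φ x| + |pd 1 φ x|) ≤ kap φ n x * g x * M := by
          by_cases hk : kap φ n x = 0
          · simp [hk]
          · have := hM x (by rw [h.closure]; exact (kap_strip hk).2)
            rw [Real.norm_of_nonneg (by positivity)] at this
            exact mul_le_mul_of_nonneg_left this (by positivity)
        nlinarith [mul_nonneg cc gx]
      rw [integral_add (cut_int h n cE) ((kap_int h n gc).const_mul _), integral_const_mul] at b1
      nlinarith [mul_le_mul_of_nonneg_left hn hM0]
    have B0 : 0 ≤ ∫ x, (|pd 0 (fun x => cut φ n x * g x) x| + |pd 1 (fun x => cut φ n x * g x) x|) :=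
      integral_nonneg fun x => by positivity
    calc _ ≤ _ := A
      _ ≤ _ := key
      _ ≤ _ := pow_le_pow_left₀ B0 B 2
      _ = _ := by rw [mul_pow]
  linarith

lemma cs_dom (h : DomFn Ω φ) {f g : V2 → ℝ} (hf : Continuous f) (hg : Continuous g) :
    (∫ x in Ω, f x * g x) ^ 2 ≤ (∫ x in Ω, f x ^ 2) * ∫ x in Ω, g x ^ 2 := by
  have q : ∀ t : ℝ, 0 ≤ (∫ x in Ω, f x ^ 2) * (t * t) + (2 * ∫ x in Ω, f x * g x) * t + ∫ x in Ω, g x ^ 2 := by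
    intro t
    have e : ∫ x in Ω, (t * f x + g x) ^ 2 = (∫ x in Ω, f x ^ 2) * (t * t) + (2 * ∫ x in Ω, f x * g x) * t + ∫ x in Ω, g x ^ 2 := by
      have : ∀ x, (t * f x + g x) ^ 2 = (t * t) * f x ^ 2 + (2 * t) * (f x * g x) + g x ^ 2 := fun x => by ring
      simp_rw [this]
      rw [integral_add (h.intOn (by fun_prop)) (h.intOn (by fun_prop)),
        integral_add (h.intOn (by fun_prop)) (h.intOn (by fun_prop)), integral_const_mul, integral_const_mul]
      ring
    rw [← e]; exact integral_nonneg fun x => sq_nonneg _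
  have := discrim_le_zero q
  rw [discrim] at this
  nlinarith

/-- the `H1` energy -/
def En (Ω : Set V2) (v : V2 → ℝ) : ℝ := ∫ x in Ω, (pd 0 v x ^ 2 + pd 1 v x ^ 2 + v x ^ 2)

lemma pd_abs_rpow {v : V2 → ℝ} (hv : ContDiff ℝ 1 v) {q : ℝ} (hq : 1 < q) (i : Fin 2) (x : V2) :
    |pd i (fun x => |v x| ^ q) x| = q * |v x| ^ (q - 1) * |pd i v x| := by
  have h1 : HasDerivAt (fun t : ℝ => |t| ^ q) (q * |v x| ^ (q - 2) * v x) (v x) := hasDerivAt_norm_rpow (v x) hq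
  have h2 : HasFDerivAt (fun x => |v x| ^ q) _ x := h1.comp_hasFDerivAt x (hv.differentiable (by simp) x).hasFDerivAt
  have e : pd i (fun x => |v x| ^ q) x = fderiv ℝ (fun x => |v x| ^ q) x (Pi.single i 1) := rfl
  rw [e, h2.fderiv]
  show |(q * |v x| ^ (q - 2) * v x) * pd i v x| = _
  rw [abs_mul, abs_mul, abs_mul, abs_of_nonneg (by linarith : 0 ≤ q), abs_of_nonneg (by positivity : 0 ≤ |v x| ^ (q-2))]
  by_cases hv0 : v x = 0
  · rw [hv0, abs_zero, Real.zero_rpow (by linarith : q - 1 ≠ 0)]; ring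
  · have : |v x| ^ (q - 1) = |v x| ^ (q - 2) * |v x| := by
      rw [show q - 1 = (q - 2) + 1 by ring, Real.rpow_add_one (abs_pos.2 hv0).ne']
    rw [this]; ring

lemma gn_step (h : DomFn Ω φ) {p : ℝ} (hp : 4 ≤ p) : ∃ K > (0:ℝ), ∀ v : V2 → ℝ, ContDiff ℝ 1 v →
    ∫ x in Ω, |v x| ^ p ≤ K * En Ω v * ∫ x in Ω, |v x| ^ (p - 2) := by
  obtain ⟨C, hC, hCb⟩ := sob_dom h
  refine ⟨C * (p / 2) ^ 2 * 3, by positivity, fun v hv => ?_⟩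
  have hq : 1 < p / 2 := by linarith
  have vc := hv.continuous
  have v0 := cont_pd hv 0
  have v1 := cont_pd hv 1
  have hg : ContDiff ℝ 1 (fun x => |v x| ^ (p / 2)) := hv.norm_rpow hq
  have key := hCb _ hg (fun x => by positivity)
  have e1 : ∀ x, (|v x| ^ (p / 2)) ^ 2 = |v x| ^ p := fun x => by
    rw [← Real.rpow_mul_natCast (abs_nonneg _)]; congr 1; push_cast; ring
  simp_rw [e1, pd_abs_rpow hv hq] at key
  have cq : Continuous (fun x => |v x| ^ (p / 2 - 1)) := cont_abspow vc (by linarith)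
  have cq' : Continuous (fun x => |v x| ^ (p / 2)) := cont_abspow vc (by linarith)
  have b : ∫ x in Ω, (p / 2 * |v x| ^ (p / 2 - 1) * |pd 0 v x| + p / 2 * |v x| ^ (p / 2 - 1) * |pd 1 v x| + |v x| ^ (p / 2))
      ≤ (p / 2) * ∫ x in Ω, |v x| ^ (p / 2 - 1) * (|pd 0 v x| + |pd 1 v x| + |v x|) := by
    rw [← integral_const_mul]
    apply integral_mono (h.intOn (by fun_prop)) (h.intOn (by fun_prop))
    intro x
    show p / 2 * |v x| ^ (p / 2 - 1) * |pd 0 v x| + p / 2 * |v x| ^ (p / 2 - 1) * |pd 1 v x| + |v x| ^ (p / 2) ≤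
      p / 2 * (|v x| ^ (p / 2 - 1) * (|pd 0 v x| + |pd 1 v x| + |v x|))
    have e : |v x| ^ (p / 2) = |v x| ^ (p / 2 - 1) * |v x| := by
      rw [← Real.rpow_add_one' (abs_nonneg _) (by linarith)]; congr 1; ring
    rw [e]
    have : 0 ≤ |v x| ^ (p / 2 - 1) * |v x| := by positivity
    nlinarith
  have b0 : 0 ≤ ∫ x in Ω, (p / 2 * |v x| ^ (p / 2 - 1) * |pd 0 v x| + p / 2 * |v x| ^ (p / 2 - 1) * |pd 1 v x| + |v x| ^ (p / 2)) :=
    integral_nonneg fun x => by positivity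
  have cs := cs_dom h (f := fun x => |v x| ^ (p / 2 - 1)) (g := fun x => |pd 0 v x| + |pd 1 v x| + |v x|) cq (by fun_prop)
  have e2 : ∀ x, (|v x| ^ (p / 2 - 1)) ^ 2 = |v x| ^ (p - 2) := fun x => by
    rw [← Real.rpow_mul_natCast (abs_nonneg _)]; congr 1; push_cast; ring
  simp_rw [e2] at cs
  have e3 : ∫ x in Ω, (|pd 0 v x| + |pd 1 v x| + |v x|) ^ 2 ≤ 3 * En Ω v := by
    rw [En, ← integral_const_mul]
    apply integral_mono (h.intOn (by fun_prop)) (h.intOn (by fun_prop))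
    intro x
    show (|pd 0 v x| + |pd 1 v x| + |v x|) ^ 2 ≤ 3 * (pd 0 v x ^ 2 + pd 1 v x ^ 2 + v x ^ 2)
    rw [← sq_abs (pd 0 v x), ← sq_abs (pd 1 v x), ← sq_abs (v x)]
    nlinarith [sq_nonneg (|pd 0 v x| - |pd 1 v x|), sq_nonneg (|pd 0 v x| - |v x|), sq_nonneg (|v x| - |pd 1 v x|)]
  have I0 : 0 ≤ ∫ x in Ω, |v x| ^ (p - 2) := integral_nonneg fun x => by positivity
  calc _ ≤ _ := key
    _ ≤ C * ((p / 2) * ∫ x in Ω, |v x| ^ (p / 2 - 1) * (|pd 0 v x| + |pd 1 v x| + |v x|)) ^ 2 := by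
      apply mul_le_mul_of_nonneg_left (pow_le_pow_left₀ b0 b 2) hC.le
    _ = C * (p / 2) ^ 2 * (∫ x in Ω, |v x| ^ (p / 2 - 1) * (|pd 0 v x| + |pd 1 v x| + |v x|)) ^ 2 := by ring
    _ ≤ C * (p / 2) ^ 2 * ((∫ x in Ω, |v x| ^ (p - 2)) * (3 * En Ω v)) := by
      apply mul_le_mul_of_nonneg_left (cs.trans (mul_le_mul_of_nonneg_left e3 I0)) (by positivity)
    _ = _ := by ring

lemma ptw1 {p l w : ℝ} (hp : 4 ≤ p) (hl : 0 < l) (hw : 0 ≤ w) : w ^ (p - 2) ≤ l ^ (-2:ℝ) * w ^ p + l ^ (p - 4) * w ^ (2:ℝ) := by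
  have n1 : 0 ≤ l ^ (-2:ℝ) * w ^ p := by positivity
  have n2 : 0 ≤ l ^ (p - 4) * w ^ (2:ℝ) := by positivity
  rcases le_total l w with hh | hh
  · have hwp : 0 < w := hl.trans_le hh
    have : w ^ (p - 2) = w ^ (-2:ℝ) * w ^ p := by rw [← Real.rpow_add hwp]; congr 1; ring
    have h2 : w ^ (-2:ℝ) ≤ l ^ (-2:ℝ) := Real.rpow_le_rpow_of_nonpos hl hh (by norm_num)
    have : w ^ (p - 2) ≤ l ^ (-2:ℝ) * w ^ p := by rw [this]; gcongr
    linarith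
  · have : w ^ (p - 2) = w ^ (p - 4) * w ^ (2:ℝ) := by
      rw [← Real.rpow_add_of_nonneg hw (by linarith) (by norm_num)]; congr 1; ring
    have h2 : w ^ (p - 4) ≤ l ^ (p - 4) := Real.rpow_le_rpow hw hh (by linarith)
    have : w ^ (p - 2) ≤ l ^ (p - 4) * w ^ (2:ℝ) := by rw [this]; gcongr
    linarith

lemma ptw2 {p l w : ℝ} (hp : 2 < p) (hp4 : p < 4) (hl : 0 < l) (hw : 0 ≤ w) :
    w ^ p ≤ l ^ (p - 2) * w ^ (2:ℝ) + l ^ (p - 4) * w ^ (4:ℝ) := by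
  have n1 : 0 ≤ l ^ (p - 2) * w ^ (2:ℝ) := by positivity
  have n2 : 0 ≤ l ^ (p - 4) * w ^ (4:ℝ) := by positivity
  rcases le_total l w with hh | hh
  · have hwp : 0 < w := hl.trans_le hh
    have : w ^ p = w ^ (p - 4) * w ^ (4:ℝ) := by rw [← Real.rpow_add hwp]; congr 1; ring
    have h2 : w ^ (p - 4) ≤ l ^ (p - 4) := Real.rpow_le_rpow_of_nonpos hl hh (by linarith)
    have : w ^ p ≤ l ^ (p - 4) * w ^ (4:ℝ) := by rw [this]; gcongr
    linarith
  · have : w ^ p = w ^ (p - 2) * w ^ (2:ℝ) := by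
      rw [← Real.rpow_add_of_nonneg hw (by linarith) (by norm_num)]; congr 1; ring
    have h2 : w ^ (p - 2) ≤ l ^ (p - 2) := Real.rpow_le_rpow hw hh (by linarith)
    have : w ^ p ≤ l ^ (p - 2) * w ^ (2:ℝ) := by rw [this]; gcongr
    linarith

lemma En_nonneg (v : V2 → ℝ) : 0 ≤ En Ω v := integral_nonneg fun x => by positivity

lemma En_zero (h : DomFn Ω φ) {p : ℝ} (hp : 0 < p) {v : V2 → ℝ} (hv : ContDiff ℝ 1 v) (hE : En Ω v = 0) : ∫ x in Ω, |v x| ^ p = 0 := by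
  have vc := hv.continuous
  have v0 := cont_pd hv 0
  have v1 := cont_pd hv 1
  have := (integral_eq_zero_iff_of_nonneg (fun x => by positivity) (h.intOn (f := fun x => pd 0 v x ^ 2 + pd 1 v x ^ 2 + v x ^ 2) (by fun_prop))).1 hE
  apply integral_eq_zero_of_ae
  filter_upwards [this] with x hx
  have hx : pd 0 v x ^ 2 + pd 1 v x ^ 2 + v x ^ 2 = 0 := hx
  have : v x = 0 := by
    have : v x ^ 2 = 0 := by nlinarith [sq_nonneg (pd 0 v x), sq_nonneg (pd 1 v x), sq_nonneg (v x)]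
    simpa using this
  simp [this, Real.zero_rpow hp.ne']

lemma gn4 (h : DomFn Ω φ) {p : ℝ} (hp : 4 ≤ p) : ∃ C > (0:ℝ), ∀ v : V2 → ℝ, ContDiff ℝ 1 v →
    ∫ x in Ω, |v x| ^ p ≤ C * (∫ x in Ω, |v x| ^ (2:ℝ)) * En Ω v ^ ((p - 2) / 2) := by
  obtain ⟨K, hK, hKb⟩ := gn_step h hp
  refine ⟨(2 * K) ^ ((p - 2) / 2), by positivity, fun v hv => ?_⟩
  have vc := hv.continuous
  have I2 : 0 ≤ ∫ x in Ω, |v x| ^ (2:ℝ) := integral_nonneg fun x => by positivity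
  rcases (En_nonneg (Ω := Ω) v).eq_or_lt with hE | hE
  · rw [En_zero h (by linarith) hv hE.symm]
    have := En_nonneg (Ω := Ω) v
    positivity
  · have key := hKb v hv
    have c1 := cont_abspow vc (p := p) (by linarith)
    have c2 := cont_abspow vc (p := 2) (by linarith)
    have c3 := cont_abspow vc (p := p - 2) (by linarith)
    set l := (2 * K * En Ω v) ^ ((1:ℝ) / 2) with hl
    have hpos : 0 < 2 * K * En Ω v := by positivity
    have lpos : 0 < l := by positivity
    have t : ∫ x in Ω, |v x| ^ (p - 2) ≤ l ^ (-2:ℝ) * (∫ x in Ω, |v x| ^ p) + l ^ (p - 4) * ∫ x in Ω, |v x| ^ (2:ℝ) := by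
      rw [← integral_const_mul, ← integral_const_mul, ← integral_add (h.intOn (by fun_prop)) (h.intOn (by fun_prop))]
      apply integral_mono (h.intOn (by fun_prop)) (h.intOn (by fun_prop))
      intro x
      exact ptw1 hp lpos (abs_nonneg _)
    have r1 : l ^ (-2:ℝ) = (2 * K * En Ω v)⁻¹ := by
      rw [hl, ← Real.rpow_mul hpos.le, ← Real.rpow_neg_one]; norm_num
    have r2 : 2 * K * En Ω v * l ^ (p - 4) = (2 * K * En Ω v) ^ ((p - 2) / 2) := by
      rw [hl, ← Real.rpow_mul hpos.le]
      conv_lhs => lhs; rw [← Real.rpow_one (2 * K * En Ω v)]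
      rw [← Real.rpow_add hpos]; congr 1; ring
    rw [r1] at t
    have := mul_le_mul_of_nonneg_left t (by positivity : 0 ≤ K * En Ω v)
    have e : K * En Ω v * ((2 * K * En Ω v)⁻¹ * (∫ x in Ω, |v x| ^ p) + l ^ (p - 4) * ∫ x in Ω, |v x| ^ (2:ℝ)) =
        (∫ x in Ω, |v x| ^ p) / 2 + (2 * K * En Ω v * l ^ (p - 4)) / 2 * ∫ x in Ω, |v x| ^ (2:ℝ) := by
      field_simp
    rw [e, r2] at this
    have f := key.trans this
    rw [Real.mul_rpow (by positivity) hE.le] at f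
    linarith

lemma gn_dom (h : DomFn Ω φ) {p : ℝ} (hp : 2 < p) : ∃ C > (0:ℝ), ∀ v : V2 → ℝ, ContDiff ℝ 1 v →
    ∫ x in Ω, |v x| ^ p ≤ C * (∫ x in Ω, |v x| ^ (2:ℝ)) * En Ω v ^ ((p - 2) / 2) := by
  rcases le_or_gt 4 p with hp4 | hp4
  · exact gn4 h hp4
  obtain ⟨K, hK, hKb⟩ := gn4 h (le_refl 4)
  refine ⟨1 + K, by positivity, fun v hv => ?_⟩
  have vc := hv.continuous
  have I2 : 0 ≤ ∫ x in Ω, |v x| ^ (2:ℝ) := integral_nonneg fun x => by positivity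
  rcases (En_nonneg (Ω := Ω) v).eq_or_lt with hE | hE
  · rw [En_zero h (by linarith) hv hE.symm]
    have := En_nonneg (Ω := Ω) v
    positivity
  · have key := hKb v hv
    have c1 := cont_abspow vc (p := p) (by linarith)
    have c2 := cont_abspow vc (p := 2) (by linarith)
    have c3 := cont_abspow vc (p := 4) (by linarith)
    set l := (En Ω v) ^ ((1:ℝ) / 2) with hl
    have lpos : 0 < l := by positivity
    have t : ∫ x in Ω, |v x| ^ p ≤ l ^ (p - 2) * (∫ x in Ω, |v x| ^ (2:ℝ)) + l ^ (p - 4) * ∫ x in Ω, |v x| ^ (4:ℝ) := by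
      rw [← integral_const_mul, ← integral_const_mul, ← integral_add (h.intOn (by fun_prop)) (h.intOn (by fun_prop))]
      apply integral_mono (h.intOn (by fun_prop)) (h.intOn (by fun_prop))
      intro x
      exact ptw2 hp hp4 lpos (abs_nonneg _)
    have r1 : l ^ (p - 2) = En Ω v ^ ((p - 2) / 2) := by
      rw [hl, ← Real.rpow_mul hE.le]; congr 1; ring
    have r2 : l ^ (p - 4) * En Ω v ^ (((4:ℝ) - 2) / 2) = En Ω v ^ ((p - 2) / 2) := by
      rw [hl, ← Real.rpow_mul hE.le, ← Real.rpow_add hE]; congr 1; ring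
    have := mul_le_mul_of_nonneg_left key (by positivity : 0 ≤ l ^ (p - 4))
    rw [r1] at t
    calc _ ≤ _ := t
      _ ≤ _ := add_le_add_right this _
      _ = En Ω v ^ ((p - 2) / 2) * (∫ x in Ω, |v x| ^ (2:ℝ)) + K * (∫ x in Ω, |v x| ^ (2:ℝ)) * (l ^ (p - 4) * En Ω v ^ (((4:ℝ) - 2) / 2)) := by ring
      _ = _ := by rw [r2]; ring

end



section
variable {Ω : Set V2} {φ : V2 → ℝ}

lemma lps_int_nonneg (p : ℝ) (f : V2 → ℝ) : 0 ≤ ∫ x in Ω, |f x| ^ p := integral_nonneg fun x => by positivity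

lemma lps_nonneg (p : ℝ) (f : V2 → ℝ) : 0 ≤ LpS p Ω f := Real.rpow_nonneg (lps_int_nonneg p f) _

lemma root_pow {p a : ℝ} (hp : 0 < p) (ha : 0 ≤ a) : (a ^ (1 / p)) ^ p = a := by
  rw [← Real.rpow_mul ha, one_div_mul_cancel hp.ne', Real.rpow_one]

lemma pow_root {p a : ℝ} (hp : 0 < p) (ha : 0 ≤ a) : (a ^ p) ^ (1 / p) = a := by
  rw [← Real.rpow_mul ha, mul_one_div_cancel hp.ne', Real.rpow_one]

lemma lps_pow {p : ℝ} (hp : 0 < p) (f : V2 → ℝ) : LpS p Ω f ^ p = ∫ x in Ω, |f x| ^ p :=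
  root_pow hp (lps_int_nonneg p f)

lemma lps_sq (f : V2 → ℝ) : LpS 2 Ω f ^ 2 = ∫ x in Ω, f x ^ 2 := by
  have := lps_pow (Ω := Ω) (two_pos) f
  rw [Real.rpow_two] at this
  rw [this]; simp_rw [Real.rpow_two, sq_abs]

lemma lps2_le {f : V2 → ℝ} {D : ℝ} (hD : 0 ≤ D) (h : ∫ x in Ω, f x ^ 2 ≤ D ^ 2) : LpS 2 Ω f ≤ D := by
  rw [← lps_sq] at h
  exact (pow_le_pow_iff_left₀ (lps_nonneg _ _) hD two_ne_zero).1 h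

lemma root_add {p a b : ℝ} (hp : 1 ≤ p) (ha : 0 ≤ a) (hb : 0 ≤ b) : (a + b) ^ (1 / p) ≤ a ^ (1 / p) + b ^ (1 / p) :=
  Real.rpow_add_le_add_rpow ha hb (by positivity) (by rw [div_le_one (by linarith)]; exact hp)

lemma lps_add (h : DomFn Ω φ) {p : ℝ} (hp : 1 ≤ p) {f g k : V2 → ℝ} (hf : Continuous f) (hg : Continuous g) (hk : Continuous k)
    (hb : ∀ x ∈ Ω, |f x| ≤ |g x| + |k x|) : LpS p Ω f ≤ 2 * (LpS p Ω g + LpS p Ω k) := by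
  have hp0 : 0 < p := by linarith
  have cf := cont_abspow hf hp0.le
  have cg := cont_abspow hg hp0.le
  have ck := cont_abspow hk hp0.le
  have t : ∫ x in Ω, |f x| ^ p ≤ 2 ^ p * ((∫ x in Ω, |g x| ^ p) + ∫ x in Ω, |k x| ^ p) := by
    rw [← integral_add (h.intOn cg) (h.intOn ck), ← integral_const_mul]
    apply setIntegral_mono_on (h.intOn cf) (h.intOn (by fun_prop)) h.isOpen.measurableSet
    intro x hx
    exact (Real.rpow_le_rpow (abs_nonneg _) (hb x hx) hp0.le).trans (add_rpow_le2 hp0.le (abs_nonneg _) (abs_nonneg _))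
  unfold LpS
  have a := lps_int_nonneg (Ω := Ω) p g
  have b := lps_int_nonneg (Ω := Ω) p k
  calc _ ≤ _ := Real.rpow_le_rpow (lps_int_nonneg p f) t (by positivity)
    _ = 2 * ((∫ x in Ω, |g x| ^ p) + ∫ x in Ω, |k x| ^ p) ^ (1 / p) := by
      rw [Real.mul_rpow (by positivity) (by positivity), pow_root hp0 (by norm_num)]
    _ ≤ _ := by gcongr; exact root_add hp a b

lemma lps_smul {p c : ℝ} (hp : 0 < p) (hc : 0 ≤ c) (f : V2 → ℝ) : LpS p Ω (fun x => c * f x) = c * LpS p Ω f := by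
  unfold LpS
  simp_rw [abs_mul, abs_of_nonneg hc, Real.mul_rpow hc (abs_nonneg _)]
  rw [integral_const_mul, Real.mul_rpow (by positivity) (lps_int_nonneg p f), pow_root hp hc]

lemma gn_norm (h : DomFn Ω φ) {p : ℝ} (hp : 2 < p) : ∃ C > (0:ℝ), ∀ v : V2 → ℝ, ContDiff ℝ 1 v → ∀ N D : ℝ, LpS 2 Ω v ≤ N →
    0 ≤ D → ∫ x in Ω, (pd 0 v x ^ 2 + pd 1 v x ^ 2) ≤ D ^ 2 →
    LpS p Ω v ≤ C * (N ^ (2 / p) * D ^ (1 - 2 / p) + N) := by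
  obtain ⟨C, hC, hCb⟩ := gn_dom h hp
  refine ⟨C ^ (1 / p), by positivity, fun v hv N D hN hD hg => ?_⟩
  have hp0 : 0 < p := by linarith
  have hN0 : 0 ≤ N := (lps_nonneg _ _).trans hN
  have hth : 2 / p < 1 := by rw [div_lt_one hp0]; exact hp
  have hth0 : 0 < 2 / p := by positivity
  have vc := hv.continuous
  have v0 := cont_pd hv 0
  have v1 := cont_pd hv 1
  have I2 : ∫ x in Ω, |v x| ^ (2:ℝ) ≤ N ^ 2 := by
    have := lps_pow (Ω := Ω) (two_pos) v
    rw [← this, Real.rpow_two]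
    exact pow_le_pow_left₀ (lps_nonneg _ _) hN 2
  have hE : En Ω v ≤ (D + N) ^ 2 := by
    have e : En Ω v = (∫ x in Ω, (pd 0 v x ^ 2 + pd 1 v x ^ 2)) + ∫ x in Ω, v x ^ 2 :=
      integral_add (h.intOn (by fun_prop)) (h.intOn (by fun_prop))
    have : ∫ x in Ω, v x ^ 2 ≤ N ^ 2 := by rw [← lps_sq]; exact pow_le_pow_left₀ (lps_nonneg _ _) hN 2
    nlinarith [mul_nonneg hD hN0]
  have key : ∫ x in Ω, |v x| ^ p ≤ C * (N ^ 2 * (D + N) ^ (p - 2)) := by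
    have e : ((D + N) ^ 2) ^ ((p - 2) / 2) = (D + N) ^ (p - 2) := by
      rw [← Real.rpow_natCast_mul (by positivity)]; congr 1; push_cast; ring
    calc _ ≤ _ := hCb v hv
      _ ≤ C * N ^ 2 * ((D + N) ^ 2) ^ ((p - 2) / 2) := by
        have := lps_int_nonneg (Ω := Ω) 2 v
        gcongr
        · exact Real.rpow_nonneg (En_nonneg v) _
        · exact En_nonneg v
      _ = _ := by rw [e]; ring
  have e1 : (C * (N ^ 2 * (D + N) ^ (p - 2))) ^ (1 / p) = C ^ (1 / p) * (N ^ (2 / p) * (D + N) ^ (1 - 2 / p)) := by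
    rw [Real.mul_rpow hC.le (by positivity), Real.mul_rpow (by positivity) (by positivity), ← Real.rpow_natCast_mul hN0,
      ← Real.rpow_mul (by positivity)]
    congr 3
    · push_cast; ring
    · field_simp
  calc LpS p Ω v ≤ _ := Real.rpow_le_rpow (lps_int_nonneg p v) key (by positivity)
    _ = _ := e1
    _ ≤ C ^ (1 / p) * (N ^ (2 / p) * (D ^ (1 - 2 / p) + N ^ (1 - 2 / p))) := by
      gcongr
      exact Real.rpow_add_le_add_rpow hD hN0 (by linarith) (by linarith)
    _ = C ^ (1 / p) * (N ^ (2 / p) * D ^ (1 - 2 / p) + N ^ (2 / p) * N ^ (1 - 2 / p)) := by ring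
    _ = _ := by
      rw [← Real.rpow_add_of_nonneg hN0 hth0.le (by linarith)]; norm_num

lemma lps_holder (h : DomFn Ω φ) {p : ℝ} (hp : 2 < p) : ∃ C > (0:ℝ), ∀ f : V2 → ℝ, Continuous f → LpS 2 Ω f ≤ C * LpS p Ω f := by
  set m := ∫ x in Ω, (1:ℝ) with hm
  have hm0 : 0 ≤ m := integral_nonneg fun _ => zero_le_one
  refine ⟨m + 1, by positivity, fun f hf => ?_⟩
  have hp0 : 0 < p := by linarith
  have key : ∀ l > LpS p Ω f, LpS 2 Ω f ≤ (m + 1) * l := by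
    intro l hl
    have hl0 : 0 < l := lt_of_le_of_lt (lps_nonneg _ _) hl
    apply lps2_le (by positivity)
    have c1 := cont_abspow hf hp0.le
    have t : ∫ x in Ω, f x ^ 2 ≤ l ^ 2 * m + l ^ (2 - p) * ∫ x in Ω, |f x| ^ p := by
      rw [hm, ← integral_const_mul, ← integral_const_mul, ← integral_add (h.intOn (by fun_prop)) (h.intOn (by fun_prop))]
      apply integral_mono (h.intOn (by fun_prop)) (h.intOn (by fun_prop))
      intro x
      show f x ^ 2 ≤ l ^ 2 * 1 + l ^ (2 - p) * |f x| ^ p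
      have n1 : 0 ≤ l ^ (2 - p) * |f x| ^ p := by positivity
      rw [← sq_abs]
      rcases le_total (|f x|) l with hh | hh
      · have := pow_le_pow_left₀ (abs_nonneg _) hh 2
        linarith
      · have hpos : 0 < |f x| := hl0.trans_le hh
        have e : |f x| ^ 2 = |f x| ^ (2 - p) * |f x| ^ p := by
          rw [← Real.rpow_add hpos, ← Real.rpow_two]; congr 1; ring
        have h2 : |f x| ^ (2 - p) ≤ l ^ (2 - p) := Real.rpow_le_rpow_of_nonpos hl0 hh (by linarith)
        have : |f x| ^ 2 ≤ l ^ (2 - p) * |f x| ^ p := by rw [e]; gcongr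
        have := sq_nonneg l
        linarith
    have t2 : ∫ x in Ω, |f x| ^ p ≤ l ^ p := by
      rw [← lps_pow hp0]; exact Real.rpow_le_rpow (lps_nonneg _ _) hl.le hp0.le
    have t3 : l ^ (2 - p) * l ^ p = l ^ 2 := by rw [← Real.rpow_add hl0, ← Real.rpow_two]; congr 1; ring
    have t4 : l ^ (2 - p) * (∫ x in Ω, |f x| ^ p) ≤ l ^ 2 := by rw [← t3]; gcongr
    nlinarith [sq_nonneg l, mul_nonneg hm0 (sq_nonneg l), mul_nonneg (mul_nonneg hm0 hm0) (sq_nonneg l)]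
  have t : Tendsto (fun l : ℝ => (m + 1) * l) (𝓝[>] (LpS p Ω f)) (𝓝 ((m + 1) * LpS p Ω f)) := by
    have : Continuous (fun l : ℝ => (m + 1) * l) := by fun_prop
    exact (this.tendsto _).mono_left nhdsWithin_le_nhds
  exact ge_of_tendsto t (by filter_upwards [self_mem_nhdsWithin] with τ hτ using key τ hτ)

end



section
variable {Ω : Set V2} {φ : V2 → ℝ}

lemma gnsq_eq (U : V2 → V2) (x : V2) : gnsq U x = pd 0 (fun y => U y 0) x ^ 2 + pd 1 (fun y => U y 0) x ^ 2
    + pd 0 (fun y => U y 1) x ^ 2 + pd 1 (fun y => U y 1) x ^ 2 := by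
  simp [gnsq, Fin.sum_univ_two]; ring

lemma div2_eq (U : V2 → V2) (x : V2) : div2 U x = pd 0 (fun y => U y 0) x + pd 1 (fun y => U y 1) x := by
  simp [div2, Fin.sum_univ_two]

lemma gnsq_nonneg (U : V2 → V2) (x : V2) : 0 ≤ gnsq U x := by rw [gnsq_eq]; positivity

lemma lpg_nonneg (p : ℝ) (U : V2 → V2) : 0 ≤ LpG p Ω U :=
  Real.rpow_nonneg (integral_nonneg fun x => Real.rpow_nonneg (gnsq_nonneg U x) _) _

lemma lpg_sq (U : V2 → V2) : LpG 2 Ω U ^ 2 = ∫ x in Ω, gnsq U x := by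
  unfold LpG
  rw [← Real.rpow_two, root_pow two_pos (integral_nonneg fun x => Real.rpow_nonneg (gnsq_nonneg U x) _)]
  simp

lemma lpv_sq (U : V2 → V2) : LpV 2 Ω U ^ 2 = ∫ x in Ω, nsq (U x) := by
  have : ∀ x, 0 ≤ nsq (U x) := fun x => by unfold nsq; positivity
  unfold LpV
  rw [← Real.rpow_two, root_pow two_pos (integral_nonneg fun x => Real.rpow_nonneg (this x) _)]
  simp

lemma sq_half_rpow (a p : ℝ) : (a ^ 2) ^ (p / 2) = |a| ^ p := by
  rw [← sq_abs, ← Real.rpow_natCast_mul (abs_nonneg _)]; congr 1; push_cast; ring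

lemma divcurl_norm (h : DomFn Ω φ) {p : ℝ} (hp : 2 < p) : ∃ C > (0:ℝ), ∀ U : V2 → V2, (∀ i, ContDiff ℝ 1 (fun x => U x i)) →
    (∀ x ∈ frontier Ω, U x 0 * pd 0 φ x + U x 1 * pd 1 φ x = 0) →
    LpG p Ω U ≤ C * (LpS p Ω (div2 U) + LpS p Ω (curl2 U) + LpS p Ω (fun x => U x 0) + LpS p Ω (fun x => U x 1)) := by
  obtain ⟨C, hC, hCb⟩ := divcurl_dom h p hp
  have hp0 : 0 < p := by linarith
  refine ⟨(4 ^ (p / 2) * C) ^ (1 / p), by positivity, fun U hU hb => ?_⟩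
  have key := hCb (fun i x => U x i) hU hb
  have c00 := cont_abspow (cont_pd (hU 0) 0) hp0.le
  have c01 := cont_abspow (cont_pd (hU 0) 1) hp0.le
  have c10 := cont_abspow (cont_pd (hU 1) 0) hp0.le
  have c11 := cont_abspow (cont_pd (hU 1) 1) hp0.le
  have d00 := cont_pd (hU 0) 0
  have d01 := cont_pd (hU 0) 1
  have d10 := cont_pd (hU 1) 0
  have d11 := cont_pd (hU 1) 1
  have gc : Continuous (fun x => gnsq U x ^ (p / 2)) := by
    simp_rw [gnsq_eq]
    exact (by fun_prop : Continuous (fun x => pd 0 (fun y => U y 0) x ^ 2 + pd 1 (fun y => U y 0) x ^ 2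
    + pd 0 (fun y => U y 1) x ^ 2 + pd 1 (fun y => U y 1) x ^ 2)).rpow_const (fun _ => Or.inr (by positivity))
  have t : ∫ x in Ω, gnsq U x ^ (p / 2) ≤ 4 ^ (p / 2) * Asum p Ω (fun i x => U x i) := by
    unfold Asum
    rw [← integral_add (h.intOn c00) (h.intOn c10), ← integral_add (ion_add (h.intOn c00) (h.intOn c10)) (h.intOn c01),
      ← integral_add (ion_add (ion_add (h.intOn c00) (h.intOn c10)) (h.intOn c01)) (h.intOn c11), ← integral_const_mul]
    apply integral_mono (h.intOn gc) (h.intOn (by fun_prop))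
    intro x
    show gnsq U x ^ (p / 2) ≤ 4 ^ (p / 2) * (|pd 0 (fun x => U x 0) x| ^ p + |pd 0 (fun x => U x 1) x| ^ p + |pd 1 (fun x => U x 0) x| ^ p + |pd 1 (fun x => U x 1) x| ^ p)
    rw [gnsq_eq]
    refine (add_rpow_le4 (by positivity) (sq_nonneg _) (sq_nonneg _) (sq_nonneg _) (sq_nonneg _)).trans (le_of_eq ?_)
    rw [sq_half_rpow, sq_half_rpow, sq_half_rpow, sq_half_rpow]; ring
  have e1 : ∀ x, |pd 0 (fun x => U x 0) x + pd 1 (fun x => U x 1) x| = |div2 U x| := fun x => by rw [div2_eq]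
  have e2 : ∀ x, |pd 0 (fun x => U x 1) x - pd 1 (fun x => U x 0) x| = |curl2 U x| := fun x => rfl
  simp only [e1, e2] at key
  have n1 := lps_int_nonneg (Ω := Ω) p (div2 U)
  have n2 := lps_int_nonneg (Ω := Ω) p (curl2 U)
  have n3 := lps_int_nonneg (Ω := Ω) p (fun x => U x 0)
  have n4 := lps_int_nonneg (Ω := Ω) p (fun x => U x 1)
  have t2 := t.trans (mul_le_mul_of_nonneg_left key (by positivity))
  rw [← mul_assoc] at t2
  unfold LpG
  calc _ ≤ _ := Real.rpow_le_rpow (integral_nonneg fun x => Real.rpow_nonneg (gnsq_nonneg U x) _) t2 (by positivity)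
    _ = _ := Real.mul_rpow (by positivity) (by positivity)
    _ ≤ _ := by
      gcongr
      rw [← add_assoc]
      have hp1 : 1 ≤ p := by linarith
      refine (root_add hp1 (by positivity) n4).trans ?_
      unfold LpS
      gcongr
      refine (root_add hp1 (by positivity) n3).trans ?_
      gcongr
      exact root_add hp1 n1 n2

lemma c_rpow_le {c t a : ℝ} (hc : 1 ≤ c) (ht : t ≤ 1) (ha : 0 ≤ a) : (c * a) ^ t ≤ c * a ^ t := by
  rw [Real.mul_rpow (by linarith) ha]
  gcongr
  calc c ^ t ≤ c ^ (1:ℝ) := Real.rpow_le_rpow_of_exponent_le hc ht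
    _ = c := Real.rpow_one c

set_option maxHeartbeats 4000000 in
theorem main_abs (h : DomFn Ω φ) {p : ℝ} (hp : 2 < p) {μ : ℝ} (hμ : 0 < μ) : ∃ C > (0:ℝ), ∀ (U : V2 → V2) (Q : V2 → ℝ) (L X : ℝ),
    (∀ i, ContDiff ℝ (⊤ : ℕ∞) (fun x => U x i)) → ContDiff ℝ 1 Q → μ ≤ L → 0 ≤ X →
    (∀ x ∈ frontier Ω, U x 0 * pd 0 φ x + U x 1 * pd 1 φ x = 0) → (∀ x ∈ frontier Ω, curl2 U x = 0) →
    ∫ x in Ω, ((pd 0 (fun y => L * div2 U y - Q y) x - μ * pd 1 (curl2 U) x) ^ 2 +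
      (pd 1 (fun y => L * div2 U y - Q y) x + μ * pd 0 (curl2 U) x) ^ 2) ≤ X ^ 2 →
    LpG p Ω U ≤ C * (LpG 2 Ω U ^ (2 / p) * X ^ (1 - 2 / p) + LpG 2 Ω U + LpS p Ω Q / L
      + LpS 2 Ω Q ^ (2 / p) * X ^ (1 - 2 / p) / L) := by
  obtain ⟨C1, hC1, hdc⟩ := divcurl_norm h hp
  obtain ⟨Cg, hCg, hgn⟩ := gn_norm h hp
  obtain ⟨C3, hC3, hpo⟩ := poincare_tan h
  obtain ⟨C4, hC4, hho⟩ := lps_holder h hp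
  have hp0 : 0 < p := by linarith
  set θ := 2 / p with hθ
  have hth : θ < 1 := by rw [hθ, div_lt_one hp0]; exact hp
  have hth0 : 0 < θ := by positivity
  set m := μ ^ (1 - θ) with hm
  have hm0 : 0 < m := by positivity
  refine ⟨C1 * (2 * Cg * (4 / m + 4 + 2 + 2 * C4) + 2 + Cg * (2 / m + 2) + 4 * Cg * (C3 + 1)), by positivity, ?_⟩
  intro U Q L X hU hQ hL hX hb hcu hH
  have hL0 : 0 < L := hμ.trans_le hL
  have hU1 : ∀ i, ContDiff ℝ 1 (fun x => U x i) := fun i => (hU i).of_le (by simp)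
  have s : ∀ i j, ContDiff ℝ (⊤ : ℕ∞) (pd i (fun x => U x j)) := fun i j => smooth_pd (hU j) i
  have s00 := s 0 0
  have s01 := s 0 1
  have s10 := s 1 0
  have s11 := s 1 1
  have k00 := s00.continuous
  have k01 := s01.continuous
  have k10 := s10.continuous
  have k11 := s11.continuous
  have hdiv : ContDiff ℝ (⊤ : ℕ∞) (div2 U) := by
    have : div2 U = fun x => pd 0 (fun y => U y 0) x + pd 1 (fun y => U y 1) x := funext (div2_eq U)
    rw [this]; exact s00.add s11
  have hcurl : ContDiff ℝ (⊤ : ℕ∞) (curl2 U) := s01.sub s10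
  have hdiv1 : ContDiff ℝ 1 (div2 U) := hdiv.of_le (by simp)
  have hw1 : ContDiff ℝ 1 (curl2 U) := hcurl.of_le (by simp)
  have hw2 : ContDiff ℝ 2 (curl2 U) := contDiff_infty.1 hcurl 2
  set G : V2 → ℝ := fun y => L * div2 U y - Q y with hGdef
  have hG : ContDiff ℝ 1 G := (contDiff_const.mul hdiv1).sub hQ
  have o := orth h hG hw2 hcu
  have G0 := cont_pd hG 0
  have G1 := cont_pd hG 1
  have w0 := cont_pd hw1 0
  have w1 := cont_pd hw1 1
  have gw : Continuous (gnsq U) := by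
    rw [funext (gnsq_eq U)]; fun_prop
  set Y := LpG 2 Ω U with hY
  have Y0 : 0 ≤ Y := lpg_nonneg _ _
  have Y2 : ∫ x in Ω, gnsq U x = Y ^ 2 := (lpg_sq U).symm
  have split : (∫ x in Ω, (pd 0 G x ^ 2 + pd 1 G x ^ 2)) + μ ^ 2 * (∫ x in Ω, (pd 0 (curl2 U) x ^ 2 + pd 1 (curl2 U) x ^ 2)) ≤ X ^ 2 := by
    have e : ∀ x, (pd 0 G x - μ * pd 1 (curl2 U) x) ^ 2 + (pd 1 G x + μ * pd 0 (curl2 U) x) ^ 2 =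
        (pd 0 G x ^ 2 + pd 1 G x ^ 2) + μ ^ 2 * (pd 0 (curl2 U) x ^ 2 + pd 1 (curl2 U) x ^ 2)
        + 2 * μ * (pd 1 G x * pd 0 (curl2 U) x - pd 0 G x * pd 1 (curl2 U) x) := fun x => by ring
    simp_rw [e] at hH
    rw [integral_add (h.intOn (by fun_prop)) (h.intOn (by fun_prop)),
      integral_add (h.intOn (by fun_prop)) (h.intOn (by fun_prop)), integral_const_mul, integral_const_mul, o] at hH
    linarith
  have nG : 0 ≤ ∫ x in Ω, (pd 0 G x ^ 2 + pd 1 G x ^ 2) := integral_nonneg fun x => by positivity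
  have nw : 0 ≤ ∫ x in Ω, (pd 0 (curl2 U) x ^ 2 + pd 1 (curl2 U) x ^ 2) := integral_nonneg fun x => by positivity
  have dG : ∫ x in Ω, (pd 0 G x ^ 2 + pd 1 G x ^ 2) ≤ X ^ 2 := by nlinarith [sq_nonneg μ]
  have dw : ∫ x in Ω, (pd 0 (curl2 U) x ^ 2 + pd 1 (curl2 U) x ^ 2) ≤ (X / μ) ^ 2 := by
    rw [div_pow, le_div_iff₀ (by positivity)]; nlinarith
  have two : ∀ f : V2 → ℝ, Continuous f → (∀ x, f x ^ 2 ≤ 2 * gnsq U x) → LpS 2 Ω f ≤ 2 * Y := fun f hf hfb => by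
    apply lps2_le (by positivity)
    have : ∫ x in Ω, f x ^ 2 ≤ ∫ x in Ω, 2 * gnsq U x :=
      integral_mono (h.intOn (by fun_prop)) (h.intOn (by fun_prop)) hfb
    rw [integral_const_mul, Y2] at this
    nlinarith
  have nw2 : LpS 2 Ω (curl2 U) ≤ 2 * Y := two _ hcurl.continuous fun x => by
    rw [gnsq_eq, curl2]
    nlinarith [sq_nonneg (pd 0 (fun y => U y 1) x + pd 1 (fun y => U y 0) x), sq_nonneg (pd 0 (fun y => U y 0) x), sq_nonneg (pd 1 (fun y => U y 1) x)]
  have nd2 : LpS 2 Ω (div2 U) ≤ 2 * Y := two _ hdiv.continuous fun x => by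
    rw [gnsq_eq, div2_eq]
    nlinarith [sq_nonneg (pd 0 (fun y => U y 0) x - pd 1 (fun y => U y 1) x), sq_nonneg (pd 0 (fun y => U y 1) x), sq_nonneg (pd 1 (fun y => U y 0) x)]
  set Pi2 := LpS 2 Ω Q with hPi
  have Pi0 : 0 ≤ Pi2 := lps_nonneg _ _
  have hc1 := hdiv.continuous
  have hc2 := hQ.continuous
  have hc3 := hG.continuous
  have hLc : Continuous (fun x => L * div2 U x) := by fun_prop
  have nG2 : LpS 2 Ω G ≤ 4 * (L * Y) + 2 * Pi2 := by
    have := lps_add h (p := 2) (by norm_num) hc3 hLc hc2 (fun x _ => by rw [hGdef]; exact abs_sub _ _)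
    rw [lps_smul two_pos hL0.le] at this
    nlinarith [mul_le_mul_of_nonneg_left nd2 hL0.le]
  set W := Y ^ θ * X ^ (1 - θ) with hW
  set Z := Pi2 ^ θ * X ^ (1 - θ) with hZ
  set Qp := LpS p Ω Q with hQp
  have W0 : 0 ≤ W := by positivity
  have Z0 : 0 ≤ Z := by positivity
  have Qp0 : 0 ≤ Qp := lps_nonneg _ _
  have X0 : 0 ≤ X ^ (1 - θ) := by positivity
  have A : LpS p Ω (curl2 U) ≤ Cg * (2 / m * W + 2 * Y) := by
    refine (hgn _ hw1 (2 * Y) (X / μ) nw2 (by positivity) dw).trans ?_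
    have e : (X / μ) ^ (1 - θ) = X ^ (1 - θ) / m := by rw [Real.div_rpow hX hμ.le]
    rw [e]
    have := c_rpow_le (c := 2) (t := θ) (a := Y) (by norm_num) hth.le Y0
    calc Cg * ((2 * Y) ^ θ * (X ^ (1 - θ) / m) + 2 * Y) ≤ Cg * ((2 * Y ^ θ) * (X ^ (1 - θ) / m) + 2 * Y) := by gcongr
      _ = _ := by rw [hW]; ring
  have Lt : L ^ θ ≤ L / m := by
    rw [le_div_iff₀ hm0]
    calc L ^ θ * m ≤ L ^ θ * L ^ (1 - θ) := by
          gcongr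
          exact Real.rpow_le_rpow hμ.le hL (by linarith)
      _ = L := by rw [← Real.rpow_add hL0]; norm_num
  have B : LpS p Ω G ≤ Cg * (4 * (L / m) * W + 2 * Z + 4 * (L * Y) + 2 * Pi2) := by
    refine (hgn _ hG _ X nG2 hX dG).trans ?_
    have b1 : (4 * (L * Y) + 2 * Pi2) ^ θ ≤ 4 * ((L / m) * Y ^ θ) + 2 * Pi2 ^ θ := by
      refine (Real.rpow_add_le_add_rpow (by positivity) (by positivity) hth0.le hth.le).trans ?_
      have u1 := c_rpow_le (c := 4) (t := θ) (a := L * Y) (by norm_num) hth.le (by positivity)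
      have u2 := c_rpow_le (c := 2) (t := θ) (a := Pi2) (by norm_num) hth.le (by positivity)
      have u3 : (L * Y) ^ θ ≤ L / m * Y ^ θ := by
        rw [Real.mul_rpow hL0.le Y0]; gcongr
      linarith
    have := mul_le_mul_of_nonneg_right b1 X0
    apply mul_le_mul_of_nonneg_left _ hCg.le
    rw [hW, hZ]
    linarith
  have D : LpS p Ω (div2 U) ≤ 2 * Cg * (4 / m * W + 2 * (Z / L) + 4 * Y + 2 * C4 * (Qp / L)) + 2 * (Qp / L) := by
    have t := lps_add h (p := p) (by linarith) hLc hc3 hc2 (fun x _ => by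
      have : L * div2 U x = G x + Q x := by rw [hGdef]; ring
      rw [this]; exact abs_add_le _ _)
    rw [lps_smul hp0 hL0.le] at t
    have hh := hho Q hc2
    have t2 : L * LpS p Ω (div2 U) ≤ 2 * (Cg * (4 * (L / m) * W + 2 * Z + 4 * (L * Y) + 2 * (C4 * Qp)) + Qp) := by
      refine t.trans ?_
      gcongr
      refine B.trans ?_
      gcongr
    have : LpS p Ω (div2 U) ≤ (2 * (Cg * (4 * (L / m) * W + 2 * Z + 4 * (L * Y) + 2 * (C4 * Qp)) + Qp)) / L := by
      rw [le_div_iff₀ hL0]; linarith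
    refine this.trans (le_of_eq ?_)
    field_simp
  have F : ∀ i, LpS p Ω (fun x => U x i) ≤ 2 * Cg * (C3 + 1) * Y := by
    have po := hpo (fun i x => U x i) hU1 hb
    have e : ∫ x in Ω, (pd 0 (fun x => U x 0) x ^ 2 + pd 0 (fun x => U x 1) x ^ 2 + pd 1 (fun x => U x 0) x ^ 2 + pd 1 (fun x => U x 1) x ^ 2) = Y ^ 2 := by
      rw [← Y2]; congr 1; ext x; rw [gnsq_eq]; ring
    have po : ∫ x in Ω, (U x 0 ^ 2 + U x 1 ^ 2) ≤ C3 * Y ^ 2 := by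
      rw [← e]; exact po
    intro i
    have cU := fun i => (hU1 i).continuous
    have cU0 := cU 0
    have cU1 := cU 1
    have n2 : LpS 2 Ω (fun x => U x i) ≤ (C3 + 1) * Y := by
      apply lps2_le (by positivity)
      have : ∫ x in Ω, U x i ^ 2 ≤ ∫ x in Ω, (U x 0 ^ 2 + U x 1 ^ 2) := by
        apply integral_mono (h.intOn ((cU i).pow 2)) (h.intOn (by fun_prop))
        intro x
        show U x i ^ 2 ≤ U x 0 ^ 2 + U x 1 ^ 2
        fin_cases i
        · simpa using sq_nonneg (U x 1)
        · simpa using sq_nonneg (U x 0)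
      nlinarith [mul_nonneg hC3.le (sq_nonneg Y), mul_nonneg (mul_nonneg hC3.le hC3.le) (sq_nonneg Y), sq_nonneg Y]
    have n3 : ∫ x in Ω, (pd 0 (fun x => U x i) x ^ 2 + pd 1 (fun x => U x i) x ^ 2) ≤ Y ^ 2 := by
      rw [← Y2]
      have z0 := s 0 i |>.continuous
      have z1 := s 1 i |>.continuous
      apply integral_mono (h.intOn (by fun_prop)) (h.intOn gw)
      intro x
      show pd 0 (fun x => U x i) x ^ 2 + pd 1 (fun x => U x i) x ^ 2 ≤ gnsq U x
      rw [gnsq_eq]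
      fin_cases i
      · show pd 0 (fun x => U x 0) x ^ 2 + pd 1 (fun x => U x 0) x ^ 2 ≤ _
        nlinarith [sq_nonneg (pd 0 (fun x => U x 1) x), sq_nonneg (pd 1 (fun x => U x 1) x)]
      · show pd 0 (fun x => U x 1) x ^ 2 + pd 1 (fun x => U x 1) x ^ 2 ≤ _
        nlinarith [sq_nonneg (pd 0 (fun x => U x 0) x), sq_nonneg (pd 1 (fun x => U x 0) x)]
    refine (hgn _ (hU1 i) _ Y n2 Y0 n3).trans ?_
    have := c_rpow_le (c := C3 + 1) (t := θ) (a := Y) (by linarith) hth.le Y0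
    have e : Y ^ θ * Y ^ (1 - θ) = Y := by
      rw [← Real.rpow_add_of_nonneg Y0 hth0.le (by linarith)]; norm_num
    calc Cg * (((C3 + 1) * Y) ^ θ * Y ^ (1 - θ) + (C3 + 1) * Y) ≤ Cg * (((C3 + 1) * Y ^ θ) * Y ^ (1 - θ) + (C3 + 1) * Y) := by gcongr
      _ = Cg * ((C3 + 1) * (Y ^ θ * Y ^ (1 - θ)) + (C3 + 1) * Y) := by ring
      _ = _ := by rw [e]; ring
  refine (hdc U hU1 hb).trans ?_
  rw [mul_assoc]
  apply mul_le_mul_of_nonneg_left _ hC1.le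
  have F0 := F 0
  have F1 := F 1
  set q := Qp / L with hq
  set z := Z / L with hz
  have q0 : 0 ≤ q := by positivity
  have z0 : 0 ≤ z := by positivity
  have im : 0 ≤ m⁻¹ := by positivity
  have fin : 2 * Cg * (4 / m * W + 2 * z + 4 * Y + 2 * C4 * q) + 2 * q + Cg * (2 / m * W + 2 * Y) + 4 * Cg * (C3 + 1) * Y ≤
      (2 * Cg * (4 / m + 4 + 2 + 2 * C4) + 2 + Cg * (2 / m + 2) + 4 * Cg * (C3 + 1)) * (W + Y + q + z) := by
    have e : (2 * Cg * (4 / m + 4 + 2 + 2 * C4) + 2 + Cg * (2 / m + 2) + 4 * Cg * (C3 + 1)) * (W + Y + q + z) -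
      (2 * Cg * (4 / m * W + 2 * z + 4 * Y + 2 * C4 * q) + 2 * q + Cg * (2 / m * W + 2 * Y) + 4 * Cg * (C3 + 1) * Y) =
      2 * Cg * (4 / m * (Y + q + z) + 4 * (W + q + z) + 2 * (W + Y + q) + 2 * C4 * (W + Y + z)) + 2 * (W + Y + z)
        + Cg * (2 / m * (Y + q + z) + 2 * (W + q + z)) + 4 * Cg * (C3 + 1) * (W + q + z) := by ring
    have : 0 ≤ 2 * Cg * (4 / m * (Y + q + z) + 4 * (W + q + z) + 2 * (W + Y + q) + 2 * C4 * (W + Y + z)) + 2 * (W + Y + z)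
        + Cg * (2 / m * (Y + q + z) + 2 * (W + q + z)) + 4 * Cg * (C3 + 1) * (W + q + z) := by positivity
    linarith
  linarith

end



lemma sm_slice {f : ℝ → V2 → ℝ} (hf : Smooth2 f) (t : ℝ) : ContDiff ℝ (⊤ : ℕ∞) (f t) := by
  have : f t = (fun p : ℝ × V2 => f p.1 p.2) ∘ (fun x => (t, x)) := rfl
  rw [this]
  exact ContDiff.comp hf (contDiff_const.prodMk contDiff_id)

lemma sm_time {f : ℝ → V2 → ℝ} (hf : Smooth2 f) (t : ℝ) (x : V2) : DifferentiableAt ℝ (fun s => f s x) t := by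
  have : (fun s => f s x) = (fun p : ℝ × V2 => f p.1 p.2) ∘ (fun s => (s, x)) := rfl
  rw [this]
  exact (ContDiff.comp hf (contDiff_id.prodMk contDiff_const)).differentiable (by simp) t

lemma sm_dt {f : ℝ → V2 → ℝ} (hf : Smooth2 f) (t : ℝ) : Continuous (dt f t) := by
  have hd : Continuous (fderiv ℝ (fun p : ℝ × V2 => f p.1 p.2)) := ContDiff.continuous_fderiv hf (by simp)
  have e : dt f t = fun x => fderiv ℝ (fun p : ℝ × V2 => f p.1 p.2) (t, x) (1, 0) := by
    ext x
    have h1 : HasFDerivAt (fun p : ℝ × V2 => f p.1 p.2) (fderiv ℝ (fun p : ℝ × V2 => f p.1 p.2) (t, x)) (t, x) :=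
      (ContDiff.differentiable hf (by simp) (t, x)).hasFDerivAt
    have h2 : HasDerivAt (fun s : ℝ => (s, x)) ((1 : ℝ), (0 : V2)) t := (hasDerivAt_id t).prodMk (hasDerivAt_const t x)
    exact (h1.comp_hasDerivAt t h2).deriv
  rw [e]
  exact (hd.comp (by fun_prop)).clm_apply continuous_const

lemma dot_eq (a b : V2) : dot a b = a 0 * b 0 + a 1 * b 1 := by simp [dot, Fin.sum_univ_two]

lemma nsq_eq2 (a : V2) : nsq a = a 0 ^ 2 + a 1 ^ 2 := by simp [nsq, Fin.sum_univ_two]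

lemma pd_nsq {U : V2 → V2} {x : V2} (hU : ∀ i, ContDiff ℝ (⊤ : ℕ∞) (fun x => U x i)) (i : Fin 2) :
    pd i (fun y => nsq (U y)) x = 2 * (U x 0 * pd i (fun y => U y 0) x + U x 1 * pd i (fun y => U y 1) x) := by
  have d : ∀ i, DifferentiableAt ℝ (fun y => U y i) x := fun i => (hU i).differentiable (by simp) x
  have e : (fun y => nsq (U y)) = fun y => (fun y => U y 0 * U y 0) y + (fun y => U y 1 * U y 1) y := by
    ext y; rw [nsq_eq2]; ring
  rw [e, pd_add (f := fun y => U y 0 * U y 0) (g := fun y => U y 1 * U y 1) ((d 0).mul (d 0)) ((d 1).mul (d 1)), pd_mul (d 0) (d 0), pd_mul (d 1) (d 1)]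
  ring

lemma mom_lhs {ρ : ℝ → V2 → ℝ} {u : ℝ → V2 → V2} (hρ : Smooth2 ρ) (hu : Smooth2V u) (t : ℝ) (x : V2)
    (hm : dt ρ t x + div2 (fun y j => ρ t y * u t y j) x = 0) (i : Fin 2) :
    dt (fun s y => ρ s y * u s y i) t x + (∑ j, pd j (fun y => ρ t y * u t y i * u t y j) x) = ρ t x * matD u t x i := by
  have dr : DifferentiableAt ℝ (ρ t) x := (sm_slice hρ t).differentiable (by simp) x
  have d : ∀ i, DifferentiableAt ℝ (fun y => u t y i) x := fun i => (sm_slice (hu i) t).differentiable (by simp) x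
  have e1 : dt (fun s y => ρ s y * u s y i) t x = dt ρ t x * u t x i + ρ t x * dt (fun s y => u s y i) t x :=
    deriv_fun_mul (sm_time hρ t x) (sm_time (hu i) t x)
  have e2 : ∀ j, pd j (fun y => ρ t y * u t y i * u t y j) x =
      u t x i * pd j (fun y => ρ t y * u t y j) x + ρ t x * u t x j * pd j (fun y => u t y i) x := fun j => by
    have : (fun y => ρ t y * u t y i * u t y j) = fun y => (fun y => u t y i) y * (fun y => ρ t y * u t y j) y := by
      ext y; ring
    rw [this, pd_mul (f := fun y => u t y i) (g := fun y => ρ t y * u t y j) (d i) (dr.mul (d j))]; ring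
  rw [div2_eq] at hm
  rw [e1, Fin.sum_univ_two, e2, e2, matD, dot_eq]
  simp only [grad]
  linear_combination u t x i * hm

lemma visc0 {U : V2 → V2} (hU : ∀ i, ContDiff ℝ (⊤ : ℕ∞) (fun x => U x i)) (x : V2) :
    lap (fun y => U y 0) x = pd 0 (div2 U) x - pd 1 (curl2 U) x ∧
    lap (fun y => U y 1) x = pd 1 (div2 U) x + pd 0 (curl2 U) x := by
  have s : ∀ i j, DifferentiableAt ℝ (pd i (fun x => U x j)) x := fun i j => (smooth_pd (hU j) i).differentiable (by simp) x
  have y0 := pd_symm (contDiff_infty.1 (hU 0) 2) x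
  have y1 := pd_symm (contDiff_infty.1 (hU 1) 2) x
  have ed : div2 U = fun x => pd 0 (fun y => U y 0) x + pd 1 (fun y => U y 1) x := funext (div2_eq U)
  have ec : curl2 U = fun x => pd 0 (fun y => U y 1) x - pd 1 (fun y => U y 0) x := rfl
  rw [ed, ec, pd_add (s 0 0) (s 1 1), pd_add (s 0 0) (s 1 1), pd_sub (s 0 1) (s 1 0), pd_sub (s 0 1) (s 1 0)]
  simp only [lap, Fin.sum_univ_two]
  constructor <;> linarith

lemma cs_bound (m0 m1 b0 b1 d00 d01 d10 d11 : ℝ) :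
    (m0 - (b0 * d00 + b1 * d10) + (b0 * d00 + b1 * d01)) ^ 2 + (m1 - (b0 * d01 + b1 * d11) + (b0 * d10 + b1 * d11)) ^ 2
    ≤ 2 * (m0 ^ 2 + m1 ^ 2) + 8 * ((b0 ^ 2 + b1 ^ 2) * (d00 ^ 2 + d10 ^ 2 + d01 ^ 2 + d11 ^ 2)) := by
  have a : (m0 - (b0 * d00 + b1 * d10) + (b0 * d00 + b1 * d01)) ^ 2 ≤ 2 * m0 ^ 2 + 2 * (b1 * (d01 - d10)) ^ 2 := by
    nlinarith [sq_nonneg (m0 - b1 * (d01 - d10))]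
  have b : (m1 - (b0 * d01 + b1 * d11) + (b0 * d10 + b1 * d11)) ^ 2 ≤ 2 * m1 ^ 2 + 2 * (b0 * (d10 - d01)) ^ 2 := by
    nlinarith [sq_nonneg (m1 - b0 * (d10 - d01))]
  have c : (d01 - d10) ^ 2 ≤ 4 * (d00 ^ 2 + d10 ^ 2 + d01 ^ 2 + d11 ^ 2) := by
    nlinarith [sq_nonneg (d01 + d10), sq_nonneg d00, sq_nonneg d11, sq_nonneg d01, sq_nonneg d10]
  have e := mul_le_mul_of_nonneg_left c (by positivity : 0 ≤ b0 ^ 2 + b1 ^ 2)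
  linarith

lemma H_bound {Ω : Set V2} {φ : V2 → ℝ} {n : V2 → V2} (h : DomFn Ω φ) {a γ μ lam ν : ℝ} {I : Set ℝ}
    {ρ : ℝ → V2 → ℝ} {u B : ℝ → V2 → V2} (hρ : Smooth2 ρ) (hu : Smooth2V u) (hB : Smooth2V B)
    (hs : IsMHDSol Ω n a γ μ lam ν I ρ u B) {t : ℝ} (ht : t ∈ I) (c : ℝ)
    (hQ : ContDiff ℝ 1 (fun x => a * ρ t x ^ γ - c)) :
    ∫ x in Ω, ((pd 0 (fun y => (2 * μ + lam) * div2 (u t) y - (a * ρ t y ^ γ - c)) x - μ * pd 1 (curl2 (u t)) x) ^ 2 +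
      (pd 1 (fun y => (2 * μ + lam) * div2 (u t) y - (a * ρ t y ^ γ - c)) x + μ * pd 0 (curl2 (u t)) x) ^ 2)
    ≤ (3 * (LpV 2 Ω (fun x k => ρ t x * matD u t x k)
        + LpS 2 Ω (fun x => Real.sqrt (nsq (B t x)) * Real.sqrt (gnsq (B t) x)))) ^ 2 := by
  have hU : ∀ i, ContDiff ℝ (⊤ : ℕ∞) (fun x => u t x i) := fun i => sm_slice (hu i) t
  have hb : ∀ i, ContDiff ℝ (⊤ : ℕ∞) (fun x => B t x i) := fun i => sm_slice (hB i) t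
  have hdiv : ContDiff ℝ (⊤ : ℕ∞) (div2 (u t)) := by
    rw [funext (div2_eq (u t))]; exact (smooth_pd (hU 0) 0).add (smooth_pd (hU 1) 1)
  have hcurl : ContDiff ℝ (⊤ : ℕ∞) (curl2 (u t)) := (smooth_pd (hU 1) 0).sub (smooth_pd (hU 0) 1)
  have hdiv1 : ContDiff ℝ 1 (div2 (u t)) := hdiv.of_le (by simp)
  have hG : ContDiff ℝ 1 (fun y => (2 * μ + lam) * div2 (u t) y - (a * ρ t y ^ γ - c)) := (contDiff_const.mul hdiv1).sub hQ
  have hP : ContDiff ℝ 1 (fun x => a * ρ t x ^ γ) := by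
    have := hQ.add (contDiff_const (c := c)); simpa using this
  have G0 := cont_pd hG 0
  have G1 := cont_pd hG 1
  have w0 := (smooth_pd hcurl 0).continuous
  have w1 := (smooth_pd hcurl 1).continuous
  have cb0 := (hb 0).continuous
  have cb1 := (hb 1).continuous
  have cu0 := (hU 0).continuous
  have cu1 := (hU 1).continuous
  have cr := (sm_slice hρ t).continuous
  have cbp : ∀ i j, Continuous (pd i (fun y => B t y j)) := fun i j => (smooth_pd (hb j) i).continuous
  have cup : ∀ i j, Continuous (pd i (fun y => u t y j)) := fun i j => (smooth_pd (hU j) i).continuous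
  have b00 := cbp 0 0
  have b01 := cbp 0 1
  have b10 := cbp 1 0
  have b11 := cbp 1 1
  have u00 := cup 0 0
  have u01 := cup 0 1
  have u10 := cup 1 0
  have u11 := cup 1 1
  have cm : ∀ i, Continuous (fun x => matD u t x i) := fun i => by
    have k0 := sm_dt (hu i) t
    have k1 := cup 0 i
    have k2 := cup 1 i
    simp only [matD, dot_eq, grad]
    fun_prop
  have cm0 := cm 0
  have cm1 := cm 1
  have cV : Continuous (fun x => nsq (fun k => ρ t x * matD u t x k)) := by
    simp only [nsq_eq2]; fun_prop
  have cN : Continuous (fun x => nsq (B t x) * gnsq (B t) x) := by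
    simp only [nsq_eq2, gnsq_eq]; fun_prop
  have eG : ∀ i x, pd i (fun y => (2 * μ + lam) * div2 (u t) y - (a * ρ t y ^ γ - c)) x =
      (2 * μ + lam) * pd i (div2 (u t)) x - pd i (fun y => a * ρ t y ^ γ) x := fun i x => by
    have dd := hdiv1.differentiable (by simp) x
    have dP := hP.differentiable (by simp) x
    rw [pd_sub (f := fun y => (2 * μ + lam) * div2 (u t) y) (g := fun y => a * ρ t y ^ γ - c) (dd.const_mul _) (dP.sub_const c),
      pd_const_mul _ dd, pd_sub (f := fun y => a * ρ t y ^ γ) (g := fun _ => c) dP (differentiableAt_const c)]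
    simp [pd]
  have key : ∫ x in Ω, ((pd 0 (fun y => (2 * μ + lam) * div2 (u t) y - (a * ρ t y ^ γ - c)) x - μ * pd 1 (curl2 (u t)) x) ^ 2 +
      (pd 1 (fun y => (2 * μ + lam) * div2 (u t) y - (a * ρ t y ^ γ - c)) x + μ * pd 0 (curl2 (u t)) x) ^ 2) ≤
      ∫ x in Ω, (2 * nsq (fun k => ρ t x * matD u t x k) + 8 * (nsq (B t x) * gnsq (B t) x)) := by
    apply setIntegral_mono_on (h.intOn (by fun_prop)) (h.intOn (by fun_prop)) h.isOpen.measurableSet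
    intro x hx
    have q := cs_bound (ρ t x * matD u t x 0) (ρ t x * matD u t x 1) (B t x 0) (B t x 1) (pd 0 (fun y => B t y 0) x)
      (pd 0 (fun y => B t y 1) x) (pd 1 (fun y => B t y 0) x) (pd 1 (fun y => B t y 1) x)
    have m0 := hs.momentum t ht x hx 0
    have m1 := hs.momentum t ht x hx 1
    rw [mom_lhs hρ hu t x (hs.mass t ht x hx), pd_nsq hb, dot_eq] at m0 m1
    simp only [grad] at m0 m1
    rw [(visc0 hU x).1] at m0
    rw [(visc0 hU x).2] at m1
    rw [nsq_eq2, nsq_eq2, gnsq_eq, eG, eG]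
    refine le_trans (le_of_eq ?_) q
    congr 2
    · linear_combination -m0
    · linear_combination -m1
  refine key.trans ?_
  rw [integral_add (h.intOn (by fun_prop)) (h.intOn (by fun_prop)), integral_const_mul, integral_const_mul, ← lpv_sq]
  have eN : ∫ x in Ω, nsq (B t x) * gnsq (B t) x =
      LpS 2 Ω (fun x => Real.sqrt (nsq (B t x)) * Real.sqrt (gnsq (B t) x)) ^ 2 := by
    rw [lps_sq]
    congr 1; ext x
    rw [mul_pow, Real.sq_sqrt (by rw [nsq_eq2]; positivity), Real.sq_sqrt (gnsq_nonneg _ _)]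
  rw [eN]
  have v0 : 0 ≤ LpV 2 Ω (fun x k => ρ t x * matD u t x k) :=
    Real.rpow_nonneg (integral_nonneg fun x => Real.rpow_nonneg (by rw [nsq_eq2]; positivity) _) _
  have v1 := lps_nonneg (Ω := Ω) 2 (fun x => Real.sqrt (nsq (B t x)) * Real.sqrt (gnsq (B t) x))
  nlinarith [mul_nonneg v0 v1, sq_nonneg (LpV 2 Ω (fun x k => ρ t x * matD u t x k)),
    sq_nonneg (LpS 2 Ω (fun x => Real.sqrt (nsq (B t x)) * Real.sqrt (gnsq (B t) x)))]

/-- Lemma 2.7, estimate (2.8).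
For smooth solutions of compressible MHD with Navier-slip boundary conditions and
`2 ≤ p < ∞`, with `C = C(p, μ, Ω)`:
`‖∇u‖_{L^p} ≤ C(‖ρu̇‖_{L²}+‖|B||∇B|‖_{L²})^{1−2/p}‖∇u‖_{L²}^{2/p} + C‖∇u‖_{L²}
  + C(2μ+λ)⁻¹(‖P−P̄‖_{L^p} + ‖B‖²_{L^{2p}})
  + C(2μ+λ)⁻¹‖P−P̄‖_{L²}^{2/p}(‖ρu̇‖_{L²}+‖∇u‖_{L²}+‖|B||∇B|‖_{L²})^{1−2/p}`. -/
theorem stmt_10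
    (Ω : Set V2) (n : V2 → V2) (hΩ : SmoothDomain Ω n) (hconv : Convex ℝ Ω)
    (μ : ℝ) (hμ : 0 < μ) (p : ℝ) (hp : 2 ≤ p) :
    ∃ C > (0:ℝ), ∀ (a γ lam ν T : ℝ) (ρ : ℝ → V2 → ℝ) (u B : ℝ → V2 → V2),
      0 < a → 1 < γ → 0 ≤ μ + lam → 0 < ν → 0 < T →
      Smooth2 ρ → Smooth2V u → Smooth2V B →
      IsMHDSol Ω n a γ μ lam ν (Ioc 0 T) ρ u B →
      ∀ t ∈ Ioc 0 T,
        LpG p Ω (u t)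
          ≤ C * (LpV 2 Ω (fun x k => ρ t x * matD u t x k)
                + LpS 2 Ω (fun x => Real.sqrt (nsq (B t x)) * Real.sqrt (gnsq (B t) x)))
                  ^ (1 - 2 / p)
              * (LpG 2 Ω (u t)) ^ (2 / p)
            + C * LpG 2 Ω (u t)
            + C / (2 * μ + lam)
              * (LpS p Ω (fun x => a * ρ t x ^ γ - Pbar Ω a γ ρ t)
                  + (LpV (2 * p) Ω (B t)) ^ 2)
            + C / (2 * μ + lam)
              * (LpS 2 Ω (fun x => a * ρ t x ^ γ - Pbar Ω a γ ρ t)) ^ (2 / p)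
              * (LpV 2 Ω (fun x k => ρ t x * matD u t x k)
                  + LpG 2 Ω (u t)
                  + LpS 2 Ω (fun x => Real.sqrt (nsq (B t x)) * Real.sqrt (gnsq (B t) x)))
                    ^ (1 - 2 / p) := by
  have nL : ∀ (q : ℝ) (V : V2 → V2), 0 ≤ LpV q Ω V := fun q V =>
    Real.rpow_nonneg (integral_nonneg fun x => Real.rpow_nonneg (by rw [nsq_eq2]; positivity) _) _
  rcases hp.eq_or_lt with rfl | hp2
  · refine ⟨1, one_pos, ?_⟩
    intro a γ lam ν T ρ u B ha hγ hml hν hT hρ hu hB hs t ht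
    have hL : 0 < 2 * μ + lam := by linarith
    have n1 := nL 2 (fun x k => ρ t x * matD u t x k)
    have n2 := nL (2 * 2) (B t)
    have n3 := lps_nonneg (Ω := Ω) 2 (fun x => Real.sqrt (nsq (B t x)) * Real.sqrt (gnsq (B t) x))
    have n4 := lps_nonneg (Ω := Ω) 2 (fun x => a * ρ t x ^ γ - Pbar Ω a γ ρ t)
    have n5 := lpg_nonneg (Ω := Ω) 2 (u t)
    generalize LpV 2 Ω (fun x k => ρ t x * matD u t x k) = z1 at *
    generalize LpV (2 * 2) Ω (B t) = z2 at *
    generalize LpS 2 Ω (fun x => Real.sqrt (nsq (B t x)) * Real.sqrt (gnsq (B t) x)) = z3 at *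
    generalize LpS 2 Ω (fun x => a * ρ t x ^ γ - Pbar Ω a γ ρ t) = z4 at *
    generalize LpG 2 Ω (u t) = z5 at *
    have f1 : 0 ≤ 1 * (z1 + z3) ^ (1 - 2 / 2 : ℝ) * z5 ^ (2 / 2 : ℝ) := by positivity
    have f2 : 0 ≤ 1 / (2 * μ + lam) * (z4 + z2 ^ 2) := by positivity
    have f3 : 0 ≤ 1 / (2 * μ + lam) * z4 ^ (2 / 2 : ℝ) * (z1 + z5 + z3) ^ (1 - 2 / 2 : ℝ) := by positivity
    calc z5 = 0 + 1 * z5 + 0 + 0 := by ring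
      _ ≤ _ := add_le_add (add_le_add (add_le_add f1 le_rfl) f2) f3
  · obtain ⟨φ, hφ, hΩe, hfr, hgr, hn⟩ := hΩ.defining
    have h : DomFn Ω φ := ⟨hΩ.nonempty, hΩ.bounded, hφ, hΩe, hfr, hgr, hconv⟩
    obtain ⟨C, hC, hmain⟩ := main_abs h hp2 hμ
    refine ⟨3 * C, by positivity, ?_⟩
    intro a γ lam ν T ρ u B ha hγ hml hν hT hρ hu hB hs t ht
    have hL : 0 < 2 * μ + lam := by linarith
    have hQ : ContDiff ℝ 1 (fun x => a * ρ t x ^ γ - Pbar Ω a γ ρ t) := by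
      have r1 : ContDiff ℝ 1 (ρ t) := (sm_slice hρ t).of_le (by simp)
      have r2 : ContDiff ℝ ((1 : ℕ) : WithTop ℕ∞) (fun y : ℝ => y ^ γ) := Real.contDiff_rpow_const_of_le (by simpa using hγ.le)
      have r3 : ContDiff ℝ 1 (fun x => ρ t x ^ γ) := ContDiff.comp (g := fun y : ℝ => y ^ γ) (by simpa using r2) r1
      exact (contDiff_const.mul r3).sub contDiff_const
    have hbd : ∀ x ∈ frontier Ω, u t x 0 * pd 0 φ x + u t x 1 * pd 1 φ x = 0 := fun x hx => by
      have e := (hs.slipU t ht x hx).1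
      have g0 : 0 < nsq (grad φ x) := by
        rw [nsq_eq2]
        by_contra hc
        apply hgr x hx
        have a0 : grad φ x 0 = 0 := by nlinarith [sq_nonneg (grad φ x 0), sq_nonneg (grad φ x 1)]
        have a1 : grad φ x 1 = 0 := by nlinarith [sq_nonneg (grad φ x 0), sq_nonneg (grad φ x 1)]
        ext i; fin_cases i
        · exact a0
        · exact a1
      have s0 : (Real.sqrt (nsq (grad φ x)))⁻¹ ≠ 0 := inv_ne_zero (Real.sqrt_pos.2 g0).ne'
      rw [hn x hx, dot_eq] at e
      simp only [Pi.smul_apply, smul_eq_mul, grad] at e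
      have e' : (Real.sqrt (nsq (grad φ x)))⁻¹ * (u t x 0 * pd 0 φ x + u t x 1 * pd 1 φ x) = 0 := by
        rw [← e]

        ring
      exact (mul_eq_zero.1 e').resolve_left s0
    have hcu : ∀ x ∈ frontier Ω, curl2 (u t) x = 0 := fun x hx => (hs.slipU t ht x hx).2
    have n1 := nL 2 (fun x k => ρ t x * matD u t x k)
    have n2 := nL (2 * p) (B t)
    have n3 := lps_nonneg (Ω := Ω) 2 (fun x => Real.sqrt (nsq (B t x)) * Real.sqrt (gnsq (B t) x))
    have n4 := lps_nonneg (Ω := Ω) 2 (fun x => a * ρ t x ^ γ - Pbar Ω a γ ρ t)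
    have n5 := lpg_nonneg (Ω := Ω) 2 (u t)
    have n6 := lps_nonneg (Ω := Ω) p (fun x => a * ρ t x ^ γ - Pbar Ω a γ ρ t)
    have key := hmain (u t) (fun x => a * ρ t x ^ γ - Pbar Ω a γ ρ t) (2 * μ + lam)
      (3 * (LpV 2 Ω (fun x k => ρ t x * matD u t x k)
        + LpS 2 Ω (fun x => Real.sqrt (nsq (B t x)) * Real.sqrt (gnsq (B t) x))))
      (fun i => sm_slice (hu i) t) hQ (by linarith) (by positivity) hbd hcu (H_bound h hρ hu hB hs ht _ hQ)
    refine key.trans ?_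
    generalize LpV 2 Ω (fun x k => ρ t x * matD u t x k) = z1 at *
    generalize LpV (2 * p) Ω (B t) = z2 at *
    generalize LpS 2 Ω (fun x => Real.sqrt (nsq (B t x)) * Real.sqrt (gnsq (B t) x)) = z3 at *
    generalize LpS 2 Ω (fun x => a * ρ t x ^ γ - Pbar Ω a γ ρ t) = z4 at *
    generalize LpG 2 Ω (u t) = z5 at *
    generalize LpS p Ω (fun x => a * ρ t x ^ γ - Pbar Ω a γ ρ t) = z6 at *
    generalize 2 * μ + lam = L at *
    have hp0 : 0 < p := by linarith
    have th0 : 0 < 2 / p := by positivity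
    have th1 : 2 / p < 1 := by rw [div_lt_one hp0]; exact hp2
    generalize 2 / p = θ at *
    have c1 : (3 * (z1 + z3)) ^ (1 - θ) ≤ 3 * (z1 + z3) ^ (1 - θ) := c_rpow_le (by norm_num) (by linarith) (by positivity)
    have c2 : (z1 + z3) ^ (1 - θ) ≤ (z1 + z5 + z3) ^ (1 - θ) :=
      Real.rpow_le_rpow (by positivity) (by linarith) (by linarith)
    have a5 : 0 ≤ z5 ^ θ := by positivity
    have a4 : 0 ≤ z4 ^ θ / L := by positivity
    have e1 := mul_le_mul_of_nonneg_left c1 a5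
    have e2 := mul_le_mul_of_nonneg_left (c1.trans (mul_le_mul_of_nonneg_left c2 (by norm_num : (0:ℝ) ≤ 3))) a4
    have a6 : 0 ≤ z6 / L := by positivity
    have a2 : 0 ≤ z2 ^ 2 / L := by positivity
    have tot : z5 ^ θ * (3 * (z1 + z3)) ^ (1 - θ) + z5 + z6 / L + z4 ^ θ * (3 * (z1 + z3)) ^ (1 - θ) / L ≤
        3 * (z5 ^ θ * (z1 + z3) ^ (1 - θ)) + 3 * z5 + 3 * (z6 / L) + 3 * (z2 ^ 2 / L) + 3 * (z4 ^ θ / L * (z1 + z5 + z3) ^ (1 - θ)) := by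
      have e3 : z4 ^ θ * (3 * (z1 + z3)) ^ (1 - θ) / L = z4 ^ θ / L * (3 * (z1 + z3)) ^ (1 - θ) := by ring
      rw [e3]
      linarith
    refine (mul_le_mul_of_nonneg_left tot hC.le).trans (le_of_eq ?_)
    ring

end MHD
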